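/- Let T and U be computable consistent extensions of PA and n ≥ 1. The following are equivalent: (1) (T,U) is a C^∧_n-pair, i.e., both T + Th_{Σ_n∧Π_n}(U) and U + Th_{Σ_n∧Π_n}(T) are consistent; (2) there is a B(Σ_n) sentence in HCons(Σ_n∧Π_n,T) ∩ HCons(Σ_n∧Π_n,U) \ (Th(T) ∪ Th(U)); (3) there is a sentence φ ∈ HCons(Σ_n∧Π_n,T) ∩ HCons(Σ_n∧Π_n,U) together with a B(Σ_n) sentence ψ such that PA + φ ⊢ ψ, T ⊬ ψ, and U ⊬ ψ; (4) there is a sentence in HCons(Σ_n∧Π_n,T) ∩ HCons(Σ_n∧Π_n,U) \ (Th(T) ∪ Th(U)). -/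

import Mathlib

open FirstOrder Language
open scoped FirstOrder

namespace Guaspari

/-- The first-order language of arithmetic: a constant `0`, a unary function `S`,
binary functions `+` (coded `false`) and `·` (coded `true`), and a binary relation `≤`. -/
def LA : FirstOrder.Language :=
  ⟨fun n => match n with | 0 => Unit | 1 => Unit | 2 => Bool | _ => Empty,
   fun n => match n with | 2 => Unit | _ => Empty⟩

/-- Sentences of the language of arithmetic. -/
abbrev Snt : Type := LA.Sentence

/-- Theories (sets of sentences) in the language of arithmetic. -/
abbrev Thy : Type := LA.Theory

/-- The term `0`. -/
def zeroT {α : Type} {n : ℕ} : LA.Term (α ⊕ Fin n) :=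
  Constants.term (show LA.Constants from Unit.unit)

/-- The term `S t`. -/
def succT {α : Type} {n : ℕ} (t : LA.Term (α ⊕ Fin n)) : LA.Term (α ⊕ Fin n) :=
  Functions.apply₁ (show LA.Functions 1 from Unit.unit) t

/-- The term `t + u`. -/
def addT {α : Type} {n : ℕ} (t u : LA.Term (α ⊕ Fin n)) : LA.Term (α ⊕ Fin n) :=
  Functions.apply₂ (show LA.Functions 2 from false) t u

/-- The term `t * u`. -/
def mulT {α : Type} {n : ℕ} (t u : LA.Term (α ⊕ Fin n)) : LA.Term (α ⊕ Fin n) :=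
  Functions.apply₂ (show LA.Functions 2 from true) t u

/-- The atomic formula `t ≤ u`. -/
def leF {α : Type} {n : ℕ} (t u : LA.Term (α ⊕ Fin n)) : LA.BoundedFormula α n :=
  Relations.boundedFormula₂ (show LA.Relations 2 from Unit.unit) t u

/-- The `i`-th (de Bruijn-indexed) bound variable as a term. -/
def vT {m : ℕ} (i : Fin m) : LA.Term (Empty ⊕ Fin m) := Term.var (Sum.inr i)

/-- The induction axiom for the formula `φ(x₀,…,x_{k-1}, x_k)` with induction on `x_k`,
universally closed over the parameters `x₀,…,x_{k-1}`. -/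
def indAxiom {k : ℕ} (φ : LA.BoundedFormula Empty (k + 1)) : Snt :=
  let base := ∀' ((vT (Fin.last k) =' zeroT) ⟹ φ)
  let step := ∀' (φ ⟹
    ∀' ((vT (Fin.last (k + 1)) =' succT (vT (Fin.castSucc (Fin.last k)))) ⟹ φ.liftAt 1 k))
  ((base ⊓ step) ⟹ ∀' φ).alls

/-- The axioms of Peano arithmetic `PA`: the basic axioms for `0`, `S`, `+`, `·`, `≤`,
together with the full induction scheme. -/
def PAAx : Thy :=
  {∀' ∼(succT (vT 0) =' zeroT),
   ∀' ∀' ((succT (vT 0) =' succT (vT 1)) ⟹ (vT 0 =' vT 1)),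
   ∀' (addT (vT 0) zeroT =' vT 0),
   ∀' ∀' (addT (vT 0) (succT (vT 1)) =' succT (addT (vT 0) (vT 1))),
   ∀' (mulT (vT 0) zeroT =' zeroT),
   ∀' ∀' (mulT (vT 0) (succT (vT 1)) =' addT (mulT (vT 0) (vT 1)) (vT 0)),
   ∀' ∀' (leF (vT 0) (vT 1) ⇔ ∃' (addT (vT 2) (vT 0) =' vT 1))} ∪
  {φ | ∃ (k : ℕ) (ψ : LA.BoundedFormula Empty (k + 1)), φ = indAxiom ψ}

/-- `Prv T φ`: the sentence `φ` is provable from the theory `T` (equivalently, by the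
Gödel completeness theorem, `φ` holds in every model of `T`). -/
def Prv (T : Thy) (φ : Snt) : Prop := T ⊨ᵇ φ

/-- `Th T`: the set of sentences provable from `T`. -/
def Th (T : Thy) : Set Snt := {φ | Prv T φ}

/-- `Con T`: the theory `T` is consistent. -/
def Con (T : Thy) : Prop := ¬ Prv T ⊥

/-- The theory `T + φ`. -/
def add (T : Thy) (φ : Snt) : Thy := insert φ T

/-- `T` is an extension of `PA`. -/
def ExtPA (T : Thy) : Prop := ∀ φ ∈ PAAx, Prv T φ

/-- `V` is a subtheory of `T` (containing `PA`, as assumed throughout the paper). -/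
def SubThy (V T : Thy) : Prop := ExtPA V ∧ ∀ φ, Prv V φ → Prv T φ

/-- Δ₀ (bounded) formulas. -/
inductive IsDelta0 : ∀ {m : ℕ}, LA.BoundedFormula Empty m → Prop
  | falsum {m : ℕ} : IsDelta0 (⊥ : LA.BoundedFormula Empty m)
  | equal {m : ℕ} (t u : LA.Term (Empty ⊕ Fin m)) : IsDelta0 (t =' u)
  | le {m : ℕ} (t u : LA.Term (Empty ⊕ Fin m)) : IsDelta0 (leF t u)
  | imp {m : ℕ} {φ ψ : LA.BoundedFormula Empty m} :
      IsDelta0 φ → IsDelta0 ψ → IsDelta0 (φ ⟹ ψ)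
  | ball {m : ℕ} (t : LA.Term (Empty ⊕ Fin m)) {φ : LA.BoundedFormula Empty (m + 1)} :
      IsDelta0 φ →
      IsDelta0 (∀' (leF (vT (Fin.last m)) (t.relabel (Sum.map id Fin.castSucc)) ⟹ φ))
  | bex {m : ℕ} (t : LA.Term (Empty ⊕ Fin m)) {φ : LA.BoundedFormula Empty (m + 1)} :
      IsDelta0 φ →
      IsDelta0 (∃' (leF (vT (Fin.last m)) (t.relabel (Sum.map id Fin.castSucc)) ⊓ φ))

mutual
  /-- `Σ_k` formulas (cumulatively: every `Π_k` formula is `Σ_{k+1}`). -/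
  inductive IsSigmaFml : ℕ → ∀ {m : ℕ}, LA.BoundedFormula Empty m → Prop
    | ofDelta0 {m : ℕ} {φ : LA.BoundedFormula Empty m} : IsDelta0 φ → IsSigmaFml 0 φ
    | ofPi {k : ℕ} {m : ℕ} {φ : LA.BoundedFormula Empty m} :
        IsPiFml k φ → IsSigmaFml (k + 1) φ
    | ex {k : ℕ} {m : ℕ} {φ : LA.BoundedFormula Empty (m + 1)} :
        IsSigmaFml (k + 1) φ → IsSigmaFml (k + 1) (∃' φ)
  /-- `Π_k` formulas (cumulatively: every `Σ_k` formula is `Π_{k+1}`). -/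
  inductive IsPiFml : ℕ → ∀ {m : ℕ}, LA.BoundedFormula Empty m → Prop
    | ofDelta0 {m : ℕ} {φ : LA.BoundedFormula Empty m} : IsDelta0 φ → IsPiFml 0 φ
    | ofSigma {k : ℕ} {m : ℕ} {φ : LA.BoundedFormula Empty m} :
        IsSigmaFml k φ → IsPiFml (k + 1) φ
    | all {k : ℕ} {m : ℕ} {φ : LA.BoundedFormula Empty (m + 1)} :
        IsPiFml (k + 1) φ → IsPiFml (k + 1) (∀' φ)
end

/-- The set of `Σ_k` sentences. -/
def SigmaS (k : ℕ) : Set Snt := {φ | IsSigmaFml k φ}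

/-- The set of `Π_k` sentences. -/
def PiS (k : ℕ) : Set Snt := {φ | IsPiFml k φ}

/-- The set of `Σ_k ∧ Π_k` sentences, i.e. sentences of the form `σ ∧ π` with
`σ` a `Σ_k` sentence and `π` a `Π_k` sentence. -/
def SigAndPiS (k : ℕ) : Set Snt :=
  {φ | ∃ σ ∈ SigmaS k, ∃ π ∈ PiS k, φ = σ ⊓ π}

/-- `B(Σ_k)` sentences: Boolean combinations of `Σ_k` sentences. -/
inductive IsBoolSigma (k : ℕ) : Snt → Prop
  | base {φ : Snt} : φ ∈ SigmaS k → IsBoolSigma k φ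
  | not {φ : Snt} : IsBoolSigma k φ → IsBoolSigma k (∼φ)
  | imp {φ ψ : Snt} : IsBoolSigma k φ → IsBoolSigma k ψ → IsBoolSigma k (φ ⟹ ψ)
  | inf {φ ψ : Snt} : IsBoolSigma k φ → IsBoolSigma k ψ → IsBoolSigma k (φ ⊓ ψ)
  | sup {φ ψ : Snt} : IsBoolSigma k φ → IsBoolSigma k ψ → IsBoolSigma k (φ ⊔ ψ)

/-- The set of `B(Σ_k)` sentences. -/
def BSigmaS (k : ℕ) : Set Snt := {φ | IsBoolSigma k φ}

/-- The set of `Γ` sentences provable in `T`, `Th_Γ(T)`. -/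
def ThIn (Γ : Set Snt) (T : Thy) : Set Snt := Γ ∩ Th T

instance (i : ℕ) : Encodable (LA.Functions i) :=
  match i with
  | 0 => inferInstanceAs (Encodable Unit)
  | 1 => inferInstanceAs (Encodable Unit)
  | 2 => inferInstanceAs (Encodable Bool)
  | (_ + 3) => inferInstanceAs (Encodable Empty)

instance (i : ℕ) : Encodable (LA.Relations i) :=
  match i with
  | 0 => inferInstanceAs (Encodable Empty)
  | 1 => inferInstanceAs (Encodable Empty)
  | 2 => inferInstanceAs (Encodable Unit)
  | (_ + 3) => inferInstanceAs (Encodable Empty)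

/-- A Gödel numbering of sentences, via Mathlib's encoding of bounded formulas. -/
def gnum (φ : Snt) : ℕ :=
  Encodable.encode
    (show List ((Σ k, LA.Term (Empty ⊕ Fin k)) ⊕ ((Σ n, LA.Relations n) ⊕ ℕ)) from
      BoundedFormula.encoding.encode (⟨0, φ⟩ : Σ n, LA.BoundedFormula Empty n))

/-- The (axiom set of the) theory `T` is computable. -/
def CompThy (T : Thy) : Prop :=
  ComputablePred (fun m : ℕ => ∃ φ ∈ T, gnum φ = m)

/-- `T` is a computable consistent extension of `PA`. -/
def GoodThy (T : Thy) : Prop := CompThy T ∧ Con T ∧ ExtPA T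

/-- `φ` is `Γ`-conservative over `T` for a class of sentences `Γ`:
every `Γ` sentence provable in `T + φ` is provable in `T`. -/
def ConsIn (Γ : Set Snt) (T : Thy) (φ : Snt) : Prop :=
  ∀ γ ∈ Γ, Prv (add T φ) γ → Prv T γ

/-- `φ` is hereditarily `Γ`-conservative over `T`: `Γ`-conservative over every
subtheory of `T` (containing `PA`). -/
def HConsIn (Γ : Set Snt) (T : Thy) (φ : Snt) : Prop :=
  ∀ V : Thy, SubThy V T → ConsIn Γ V φ

/-- `φ` is `Σ_k↓Π_k`-conservative over `V`. -/
def SPCons (k : ℕ) (V : Thy) (φ : Snt) : Prop :=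
  ∀ σ ∈ SigmaS k, ∀ π ∈ PiS k, Prv (add V φ) (σ ⊓ π) → Prv V (σ ⊔ π)

/-- `φ` is hereditarily `Σ_k↓Π_k`-conservative over `T`. -/
def HSPCons (k : ℕ) (T : Thy) (φ : Snt) : Prop :=
  ∀ V : Thy, SubThy V T → SPCons k V φ

/-- The theory `S` is `Σ_k↓Π_k`-conservative over `PA`. -/
def ThySPConsPA (k : ℕ) (S : Thy) : Prop :=
  ∀ σ ∈ SigmaS k, ∀ π ∈ PiS k, Prv S (σ ⊓ π) → Prv PAAx (σ ⊔ π)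

/-- `δ` is a `Δ_k(S)` sentence: `S`-provably equivalent to both a `Σ_k` sentence
and a `Π_k` sentence. -/
def IsDeltaIn (k : ℕ) (S : Thy) (δ : Snt) : Prop :=
  (∃ σ ∈ SigmaS k, Prv S (δ ⇔ σ)) ∧ ∃ π ∈ PiS k, Prv S (δ ⇔ π)

/-- `φ` is `Δ_k(S)`-conservative over `V`. -/
def DeltaConsRel (k : ℕ) (S V : Thy) (φ : Snt) : Prop :=
  ∀ δ : Snt, IsDeltaIn k S δ → Prv (add V φ) δ → Prv V δ

/-- `φ` is `Δ_k`-conservative over `T`, i.e. `Δ_k(Th(T))`-conservative over `T`. -/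
def DeltaCons (k : ℕ) (T : Thy) (φ : Snt) : Prop := DeltaConsRel k (Th T) T φ

/-- `φ` is hereditarily `Δ_k`-conservative over `T`. -/
def HDeltaCons (k : ℕ) (T : Thy) (φ : Snt) : Prop :=
  ∀ V : Thy, SubThy V T → DeltaConsRel k (Th V) V φ

/-- `φ` is doubly `Π_k`-conservative over `T`: `φ` is `Π_k`-conservative and `¬φ` is
`Σ_k`-conservative over `T`. -/
def DCons (k : ℕ) (T : Thy) (φ : Snt) : Prop :=
  ConsIn (PiS k) T φ ∧ ConsIn (SigmaS k) T (∼φ)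

/-- `φ` is hereditarily doubly `Π_k`-conservative over `T`. -/
def HDCons (k : ℕ) (T : Thy) (φ : Snt) : Prop :=
  ∀ V : Thy, SubThy V T → DCons k V φ

/-- `(T,U)` is a `B_n`-pair. -/
def Bpair (n : ℕ) (T U : Thy) : Prop :=
  (¬ ThIn (PiS n) T ⊆ Th U ∨ Con (T ∪ ThIn (PiS n) U)) ∧
  (¬ ThIn (PiS n) U ⊆ Th T ∨ Con (U ∪ ThIn (PiS n) T))

/-- `(T,U)` is a `C_n`-pair. -/
def Cpair (n : ℕ) (T U : Thy) : Prop :=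
  Con (T ∪ ThIn (PiS n) U) ∧ Con (U ∪ ThIn (PiS n) T)

/-- `(T,U)` is a `C⁻_n`-pair. -/
def Cmpair (n : ℕ) (T U : Thy) : Prop :=
  Con (T ∪ ThIn (PiS n) U) ∨ Con (U ∪ ThIn (PiS n) T)

/-- `(T,U)` is a `C^∧_n`-pair. -/
def Capair (n : ℕ) (T U : Thy) : Prop :=
  Con (T ∪ ThIn (SigAndPiS n) U) ∧ Con (U ∪ ThIn (SigAndPiS n) T)

/-- `(T,U)` is a `C^B_n`-pair. -/
def CBpair (n : ℕ) (T U : Thy) : Prop :=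
  Con (T ∪ ThIn (BSigmaS n) U)



end Guaspari

open FirstOrder Language
open scoped FirstOrder
namespace Guaspari

/-- Peano models, bundled with the algebraic structure. -/
class PAM (M : Type) extends CommSemiring M, LinearOrder M, IsStrictOrderedRing M where
  str : LA.Structure M
  hz : ∀ v : Fin 0 → M, str.funMap (show LA.Functions 0 from Unit.unit) v = 0
  hs : ∀ v : Fin 1 → M, str.funMap (show LA.Functions 1 from Unit.unit) v = v 0 + 1
  ha : ∀ v : Fin 2 → M, str.funMap (show LA.Functions 2 from false) v = v 0 + v 1
  hm : ∀ v : Fin 2 → M, str.funMap (show LA.Functions 2 from true) v = v 0 * v 1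
  hl : ∀ v : Fin 2 → M, str.RelMap (show LA.Relations 2 from Unit.unit) v ↔ v 0 ≤ v 1
  le_iff : ∀ x y : M, x ≤ y ↔ ∃ z, y = x + z
  ind : ∀ (k : ℕ) (φ : LA.BoundedFormula Empty (k + 1)) (v : Fin k → M),
    φ.Realize default (Fin.snoc v 0) →
    (∀ x, φ.Realize default (Fin.snoc v x) → φ.Realize default (Fin.snoc v (x + 1))) →
    ∀ x, φ.Realize default (Fin.snoc v x)

attribute [instance] PAM.str

section
variable {M : Type} [PAM M] {α : Type} {m : ℕ}

@[simp] theorem r_zero (e : α → M) (v : Fin m → M) :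
    (zeroT : LA.Term (α ⊕ Fin m)).realize (Sum.elim e v) = 0 := PAM.hz _
@[simp] theorem r_succ (e : α → M) (v : Fin m → M) (t : LA.Term (α ⊕ Fin m)) :
    (succT t).realize (Sum.elim e v) = t.realize (Sum.elim e v) + 1 := PAM.hs _
@[simp] theorem r_add (e : α → M) (v : Fin m → M) (t u : LA.Term (α ⊕ Fin m)) :
    (addT t u).realize (Sum.elim e v) = t.realize (Sum.elim e v) + u.realize (Sum.elim e v) :=
  PAM.ha _
@[simp] theorem r_mul (e : α → M) (v : Fin m → M) (t u : LA.Term (α ⊕ Fin m)) :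
    (mulT t u).realize (Sum.elim e v) = t.realize (Sum.elim e v) * u.realize (Sum.elim e v) :=
  PAM.hm _
@[simp] theorem r_le (e : α → M) (v : Fin m → M) (t u : LA.Term (α ⊕ Fin m)) :
    (leF t u).Realize e v ↔ t.realize (Sum.elim e v) ≤ u.realize (Sum.elim e v) :=
  PAM.hl _
@[simp] theorem r_v (e : Empty → M) (v : Fin m → M) (i : Fin m) :
    (vT i).realize (Sum.elim e v) = v i := rfl
end
end Guaspari

namespace Guaspari
set_option linter.unusedSimpArgs false

section raw
variable {M : Type} [LA.Structure M]

def rz (M : Type) [LA.Structure M] : M :=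
  Structure.funMap (show LA.Functions 0 from Unit.unit) (default : Fin 0 → M)
def rs (x : M) : M := Structure.funMap (show LA.Functions 1 from Unit.unit) ![x]
def ra (x y : M) : M := Structure.funMap (show LA.Functions 2 from false) ![x, y]
def rm (x y : M) : M := Structure.funMap (show LA.Functions 2 from true) ![x, y]
def rl (x y : M) : Prop := Structure.RelMap (show LA.Relations 2 from Unit.unit) ![x, y]

theorem q_zero {α : Type} {m : ℕ} (w : α ⊕ Fin m → M) :
    (zeroT : LA.Term (α ⊕ Fin m)).realize w = rz M := by
  unfold zeroT rz
  exact congrArg _ (Subsingleton.elim (α := Fin 0 → M) _ _)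
theorem q_succ {α : Type} {m : ℕ} (w : α ⊕ Fin m → M) (t) :
    (succT t : LA.Term (α ⊕ Fin m)).realize w = rs (t.realize w) := by
  unfold succT rs; exact Term.realize_functions_apply₁
theorem q_add {α : Type} {m : ℕ} (w : α ⊕ Fin m → M) (t u) :
    (addT t u : LA.Term (α ⊕ Fin m)).realize w = ra (t.realize w) (u.realize w) := by
  unfold addT ra; exact Term.realize_functions_apply₂
theorem q_mul {α : Type} {m : ℕ} (w : α ⊕ Fin m → M) (t u) :
    (mulT t u : LA.Term (α ⊕ Fin m)).realize w = rm (t.realize w) (u.realize w) := by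
  unfold mulT rm; exact Term.realize_functions_apply₂
theorem q_le {α : Type} {m : ℕ} (e : α → M) (v : Fin m → M) (t u : LA.Term (α ⊕ Fin m)) :
    (leF t u).Realize e v ↔ rl (t.realize (Sum.elim e v)) (u.realize (Sum.elim e v)) := by
  unfold leF rl; exact BoundedFormula.realize_rel₂
theorem q_v {m : ℕ} (e : Empty → M) (v : Fin m → M) (i : Fin m) :
    (vT i).realize (Sum.elim e v) = v i := rfl

theorem raw_ind (h : M ⊨ PAAx) (k : ℕ) (φ : LA.BoundedFormula Empty (k + 1)) (v : Fin k → M)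
    (h0 : φ.Realize default (Fin.snoc v (rz M)))
    (hs : ∀ x, φ.Realize default (Fin.snoc v x) → φ.Realize default (Fin.snoc v (rs x))) :
    ∀ x, φ.Realize default (Fin.snoc v x) := by
  have := h.realize_of_mem (indAxiom φ) (Or.inr ⟨k, φ, rfl⟩)
  unfold indAxiom at this
  have := BoundedFormula.realize_alls.1 this v
  simp only [BoundedFormula.realize_imp, BoundedFormula.realize_inf, BoundedFormula.realize_all,
    BoundedFormula.realize_bdEqual, q_v, q_zero, q_succ, Fin.snoc_last, Fin.snoc_castSucc] at this
  refine this ⟨?_, ?_⟩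
  · rintro a rfl; exact h0
  · rintro a ha b rfl
    rw [BoundedFormula.realize_liftAt_one (by omega)]
    convert hs a ha using 1
    funext i
    refine Fin.lastCases ?_ (fun i => ?_) i
    · simp
    · have : (i:ℕ) < k := i.2
      simp only [Function.comp, Fin.val_castSucc, this, if_true]
      erw [Fin.snoc_castSucc]
      erw [Fin.snoc_castSucc]
      simp

theorem sn0 {A : Type} (v : Fin 0 → A) (x : A) : (Fin.snoc v x : Fin 1 → A) = ![x] := by
  funext i; fin_cases i; rfl
theorem sn1 {A : Type} (a x : A) : (Fin.snoc ![a] x : Fin 2 → A) = ![a, x] := by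
  funext i; fin_cases i <;> rfl
theorem sn2 {A : Type} (a b x : A) : (Fin.snoc ![a, b] x : Fin 3 → A) = ![a, b, x] := by
  funext i; fin_cases i <;> rfl

theorem raw_ax (h : M ⊨ PAAx) : (∀ x : M, rs x ≠ rz M) ∧ (∀ x y : M, rs x = rs y → x = y) ∧
    (∀ x : M, ra x (rz M) = x) ∧ (∀ x y : M, ra x (rs y) = rs (ra x y)) ∧
    (∀ x : M, rm x (rz M) = rz M) ∧ (∀ x y : M, rm x (rs y) = ra (rm x y) x) ∧
    (∀ x y : M, rl x y ↔ ∃ z, ra z x = y) := by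
  have key := fun φ (hφ : φ ∈ PAAx) => h.realize_of_mem φ hφ
  have e (v : Fin 0 → M) (x y : M) : (Fin.snoc (Fin.snoc v x : Fin 1 → M) y : Fin 2 → M) = ![x, y] := by
    rw [sn0, sn1]
  have e3 (x y z : M) : (Fin.snoc ![x, y] z : Fin 3 → M) = ![x, y, z] := sn2 ..
  refine ⟨?_, ?_, ?_, ?_, ?_, ?_, ?_⟩
  · have := key _ (Or.inl (Or.inl rfl))
    simpa [Sentence.Realize, Formula.Realize, q_v, q_zero, q_succ, sn0] using this
  · have := key _ (Or.inl (Or.inr (Or.inl rfl)))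
    simpa [Sentence.Realize, Formula.Realize, q_v, q_zero, q_succ, e] using this
  · have := key _ (Or.inl (Or.inr (Or.inr (Or.inl rfl))))
    simpa [Sentence.Realize, Formula.Realize, q_v, q_zero, q_add, q_succ, e, sn0] using this
  · have := key _ (Or.inl (Or.inr (Or.inr (Or.inr (Or.inl rfl)))))
    simpa [Sentence.Realize, Formula.Realize, q_v, q_zero, q_add, q_succ, e, sn0] using this
  · have := key _ (Or.inl (Or.inr (Or.inr (Or.inr (Or.inr (Or.inl rfl))))))
    simpa [Sentence.Realize, Formula.Realize, q_v, q_zero, q_add, q_mul, q_succ, e, sn0] using this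
  · have := key _ (Or.inl (Or.inr (Or.inr (Or.inr (Or.inr (Or.inr (Or.inl rfl)))))))
    simpa [Sentence.Realize, Formula.Realize, q_v, q_zero, q_add, q_mul, q_succ, e, sn0] using this
  · have := key _ (Or.inl (Or.inr (Or.inr (Or.inr (Or.inr (Or.inr (Or.inr rfl)))))))
    simpa [Sentence.Realize, Formula.Realize, q_v, q_zero, q_add, q_mul, q_succ, q_le, e, e3,
      sn0] using this

theorem ind0 (h : M ⊨ PAAx) (φ : LA.BoundedFormula Empty 1)
    (h0 : φ.Realize default ![rz M])
    (hs : ∀ x : M, φ.Realize default ![x] → φ.Realize default ![rs x]) (x : M) :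
    φ.Realize default ![x] := by
  have := raw_ind h 0 φ ![] (by rwa [sn0]) (by simpa [sn0] using hs) x
  rwa [sn0] at this
theorem ind1 (h : M ⊨ PAAx) (φ : LA.BoundedFormula Empty 2) (a : M)
    (h0 : φ.Realize default ![a, rz M])
    (hs : ∀ x : M, φ.Realize default ![a, x] → φ.Realize default ![a, rs x]) (x : M) :
    φ.Realize default ![a, x] := by
  have := raw_ind h 1 φ ![a] (by rwa [sn1]) (by simpa [sn1] using hs) x
  rwa [sn1] at this
theorem ind2 (h : M ⊨ PAAx) (φ : LA.BoundedFormula Empty 3) (a b : M)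
    (h0 : φ.Realize default ![a, b, rz M])
    (hs : ∀ x : M, φ.Realize default ![a, b, x] → φ.Realize default ![a, b, rs x]) (x : M) :
    φ.Realize default ![a, b, x] := by
  have := raw_ind h 2 φ ![a, b] (by rwa [sn2]) (by simpa [sn2] using hs) x
  rwa [sn2] at this

/-- Every model of `PA` carries the bundled structure. -/
@[reducible] noncomputable def PAM.ofModel (h : M ⊨ PAAx) : PAM M := by
  have s0 := (raw_ax h).1
  have sinj := (raw_ax h).2.1
  have a0 := (raw_ax h).2.2.1
  have as := (raw_ax h).2.2.2.1
  have m0 := (raw_ax h).2.2.2.2.1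
  have ms := (raw_ax h).2.2.2.2.2.1
  have lei := (raw_ax h).2.2.2.2.2.2
  have za : ∀ x : M, ra (rz M) x = x := by
    intro x
    have := ind0 h (addT zeroT (vT 0) =' vT 0) (by simp [q_v, q_zero, q_add, a0])
      (by simp +contextual [q_v, q_zero, q_add, as]) x
    simpa [q_v, q_zero, q_add] using this
  have sa : ∀ x y : M, ra (rs x) y = rs (ra x y) := by
    intro x y
    have := ind1 h (addT (succT (vT 0)) (vT 1) =' succT (addT (vT 0) (vT 1))) x
      (by simp [q_v, q_zero, q_add, q_succ, a0])
      (by simp +contextual [q_v, q_zero, q_add, q_succ, as]) y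
    simpa [q_v, q_zero, q_add, q_succ] using this
  have ac : ∀ x y : M, ra x y = ra y x := by
    intro x y
    have := ind1 h (addT (vT 0) (vT 1) =' addT (vT 1) (vT 0)) x
      (by simp [q_v, q_zero, q_add, q_succ, a0, za])
      (by simp +contextual [q_v, q_zero, q_add, q_succ, as, sa]) y
    simpa [q_v, q_zero, q_add, q_succ] using this
  have aa : ∀ x y z : M, ra (ra x y) z = ra x (ra y z) := by
    intro x y z
    have := ind2 h (addT (addT (vT 0) (vT 1)) (vT 2) =' addT (vT 0) (addT (vT 1) (vT 2))) x y
      (by simp [q_v, q_zero, q_add, q_succ, a0, za])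
      (by simp +contextual [q_v, q_zero, q_add, q_succ, as, sa]) z
    simpa [q_v, q_zero, q_add, q_succ] using this
  have zm : ∀ x : M, rm (rz M) x = rz M := by
    intro x
    have := ind0 h (mulT zeroT (vT 0) =' zeroT) (by simp [q_v, q_zero, q_mul, m0])
      (by simp [q_v, q_zero, q_mul, ms, a0]) x
    simpa [q_v, q_zero, q_mul] using this
  have alc : ∀ x y z : M, ra x (ra y z) = ra y (ra x z) := by
    intro x y z; rw [← aa, ac x y, aa]
  have sm : ∀ x y : M, rm (rs x) y = ra (rm x y) y := by
    intro x y
    have := ind1 h (mulT (succT (vT 0)) (vT 1) =' addT (mulT (vT 0) (vT 1)) (vT 1)) x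
      (by simp [q_v, q_zero, q_mul, q_add, q_succ, m0, a0])
      (by simp only [q_v, q_zero, q_mul, q_add, q_succ, ms, as, BoundedFormula.realize_bdEqual]
          intro z hz; simp at hz; simp [hz, ms, as, aa, ac z x]) y
    simpa [q_v, q_zero, q_mul, q_add, q_succ] using this
  have mc : ∀ x y : M, rm x y = rm y x := by
    intro x y
    have := ind1 h (mulT (vT 0) (vT 1) =' mulT (vT 1) (vT 0)) x
      (by simp [q_v, q_zero, q_mul, q_succ, m0, zm])
      (by simp +contextual [q_v, q_zero, q_mul, q_succ, ms, sm]) y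
    simpa [q_v, q_zero, q_mul, q_succ] using this
  have dl : ∀ x y z : M, rm x (ra y z) = ra (rm x y) (rm x z) := by
    intro x y z
    have := ind2 h (mulT (vT 0) (addT (vT 1) (vT 2)) =' addT (mulT (vT 0) (vT 1)) (mulT (vT 0) (vT 2))) x y
      (by simp [q_v, q_zero, q_mul, q_add, q_succ, a0, m0])
      (by simp +contextual [q_v, q_zero, q_mul, q_add, q_succ, as, ms, aa]) z
    simpa [q_v, q_zero, q_add, q_mul, q_succ] using this
  have ma : ∀ x y z : M, rm (rm x y) z = rm x (rm y z) := by
    intro x y z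
    have := ind2 h (mulT (mulT (vT 0) (vT 1)) (vT 2) =' mulT (vT 0) (mulT (vT 1) (vT 2))) x y
      (by simp [q_v, q_zero, q_mul, q_succ, m0])
      (by simp +contextual [q_v, q_zero, q_mul, q_succ, ms, dl]) z
    simpa [q_v, q_zero, q_mul, q_succ] using this
  have acn : ∀ x y z : M, ra x z = ra y z → x = y := by
    intro x y z
    have := ind2 h ((addT (vT 0) (vT 2) =' addT (vT 1) (vT 2)) ⟹ (vT 0 =' vT 1)) x y
      (by simp [q_v, q_zero, q_add, q_succ, a0, za])
      (by simp only [q_v, q_add, as, BoundedFormula.realize_imp, BoundedFormula.realize_bdEqual]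
          intro z hz; simp at hz; simp; rw [as, as]; exact fun h => hz (sinj _ _ h)) z
    simpa [q_v, q_zero, q_add, q_succ] using this
  have zs : ∀ x : M, x = rz M ∨ ∃ y, x = rs y := by
    intro x
    have := ind0 h ((vT 0 =' zeroT) ⊔ ∃' (vT 0 =' succT (vT 1)))
      (by simp [q_v, q_zero, q_succ])
      (by simp only [BoundedFormula.realize_sup, BoundedFormula.realize_ex, BoundedFormula.realize_bdEqual,
            q_v, q_zero, q_succ, sn1]
          exact fun x _ => Or.inr ⟨x, rfl⟩) x
    simpa [q_v, q_zero, q_succ, sn1] using this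
  have lz : ∀ x : M, rl (rz M) x := fun x => (lei _ _).2 ⟨x, a0 x⟩
  have tot : ∀ x y : M, rl x y ∨ rl y x := by
    intro x y
    have := ind1 h (leF (vT 0) (vT 1) ⊔ leF (vT 1) (vT 0)) x
      (by simp [q_v, q_zero, q_le, lz])
      (by simp only [BoundedFormula.realize_sup, q_le, q_v]
          intro y hy; simp only [Matrix.cons_val_zero, Matrix.cons_val_one] at hy ⊢
          rcases hy with hy | hy
          · left
            obtain ⟨z, hz⟩ := (lei _ _).1 hy
            exact (lei _ _).2 ⟨rs z, by rw [sa, hz]⟩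
          · obtain ⟨z, hz⟩ := (lei _ _).1 hy
            rcases zs z with rfl | ⟨w, rfl⟩
            · left; exact (lei _ _).2 ⟨rs (rz M), by rw [sa, za, ← hz, za]⟩
            · right; exact (lei _ _).2 ⟨w, by rw [as, ← sa, hz]⟩) y
    simpa [q_v, q_le] using this
  have az : ∀ x y : M, ra x y = rz M → x = rz M := by
    intro x y hxy
    rcases zs x with rfl | ⟨z, rfl⟩
    · rfl
    · rw [sa] at hxy; exact (s0 _ hxy).elim
  letI : Zero M := ⟨rz M⟩
  letI : One M := ⟨rs (rz M)⟩
  letI : Add M := ⟨ra⟩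
  letI : Mul M := ⟨rm⟩
  letI : CommSemiring M :=
  { add := ra
    zero := rz M
    mul := rm
    one := rs (rz M)
    nsmul := nsmulRec
    npow := npowRec
    add_assoc := aa
    zero_add := za
    add_zero := a0
    add_comm := ac
    left_distrib := dl
    right_distrib := fun x y z => by
      change rm (ra x y) z = ra (rm x z) (rm y z)
      rw [mc, dl, mc z x, mc z y]
    zero_mul := zm
    mul_zero := m0
    mul_assoc := ma
    one_mul := fun x => by change rm (rs (rz M)) x = x; rw [sm, zm, za]
    mul_one := fun x => by change rm x (rs (rz M)) = x; rw [ms, m0, za]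
    mul_comm := mc }
  have acn' : ∀ x y z : M, x + z = y + z → x = y := acn
  have azp : ∀ x y : M, x + y = 0 → x = 0 := az
  have lei' : ∀ x y : M, rl x y ↔ ∃ z, y = x + z := by
    intro x y; rw [lei]
    refine exists_congr fun z => ?_
    change z + x = y ↔ _
    rw [add_comm]; exact eq_comm
  letI : LinearOrder M :=
  { le := rl
    le_refl := fun x => (lei' _ _).2 ⟨0, by rw [add_zero]⟩
    le_trans := fun x y z hx hy => by
      obtain ⟨a, rfl⟩ := (lei' _ _).1 hx
      obtain ⟨b, rfl⟩ := (lei' _ _).1 hy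
      exact (lei' _ _).2 ⟨a + b, by rw [add_assoc]⟩
    le_antisymm := fun x y hx hy => by
      obtain ⟨a, rfl⟩ := (lei' _ _).1 hx
      obtain ⟨b, hb⟩ := (lei' _ _).1 hy
      have : 0 = a + b := acn' _ _ x (by rw [zero_add, add_comm, ← add_assoc]; exact hb)
      rw [azp _ _ this.symm, add_zero]
    le_total := tot
    toDecidableLE := Classical.decRel _ }
  have lei2 : ∀ x y : M, x ≤ y ↔ ∃ z, y = x + z := lei'
  have hlt : ∀ x y : M, x < y → ∃ z, y = x + (z + 1) := by
    intro x y hxy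
    obtain ⟨z, hz⟩ := (lei2 _ _).1 hxy.le
    rcases zs z with rfl | ⟨w, rfl⟩
    · exact absurd (hz.trans (add_zero x)) hxy.ne'
    · refine ⟨w, hz.trans ?_⟩
      change ra x (rs w) = ra x (ra w (rs (rz M)))
      rw [as w, a0]
  have hlt2 : ∀ x z : M, x < x + (z + 1) := by
    intro x z
    refine lt_of_le_of_ne ((lei2 _ _).2 ⟨_, rfl⟩) fun h => ?_
    have : 0 = z + 1 := acn' _ _ x (by rw [zero_add, add_comm _ x]; exact h)
    refine s0 z ?_
    have e1 : rs z = z + 1 := by change rs z = ra z (rs (rz M)); rw [as, a0]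
    exact e1.trans this.symm
  haveI : IsStrictOrderedRing M :=
  { add_le_add_left := fun a b hab c => by
      obtain ⟨d, rfl⟩ := (lei2 _ _).1 hab
      exact (lei2 _ _).2 ⟨d, by ring⟩
    le_of_add_le_add_left := fun a b c hab => by
      obtain ⟨d, hd⟩ := (lei2 _ _).1 hab
      exact (lei2 _ _).2 ⟨d, acn' _ _ a (by rw [add_comm c, hd]; ring)⟩
    zero_le_one := (lei2 _ _).2 ⟨1, by ring⟩
    exists_pair_ne := ⟨1, 0, s0 _⟩
    mul_lt_mul_of_pos_left := fun a ha b c hbc => by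
      obtain ⟨d, rfl⟩ := hlt _ _ hbc
      obtain ⟨e, rfl⟩ := hlt _ _ ha
      have : (0 + (e + 1)) * (b + (d + 1)) = (0 + (e + 1)) * b + ((e * d + e + d) + 1) := by ring
      change (0 + (e + 1)) * b < (0 + (e + 1)) * (b + (d + 1))
      rw [this]; exact hlt2 _ _
    mul_lt_mul_of_pos_right := fun a ha b c hbc => by
      obtain ⟨d, rfl⟩ := hlt _ _ hbc
      obtain ⟨e, rfl⟩ := hlt _ _ ha
      have : (b + (d + 1)) * (0 + (e + 1)) = b * (0 + (e + 1)) + ((e * d + e + d) + 1) := by ring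
      change b * (0 + (e + 1)) < (b + (d + 1)) * (0 + (e + 1))
      rw [this]; exact hlt2 _ _ }
  have hss : ∀ x : M, rs x = x + 1 := fun x => by
    change rs x = ra x (rs (rz M)); rw [as, a0]
  exact
  { (inferInstance : CommSemiring M), (inferInstance : LinearOrder M),
    (inferInstance : IsStrictOrderedRing M) with
    str := inferInstance
    hz := fun v => by
      change _ = rz M
      unfold rz; exact congrArg _ (Subsingleton.elim (α := Fin 0 → M) _ _)
    hs := fun v => by
      rw [← hss]; unfold rs; congr 1; funext i; fin_cases i; rfl
    ha := fun v => by
      change _ = ra (v 0) (v 1)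
      unfold ra; congr 1; funext i; fin_cases i <;> rfl
    hm := fun v => by
      change _ = rm (v 0) (v 1)
      unfold rm; congr 1; funext i; fin_cases i <;> rfl
    hl := fun v => by
      change _ ↔ rl (v 0) (v 1)
      unfold rl; apply iff_of_eq; congr 1; funext i; fin_cases i <;> rfl
    le_iff := lei2
    ind := fun k φ v h0 hs => raw_ind h k φ v h0 (by
      intro x hx; rw [hss]; exact hs x hx) }

theorem PAM.ofModel_str (h : M ⊨ PAAx) : (PAM.ofModel h).str = ‹LA.Structure M› := rfl
end raw
end Guaspari

namespace Guaspari
set_option linter.unusedSimpArgs false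

section basics
variable {M : Type} [PAM M]

instance : CanonicallyOrderedAdd M where
  exists_add_of_le := fun {a b} h => (PAM.le_iff a b).1 h
  le_add_self := fun a b => (PAM.le_iff _ _).2 ⟨b, add_comm _ _⟩
  le_self_add := fun a b => (PAM.le_iff _ _).2 ⟨b, rfl⟩

theorem zs (x : M) : x = 0 ∨ ∃ y, x = y + 1 := by
  have := PAM.ind 0 ((vT 0 =' zeroT) ⊔ ∃' (vT 0 =' succT (vT 1))) (default : Fin 0 → M)
    (by simp [sn0]) (by intro x _; simp [sn0, sn1]) x
  simpa [sn0, sn1] using this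

theorem lt_iff_succ (x y : M) : x < y ↔ x + 1 ≤ y := by
  constructor
  · intro h
    obtain ⟨z, rfl⟩ := (PAM.le_iff _ _).1 h.le
    rcases zs z with rfl | ⟨w, rfl⟩
    · simp at h
    · rw [add_comm w, ← add_assoc]; exact le_self_add
  · intro h; exact lt_of_lt_of_le (lt_add_one x) h

theorem lt_succ_iff (x y : M) : x < y + 1 ↔ x ≤ y := by
  rw [lt_iff_succ]; exact add_le_add_iff_right 1

theorem le_succ_iff (x y : M) : x ≤ y + 1 ↔ x ≤ y ∨ x = y + 1 := by
  rw [le_iff_lt_or_eq, lt_succ_iff]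

/-- polynomial pairing -/
def pr (x y : M) : M := (x + y) * (x + y) + x

theorem le_prl (x y : M) : x ≤ pr x y := le_add_self
theorem le_prr (x y : M) : y ≤ pr x y := by
  unfold pr
  refine le_trans ?_ le_self_add
  rcases zs (x + y) with h | ⟨w, h⟩
  · rw [h]; rw [← h]; rw [h, mul_zero]; exact le_trans le_add_self h.le
  · calc y ≤ x + y := le_add_self
      _ ≤ (x + y) * (x + y) := by
        conv_lhs => rw [← mul_one (x + y)]
        exact mul_le_mul_right (by rw [h]; exact le_add_self) _

theorem pr_aux {x y a b : M} (h : x + y < a + b) : pr x y < pr a b := by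
  rw [lt_iff_succ] at h
  unfold pr
  calc (x + y) * (x + y) + x < (x + y + 1) * (x + y + 1) := by
        have : (x + y + 1) * (x + y + 1) = ((x + y) * (x + y) + x) + (x + y + y) + 1 := by ring
        rw [this]; exact lt_of_le_of_lt le_self_add (lt_add_one _)
    _ ≤ (a + b) * (a + b) := mul_le_mul' h h
    _ ≤ _ := le_self_add

theorem pr_inj {x y a b : M} : pr x y = pr a b ↔ x = a ∧ y = b := by
  constructor
  · intro h
    have h1 : x + y = a + b := by
      rcases lt_trichotomy (x + y) (a + b) with h2 | h2 | h2
      · exact absurd h (pr_aux h2).ne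
      · exact h2
      · exact absurd h (pr_aux h2).ne'
    unfold pr at h
    rw [h1] at h
    have := add_left_cancel h
    subst this
    exact ⟨rfl, add_left_cancel h1⟩
  · rintro ⟨rfl, rfl⟩; rfl

theorem dvd_cancel {d a b : M} (h1 : d ∣ a) (h2 : d ∣ a + b) : d ∣ b := by
  obtain ⟨x, rfl⟩ := h1
  obtain ⟨y, hy⟩ := h2
  rcases le_total x y with h | h
  · obtain ⟨z, rfl⟩ := (PAM.le_iff _ _).1 h
    exact ⟨z, add_left_cancel (hy.trans (mul_add _ _ _))⟩
  · obtain ⟨z, rfl⟩ := (PAM.le_iff _ _).1 h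
    have : d * y + (d * z + b) = d * y + 0 := by
      rw [add_zero, ← add_assoc, ← mul_add]; exact hy
    have := add_left_cancel this
    rw [add_eq_zero] at this
    rw [this.2]; exact dvd_zero _

end basics

/-- the standard model -/
instance instPAMNat : PAM ℕ :=
  { (inferInstance : CommSemiring ℕ), (inferInstance : LinearOrder ℕ),
    (inferInstance : IsStrictOrderedRing ℕ) with
    str :=
      { funMap := fun {n} f v => match n, f, v with
          | 0, _, _ => 0
          | 1, _, v => v 0 + 1
          | 2, false, v => v 0 + v 1
          | 2, true, v => v 0 * v 1
        RelMap := fun {n} _ v => match n, v with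
          | 2, v => v 0 ≤ v 1
          | _, _ => False }
    hz := fun _ => rfl
    hs := fun _ => rfl
    ha := fun _ => rfl
    hm := fun _ => rfl
    hl := fun _ => Iff.rfl
    le_iff := fun x y => le_iff_exists_add
    ind := fun k φ v h0 hs x => by induction x with
      | zero => exact h0
      | succ n ih => exact hs n ih }

theorem pa_of_pam {M : Type} [PAM M] : M ⊨ PAAx := by
  refine ⟨fun φ hφ => ?_⟩
  rcases hφ with hφ | ⟨k, ψ, rfl⟩
  · rcases hφ with rfl | rfl | rfl | rfl | rfl | rfl | rfl
    all_goals simp [Sentence.Realize, Formula.Realize, sn0, sn1, sn2]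
    · intro x y; ring
    · intro x y; ring
    · intro x y; rw [PAM.le_iff]; refine exists_congr fun z => ?_; rw [add_comm]; exact eq_comm
  · unfold indAxiom
    refine BoundedFormula.realize_alls.2 fun v => ?_
    simp only [BoundedFormula.realize_imp, BoundedFormula.realize_inf, BoundedFormula.realize_all,
      BoundedFormula.realize_bdEqual, r_v, r_zero, r_succ, Fin.snoc_last, Fin.snoc_castSucc]
    rintro ⟨h0, hs⟩
    refine PAM.ind k ψ v (h0 0 rfl) fun a ha => ?_
    have := hs a ha (a + 1) rfl
    rw [BoundedFormula.realize_liftAt_one (by omega)] at this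
    convert this using 1
    funext i
    refine Fin.lastCases ?_ (fun i => ?_) i
    · simp
    · have : (i:ℕ) < k := i.2
      simp only [Function.comp, Fin.val_castSucc, this, if_true]
      erw [Fin.snoc_castSucc]
      erw [Fin.snoc_castSucc]
      simp

section subst
/-- term lifting -/
def lft {α : Type} {m : ℕ} (t : LA.Term (α ⊕ Fin m)) : LA.Term (α ⊕ Fin (m + 1)) :=
  t.relabel (Sum.map id Fin.castSucc)

theorem r_lft {M : Type} [LA.Structure M] {α : Type} {m : ℕ} (t : LA.Term (α ⊕ Fin m)) (e : α → M)
    (v : Fin m → M) (x : M) :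
    (lft t).realize (Sum.elim e (Fin.snoc v x : Fin (m+1) → M)) = t.realize (Sum.elim e v) := by
  unfold lft
  rw [Term.realize_relabel]
  congr 1; funext i; rcases i with i | i <;> simp

/-- lifting a substitution under a binder -/
def lftS {α : Type} {m m' : ℕ} (σ : Fin m → LA.Term (α ⊕ Fin m')) :
    Fin (m + 1) → LA.Term (α ⊕ Fin (m' + 1)) :=
  Fin.snoc (α := fun _ => LA.Term (α ⊕ Fin (m' + 1))) (fun i => lft (σ i))
    (Term.var (Sum.inr (Fin.last m')))

/-- term substitution -/
def gtsub {β α : Type} (f : β → α) {m m' : ℕ} (t : LA.Term (β ⊕ Fin m))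
    (σ : Fin m → LA.Term (α ⊕ Fin m')) :
    LA.Term (α ⊕ Fin m') := t.subst (Sum.elim (fun e => Term.var (Sum.inl (f e))) σ)

/-- substitution of terms for bound variables -/
def gsub {β α : Type} (f : β → α) : {m : ℕ} → LA.BoundedFormula β m → {m' : ℕ} →
    (Fin m → LA.Term (α ⊕ Fin m')) → LA.BoundedFormula α m'
  | _, .falsum, _, _ => .falsum
  | _, .equal t u, _, σ => .equal (gtsub f t σ) (gtsub f u σ)
  | _, .rel R ts, _, σ => .rel R (fun i => gtsub f (ts i) σ)
  | _, .imp a b, _, σ => .imp (gsub f a σ) (gsub f b σ)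
  | _, .all a, _, σ => .all (gsub f a (lftS σ))

/-- term substitution, no free variables -/
abbrev tsub {α : Type} {m m' : ℕ} (t : LA.Term (Empty ⊕ Fin m)) (σ : Fin m → LA.Term (α ⊕ Fin m')) :
    LA.Term (α ⊕ Fin m') := gtsub Empty.elim t σ

/-- formula substitution, no free variables -/
abbrev sub {α : Type} {m : ℕ} (φ : LA.BoundedFormula Empty m) {m' : ℕ}
    (σ : Fin m → LA.Term (α ⊕ Fin m')) : LA.BoundedFormula α m' := gsub Empty.elim φ σ

theorem r_gtsub {M : Type} [LA.Structure M] {α β : Type} (f : β → α) {m m' : ℕ}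
    (t : LA.Term (β ⊕ Fin m))
    (σ : Fin m → LA.Term (α ⊕ Fin m')) (e : α → M) (v : Fin m' → M) :
    (gtsub f t σ).realize (Sum.elim e v) =
      t.realize (Sum.elim (e ∘ f) (fun i => (σ i).realize (Sum.elim e v))) := by
  unfold gtsub
  rw [Term.realize_subst]
  congr 1; funext i; rcases i with i | i <;> rfl

theorem r_lftS {M : Type} [LA.Structure M] {α : Type} {m m' : ℕ}
    (σ : Fin m → LA.Term (α ⊕ Fin m')) (e : α → M) (v : Fin m' → M) (x : M) :
    (fun i => (lftS σ i).realize (Sum.elim e (Fin.snoc v x : Fin (m'+1) → M))) =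
      Fin.snoc (fun i => (σ i).realize (Sum.elim e v)) x := by
  funext i
  refine Fin.lastCases ?_ (fun i => ?_) i
  · simp [lftS]
  · simp [lftS, r_lft]

theorem r_gsub {M : Type} [LA.Structure M] {α β : Type} (f : β → α) {m : ℕ}
    (φ : LA.BoundedFormula β m)
    {m' : ℕ} (σ : Fin m → LA.Term (α ⊕ Fin m')) (e : α → M) (v : Fin m' → M) :
    (gsub f φ σ).Realize e v ↔ φ.Realize (e ∘ f) (fun i => (σ i).realize (Sum.elim e v)) := by
  induction φ generalizing m' with
  | falsum => rfl
  | equal t u => simp only [gsub, BoundedFormula.Realize, r_gtsub]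
  | rel R ts => simp only [gsub, BoundedFormula.Realize, r_gtsub]
  | imp a b iha ihb => simp only [gsub, BoundedFormula.Realize, iha, ihb]
  | all a ih => simp only [gsub, BoundedFormula.Realize, ih, r_lftS]

theorem r_sub {M : Type} [LA.Structure M] {α : Type} {m : ℕ} (φ : LA.BoundedFormula Empty m)
    {m' : ℕ} (σ : Fin m → LA.Term (α ⊕ Fin m')) (e : α → M) (v : Fin m' → M) :
    (sub φ σ).Realize e v ↔ φ.Realize default (fun i => (σ i).realize (Sum.elim e v)) := by
  rw [r_gsub, Subsingleton.elim (e ∘ Empty.elim) default]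

theorem tsub_lft {m m' : ℕ} (t : LA.Term (Empty ⊕ Fin m)) (σ : Fin m → LA.Term (Empty ⊕ Fin m')) :
    tsub (lft t) (lftS σ) = lft (tsub t σ) := by
  induction t with
  | var x =>
    rcases x with x | x
    · exact x.elim
    · simp [tsub, gtsub, lft, lftS, Term.relabel, Term.subst]
  | func f ts ih =>
    simp only [tsub, gtsub, lft, Term.relabel, Term.subst] at *
    congr 1; funext i; exact ih i

theorem sub_leF {m m' : ℕ} (t u : LA.Term (Empty ⊕ Fin m)) (σ : Fin m → LA.Term (Empty ⊕ Fin m')) :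
    sub (leF t u) σ = leF (tsub t σ) (tsub u σ) := by
  unfold leF Relations.boundedFormula₂ Relations.boundedFormula
  simp only [sub, gsub]
  congr 1; funext i
  refine Fin.cases ?_ (fun i => ?_) i
  · rfl
  · refine Fin.cases ?_ (fun i => i.elim0) i
    rfl

theorem tsub_last {m m' : ℕ} (σ : Fin m → LA.Term (Empty ⊕ Fin m')) :
    tsub (vT (Fin.last m)) (lftS σ) = vT (Fin.last m') := by
  simp [tsub, gtsub, vT, lftS, Term.subst]

theorem delta_sub {m : ℕ} {φ : LA.BoundedFormula Empty m} (h : IsDelta0 φ) {m' : ℕ}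
    (σ : Fin m → LA.Term (Empty ⊕ Fin m')) : IsDelta0 (sub φ σ) := by
  induction h generalizing m' with
  | falsum => exact .falsum
  | equal t u => exact .equal _ _
  | le t u => rw [sub_leF]; exact .le _ _
  | imp _ _ iha ihb => exact .imp (iha σ) (ihb σ)
  | ball t _ ih =>
    have := IsDelta0.ball (tsub t σ) (ih (lftS σ))
    change IsDelta0 (BoundedFormula.all (BoundedFormula.imp (sub _ _) (sub _ _)))
    rw [sub_leF, tsub_last]
    have e := tsub_lft t σ
    unfold lft at e
    rw [e]; exact this
  | bex t _ ih =>
    have := IsDelta0.bex (tsub t σ) (ih (lftS σ))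
    change IsDelta0 (BoundedFormula.imp (BoundedFormula.all (BoundedFormula.imp (BoundedFormula.imp
      (BoundedFormula.imp (sub _ _) (BoundedFormula.imp (sub _ _) .falsum)) .falsum) .falsum)) .falsum)
    rw [sub_leF, tsub_last]
    have e := tsub_lft t σ
    unfold lft at e
    rw [e]; exact this

theorem sub_ex {m m' : ℕ} (φ : LA.BoundedFormula Empty (m+1)) (σ : Fin m → LA.Term (Empty ⊕ Fin m')) :
    sub (∃' φ) σ = ∃' (sub φ (lftS σ)) := rfl

theorem sp_ind {S P : ∀ (_ m : ℕ), LA.BoundedFormula Empty m → Prop}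
    (d : ∀ m φ, IsDelta0 φ → S 0 m φ ∧ P 0 m φ)
    (sp : ∀ k m φ, P k m φ → S (k + 1) m φ) (ps : ∀ k m φ, S k m φ → P (k + 1) m φ)
    (ex : ∀ k m φ, S (k + 1) (m + 1) φ → S (k + 1) m (∃' φ))
    (al : ∀ k m φ, P (k + 1) (m + 1) φ → P (k + 1) m (∀' φ)) :
    (∀ {k m : ℕ} {φ : LA.BoundedFormula Empty m}, IsSigmaFml k φ → S k m φ) ∧
    (∀ {k m : ℕ} {φ : LA.BoundedFormula Empty m}, IsPiFml k φ → P k m φ) := by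
  constructor
  · intro k m φ h
    exact IsSigmaFml.rec (motive_1 := fun k {m} φ _ => S k m φ) (motive_2 := fun k {m} φ _ => P k m φ)
      (fun h => (d _ _ h).1) (fun _ ih => sp _ _ _ ih) (fun _ ih => ex _ _ _ ih)
      (fun h => (d _ _ h).2) (fun _ ih => ps _ _ _ ih) (fun _ ih => al _ _ _ ih) h
  · intro k m φ h
    exact IsPiFml.rec (motive_1 := fun k {m} φ _ => S k m φ) (motive_2 := fun k {m} φ _ => P k m φ)
      (fun h => (d _ _ h).1) (fun _ ih => sp _ _ _ ih) (fun _ ih => ex _ _ _ ih)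
      (fun h => (d _ _ h).2) (fun _ ih => ps _ _ _ ih) (fun _ ih => al _ _ _ ih) h

theorem sp_sub :
    (∀ {k m : ℕ} {φ : LA.BoundedFormula Empty m}, IsSigmaFml k φ →
      ∀ {m' : ℕ} (σ : Fin m → LA.Term (Empty ⊕ Fin m')), IsSigmaFml k (sub φ σ)) ∧
    (∀ {k m : ℕ} {φ : LA.BoundedFormula Empty m}, IsPiFml k φ →
      ∀ {m' : ℕ} (σ : Fin m → LA.Term (Empty ⊕ Fin m')), IsPiFml k (sub φ σ)) := by
  refine sp_ind (S := fun k m φ => ∀ {m' : ℕ} (σ : Fin m → LA.Term (Empty ⊕ Fin m')),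
      IsSigmaFml k (sub φ σ)) (P := fun k m φ => ∀ {m' : ℕ} (σ : Fin m → LA.Term (Empty ⊕ Fin m')),
      IsPiFml k (sub φ σ)) ?_ ?_ ?_ ?_ ?_
  · exact fun m φ h => ⟨fun σ => .ofDelta0 (delta_sub h σ), fun σ => .ofDelta0 (delta_sub h σ)⟩
  · exact fun k m φ h m' σ => .ofPi (h σ)
  · exact fun k m φ h m' σ => .ofSigma (h σ)
  · exact fun k m φ h m' σ => by rw [sub_ex]; exact .ex (h _)
  · exact fun k m φ h m' σ => .all (h _)
end subst
end Guaspari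

namespace Guaspari
set_option linter.unusedSimpArgs false
set_option linter.unusedVariables false

/-! ### uniform definability -/

/-- uniform terms -/
def DT {m : ℕ} (t : ∀ (M : Type) [PAM M], (Fin m → M) → M) : Prop :=
  ∃ τ : LA.Term (Empty ⊕ Fin m), ∀ (M : Type) [PAM M] (v : Fin m → M),
    τ.realize (Sum.elim default v) = t M v

/-- uniform bounded predicates -/
def D0 {m : ℕ} (P : ∀ (M : Type) [PAM M], (Fin m → M) → Prop) : Prop :=
  ∃ φ : LA.BoundedFormula Empty m, IsDelta0 φ ∧ ∀ (M : Type) [PAM M] (v : Fin m → M),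
    φ.Realize default v ↔ P M v

/-- uniform Sigma predicates -/
def SigF {m : ℕ} (k : ℕ) (P : ∀ (M : Type) [PAM M], (Fin m → M) → Prop) : Prop :=
  ∃ φ : LA.BoundedFormula Empty m, IsSigmaFml k φ ∧ ∀ (M : Type) [PAM M] (v : Fin m → M),
    φ.Realize default v ↔ P M v

/-- uniform Pi predicates -/
def PiF {m : ℕ} (k : ℕ) (P : ∀ (M : Type) [PAM M], (Fin m → M) → Prop) : Prop :=
  ∃ φ : LA.BoundedFormula Empty m, IsPiFml k φ ∧ ∀ (M : Type) [PAM M] (v : Fin m → M),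
    φ.Realize default v ↔ P M v

/-- uniform first-order predicates -/
def Fm {m : ℕ} (P : ∀ (M : Type) [PAM M], (Fin m → M) → Prop) : Prop :=
  ∃ φ : LA.BoundedFormula Empty m, ∀ (M : Type) [PAM M] (v : Fin m → M),
    φ.Realize default v ↔ P M v

section
variable {m : ℕ} {t u : ∀ (M : Type) [PAM M], (Fin m → M) → M}
  {P Q : ∀ (M : Type) [PAM M], (Fin m → M) → Prop}

theorem DT.var (i : Fin m) : DT (fun M _ v => v i) := ⟨vT i, fun _ _ _ => rfl⟩
theorem DT.zero : DT (fun M _ (v : Fin m → M) => (0 : M)) := ⟨zeroT, fun _ _ _ => by simp⟩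
theorem DT.one : DT (fun M _ (v : Fin m → M) => (1 : M)) := ⟨succT zeroT, fun _ _ _ => by simp⟩
theorem DT.add (h1 : DT t) (h2 : DT u) : DT (fun M _ v => t M v + u M v) := by
  obtain ⟨a, ha⟩ := h1; obtain ⟨b, hb⟩ := h2
  exact ⟨addT a b, fun M _ v => by simp [ha, hb]⟩
theorem DT.mul (h1 : DT t) (h2 : DT u) : DT (fun M _ v => t M v * u M v) := by
  obtain ⟨a, ha⟩ := h1; obtain ⟨b, hb⟩ := h2
  exact ⟨mulT a b, fun M _ v => by simp [ha, hb]⟩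
theorem DT.nat (n : ℕ) : DT (fun M _ (v : Fin m → M) => (n : M)) := by
  induction n with
  | zero => simpa using DT.zero
  | succ n ih => simpa using DT.add ih DT.one
theorem DT.pr (h1 : DT t) (h2 : DT u) : DT (fun M _ v => pr (t M v) (u M v)) :=
  .add (.mul (.add h1 h2) (.add h1 h2)) h1
theorem DT.subst {m' : ℕ} (h : DT t) {s : ∀ (M : Type) [PAM M], (Fin m' → M) → Fin m → M}
    (hs : ∀ j, DT (fun M _ v => s M v j)) : DT (fun M _ v => t M (s M v)) := by
  obtain ⟨a, ha⟩ := h; choose b hb using hs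
  exact ⟨tsub a b, fun M _ v => by
    rw [r_gtsub, Subsingleton.elim (default ∘ Empty.elim) default]; simp only [hb, ha]⟩
theorem DT.ren {m' : ℕ} (h : DT t) (f : Fin m → Fin m') :
    DT (fun M _ (w : Fin m' → M) => t M (fun i => w (f i))) :=
  h.subst fun j => .var _

theorem D0.congr (h : D0 P) (e : ∀ (M : Type) [PAM M] v, P M v ↔ Q M v) : D0 Q := by
  obtain ⟨φ, h1, h2⟩ := h
  exact ⟨φ, h1, fun M _ v => (h2 M v).trans (e M v)⟩
theorem D0.fls : D0 (fun M _ (v : Fin m → M) => False) := ⟨⊥, .falsum, fun _ _ _ => Iff.rfl⟩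
theorem D0.eq (h1 : DT t) (h2 : DT u) : D0 (fun M _ v => t M v = u M v) := by
  obtain ⟨a, ha⟩ := h1; obtain ⟨b, hb⟩ := h2
  exact ⟨a =' b, .equal _ _, fun M _ v => by simp [ha, hb]⟩
theorem D0.le (h1 : DT t) (h2 : DT u) : D0 (fun M _ v => t M v ≤ u M v) := by
  obtain ⟨a, ha⟩ := h1; obtain ⟨b, hb⟩ := h2
  exact ⟨leF a b, .le _ _, fun M _ v => by simp [ha, hb]⟩
theorem D0.imp (h1 : D0 P) (h2 : D0 Q) : D0 (fun M _ v => P M v → Q M v) := by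
  obtain ⟨a, da, ha⟩ := h1; obtain ⟨b, db, hb⟩ := h2
  exact ⟨a ⟹ b, .imp da db, fun M _ v => by simp [ha, hb]⟩
theorem D0.not (h1 : D0 P) : D0 (fun M _ v => ¬ P M v) := h1.imp .fls
theorem D0.ne (h1 : DT t) (h2 : DT u) : D0 (fun M _ v => t M v ≠ u M v) := (D0.eq h1 h2).not
theorem D0.lt (h1 : DT t) (h2 : DT u) : D0 (fun M _ v => t M v < u M v) :=
  (D0.le h2 h1).not.congr fun M _ v => not_le
theorem D0.or (h1 : D0 P) (h2 : D0 Q) : D0 (fun M _ v => P M v ∨ Q M v) :=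
  (h1.not.imp h2).congr fun M _ v => by tauto
theorem D0.and (h1 : D0 P) (h2 : D0 Q) : D0 (fun M _ v => P M v ∧ Q M v) :=
  (h1.imp h2.not).not.congr fun M _ v => by tauto
theorem D0.iff (h1 : D0 P) (h2 : D0 Q) : D0 (fun M _ v => P M v ↔ Q M v) :=
  ((h1.imp h2).and (h2.imp h1)).congr fun M _ v => by tauto

theorem snoc_eta {A : Type} (v : Fin m → A) (x : A) :
    (fun i => (Fin.snoc v x : Fin (m+1) → A) i.castSucc) = v := by funext i; simp

theorem D0.ball {R : ∀ (M : Type) [PAM M], (Fin m → M) → M → Prop} (ht : DT t)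
    (h : D0 (fun M _ w => R M (fun i => w i.castSucc) (w (Fin.last m)))) :
    D0 (fun M _ v => ∀ x, x ≤ t M v → R M v x) := by
  obtain ⟨a, ha⟩ := ht; obtain ⟨b, db, hb⟩ := h
  refine ⟨_, IsDelta0.ball a db, fun M _ v => ?_⟩
  simp only [BoundedFormula.realize_all, BoundedFormula.realize_imp, r_le, r_v, hb, snoc_eta]
  have := fun x => r_lft a default v x
  unfold lft at this
  simp only [this, ha, Fin.snoc_last]
theorem D0.bex {R : ∀ (M : Type) [PAM M], (Fin m → M) → M → Prop} (ht : DT t)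
    (h : D0 (fun M _ w => R M (fun i => w i.castSucc) (w (Fin.last m)))) :
    D0 (fun M _ v => ∃ x, x ≤ t M v ∧ R M v x) := by
  refine (D0.ball (R := fun M _ v x => ¬ R M v x) ht h.not).not.congr fun M _ v => ?_
  push Not; rfl
theorem D0.subst {m' : ℕ} (h : D0 P) {s : ∀ (M : Type) [PAM M], (Fin m' → M) → Fin m → M}
    (hs : ∀ j, DT (fun M _ v => s M v j)) : D0 (fun M _ v => P M (s M v)) := by
  obtain ⟨a, da, ha⟩ := h; choose b hb using hs
  exact ⟨sub a b, delta_sub da b, fun M _ v => by rw [r_sub]; simp only [hb, ha]⟩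
theorem D0.ren {m' : ℕ} (h : D0 P) (f : Fin m → Fin m') :
    D0 (fun M _ (w : Fin m' → M) => P M (fun i => w (f i))) :=
  h.subst fun j => .var _

theorem D0.sig (h : D0 P) : SigF 0 P := let ⟨φ, a, b⟩ := h; ⟨φ, .ofDelta0 a, b⟩
theorem D0.pi (h : D0 P) : PiF 0 P := let ⟨φ, a, b⟩ := h; ⟨φ, .ofDelta0 a, b⟩
theorem SigF.congr {k} (h : SigF k P) (e : ∀ (M : Type) [PAM M] v, P M v ↔ Q M v) : SigF k Q := by
  obtain ⟨φ, h1, h2⟩ := h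
  exact ⟨φ, h1, fun M _ v => (h2 M v).trans (e M v)⟩
theorem PiF.congr {k} (h : PiF k P) (e : ∀ (M : Type) [PAM M] v, P M v ↔ Q M v) : PiF k Q := by
  obtain ⟨φ, h1, h2⟩ := h
  exact ⟨φ, h1, fun M _ v => (h2 M v).trans (e M v)⟩
theorem SigF.subst {k m' : ℕ} (h : SigF k P) {s : ∀ (M : Type) [PAM M], (Fin m' → M) → Fin m → M}
    (hs : ∀ j, DT (fun M _ v => s M v j)) : SigF k (fun M _ v => P M (s M v)) := by
  obtain ⟨a, da, ha⟩ := h; choose b hb using hs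
  exact ⟨sub a b, sp_sub.1 da b, fun M _ v => by rw [r_sub]; simp only [hb, ha]⟩
theorem PiF.subst {k m' : ℕ} (h : PiF k P) {s : ∀ (M : Type) [PAM M], (Fin m' → M) → Fin m → M}
    (hs : ∀ j, DT (fun M _ v => s M v j)) : PiF k (fun M _ v => P M (s M v)) := by
  obtain ⟨a, da, ha⟩ := h; choose b hb using hs
  exact ⟨sub a b, sp_sub.2 da b, fun M _ v => by rw [r_sub]; simp only [hb, ha]⟩
theorem SigF.up {k} (h : SigF k P) : PiF (k + 1) P := let ⟨φ, a, b⟩ := h; ⟨φ, .ofSigma a, b⟩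
theorem PiF.up {k} (h : PiF k P) : SigF (k + 1) P := let ⟨φ, a, b⟩ := h; ⟨φ, .ofPi a, b⟩
theorem SigF.ex {k} {R : ∀ (M : Type) [PAM M], (Fin m → M) → M → Prop}
    (h : SigF (k + 1) (fun M _ w => R M (fun i => w i.castSucc) (w (Fin.last m)))) :
    SigF (k + 1) (fun M _ v => ∃ x, R M v x) := by
  obtain ⟨b, db, hb⟩ := h
  refine ⟨_, .ex db, fun M _ v => ?_⟩
  simp only [BoundedFormula.realize_ex, hb, snoc_eta, Fin.snoc_last]
theorem PiF.all {k} {R : ∀ (M : Type) [PAM M], (Fin m → M) → M → Prop}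
    (h : PiF (k + 1) (fun M _ w => R M (fun i => w i.castSucc) (w (Fin.last m)))) :
    PiF (k + 1) (fun M _ v => ∀ x, R M v x) := by
  obtain ⟨b, db, hb⟩ := h
  refine ⟨_, .all db, fun M _ v => ?_⟩
  simp only [BoundedFormula.realize_all, hb, snoc_eta, Fin.snoc_last]
end

theorem sp_neg :
    (∀ {k m : ℕ} {φ : LA.BoundedFormula Empty m}, IsSigmaFml k φ →
      PiF k (fun M _ v => ¬ φ.Realize default v)) ∧
    (∀ {k m : ℕ} {φ : LA.BoundedFormula Empty m}, IsPiFml k φ →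
      SigF k (fun M _ v => ¬ φ.Realize default v)) := by
  refine sp_ind (S := fun k m φ => PiF k (fun M _ v => ¬ φ.Realize default v))
    (P := fun k m φ => SigF k (fun M _ v => ¬ φ.Realize default v)) ?_ ?_ ?_ ?_ ?_
  · intro m φ h
    have : D0 (fun M _ v => ¬ φ.Realize default v) := D0.not ⟨φ, h, fun _ _ _ => Iff.rfl⟩
    exact ⟨this.pi, this.sig⟩
  · exact fun k m φ h => h.up
  · exact fun k m φ h => h.up
  · intro k m φ h
    refine PiF.congr (P := fun M _ v => ∀ x, ¬ φ.Realize default (Fin.snoc v x)) ?_ ?_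
    · apply PiF.all
      refine h.congr fun M _ v => ?_
      rw [show (Fin.snoc (fun i => v i.castSucc) (v (Fin.last m)) : Fin (m+1) → M) = v from
        Fin.snoc_init_self v]
    · intro M _ v; simp
  · intro k m φ h
    refine SigF.congr (P := fun M _ v => ∃ x, ¬ φ.Realize default (Fin.snoc v x)) ?_ ?_
    · apply SigF.ex
      refine h.congr fun M _ v => ?_
      rw [show (Fin.snoc (fun i => v i.castSucc) (v (Fin.last m)) : Fin (m+1) → M) = v from
        Fin.snoc_init_self v]
    · intro M _ v; simp

theorem SigF.neg {m k : ℕ} {P : ∀ (M : Type) [PAM M], (Fin m → M) → Prop} (h : SigF k P) :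
    PiF k (fun M _ v => ¬ P M v) := by
  obtain ⟨φ, a, b⟩ := h
  exact (sp_neg.1 a).congr fun M _ v => by rw [b]
theorem PiF.neg {m k : ℕ} {P : ∀ (M : Type) [PAM M], (Fin m → M) → Prop} (h : PiF k P) :
    SigF k (fun M _ v => ¬ P M v) := by
  obtain ⟨φ, a, b⟩ := h
  exact (sp_neg.2 a).congr fun M _ v => by rw [b]

theorem sp_guard :
    (∀ {k m : ℕ} {φ : LA.BoundedFormula Empty m}, IsSigmaFml k φ →
      ∀ G : ∀ (M : Type) [PAM M], (Fin m → M) → Prop, D0 G →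
      SigF k (fun M _ v => G M v → φ.Realize default v) ∧
      SigF k (fun M _ v => G M v ∧ φ.Realize default v)) ∧
    (∀ {k m : ℕ} {φ : LA.BoundedFormula Empty m}, IsPiFml k φ →
      ∀ G : ∀ (M : Type) [PAM M], (Fin m → M) → Prop, D0 G →
      PiF k (fun M _ v => G M v → φ.Realize default v) ∧
      PiF k (fun M _ v => G M v ∧ φ.Realize default v)) := by
  refine sp_ind (S := fun k m φ => ∀ G : ∀ (M : Type) [PAM M], (Fin m → M) → Prop, D0 G →
      SigF k (fun M _ v => G M v → φ.Realize default v) ∧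
      SigF k (fun M _ v => G M v ∧ φ.Realize default v))
    (P := fun k m φ => ∀ G : ∀ (M : Type) [PAM M], (Fin m → M) → Prop, D0 G →
      PiF k (fun M _ v => G M v → φ.Realize default v) ∧
      PiF k (fun M _ v => G M v ∧ φ.Realize default v)) ?_ ?_ ?_ ?_ ?_
  · intro m φ h
    have : D0 (fun M _ v => φ.Realize default v) := ⟨φ, h, fun _ _ _ => Iff.rfl⟩
    exact ⟨fun G hG => ⟨(hG.imp this).sig, (hG.and this).sig⟩,
      fun G hG => ⟨(hG.imp this).pi, (hG.and this).pi⟩⟩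
  · exact fun k m φ h G hG => ⟨(h G hG).1.up, (h G hG).2.up⟩
  · exact fun k m φ h G hG => ⟨(h G hG).1.up, (h G hG).2.up⟩
  · intro k m φ h G hG
    have := h (fun M _ w => G M (fun i => w i.castSucc)) (hG.ren _)
    constructor
    · refine SigF.congr (P := fun M _ v => ∃ x, (G M v → φ.Realize default (Fin.snoc v x))) ?_ ?_
      · apply SigF.ex
        refine this.1.congr fun M _ v => ?_
        rw [show (Fin.snoc (fun i => v i.castSucc) (v (Fin.last m)) : Fin (m+1) → M) = v from
          Fin.snoc_init_self v]
      · intro M _ v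
        rw [BoundedFormula.realize_ex]
        by_cases hh : G M v <;> simp [hh]
    · refine SigF.congr (P := fun M _ v => ∃ x, (G M v ∧ φ.Realize default (Fin.snoc v x))) ?_ ?_
      · apply SigF.ex
        refine this.2.congr fun M _ v => ?_
        rw [show (Fin.snoc (fun i => v i.castSucc) (v (Fin.last m)) : Fin (m+1) → M) = v from
          Fin.snoc_init_self v]
      · intro M _ v
        rw [BoundedFormula.realize_ex]
        by_cases hh : G M v <;> simp [hh]
  · intro k m φ h G hG
    have := h (fun M _ w => G M (fun i => w i.castSucc)) (hG.ren _)
    constructor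
    · refine PiF.congr (P := fun M _ v => ∀ x, (G M v → φ.Realize default (Fin.snoc v x))) ?_ ?_
      · apply PiF.all
        refine this.1.congr fun M _ v => ?_
        rw [show (Fin.snoc (fun i => v i.castSucc) (v (Fin.last m)) : Fin (m+1) → M) = v from
          Fin.snoc_init_self v]
      · intro M _ v
        rw [BoundedFormula.realize_all]
        by_cases hh : G M v <;> simp [hh]
    · refine PiF.congr (P := fun M _ v => ∀ x, (G M v ∧ φ.Realize default (Fin.snoc v x))) ?_ ?_
      · apply PiF.all
        refine this.2.congr fun M _ v => ?_
        rw [show (Fin.snoc (fun i => v i.castSucc) (v (Fin.last m)) : Fin (m+1) → M) = v from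
          Fin.snoc_init_self v]
      · intro M _ v
        rw [BoundedFormula.realize_all]
        by_cases hh : G M v <;> simp [hh]

section
variable {m k : ℕ} {P G : ∀ (M : Type) [PAM M], (Fin m → M) → Prop}
theorem SigF.gand (hG : D0 G) (h : SigF k P) : SigF k (fun M _ v => G M v ∧ P M v) := by
  obtain ⟨φ, a, b⟩ := h
  exact (sp_guard.1 a G hG).2.congr fun M _ v => by rw [b]
theorem PiF.gand (hG : D0 G) (h : PiF k P) : PiF k (fun M _ v => G M v ∧ P M v) := by
  obtain ⟨φ, a, b⟩ := h
  exact (sp_guard.2 a G hG).2.congr fun M _ v => by rw [b]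
theorem PiF.gimp (hG : D0 G) (h : PiF k P) : PiF k (fun M _ v => G M v → P M v) := by
  obtain ⟨φ, a, b⟩ := h
  exact (sp_guard.2 a G hG).1.congr fun M _ v => by rw [b]
theorem PiF.ball {t : ∀ (M : Type) [PAM M], (Fin m → M) → M}
    {R : ∀ (M : Type) [PAM M], (Fin m → M) → M → Prop} (ht : DT t)
    (h : PiF k (fun M _ w => R M (fun i => w i.castSucc) (w (Fin.last m)))) :
    PiF k (fun M _ v => ∀ x, x ≤ t M v → R M v x) := by
  cases k with
  | zero =>
    obtain ⟨φ, a, b⟩ := h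
    cases a with
    | ofDelta0 a => exact (D0.ball ht ⟨φ, a, b⟩).pi
  | succ k =>
    apply PiF.all
    exact PiF.gimp (D0.le (.var _) (ht.ren _)) h
theorem D0.fm (h : D0 P) : Fm P := let ⟨φ, _, b⟩ := h; ⟨φ, b⟩
theorem SigF.fm (h : SigF k P) : Fm P := let ⟨φ, _, b⟩ := h; ⟨φ, b⟩
theorem PiF.fm (h : PiF k P) : Fm P := let ⟨φ, _, b⟩ := h; ⟨φ, b⟩
end

/-! ### definability with parameters in one model -/
section
variable {M : Type} [PAM M] {m : ℕ}

/-- terms with parameters -/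
def DF (t : (Fin m → M) → M) : Prop :=
  ∃ τ : LA.Term (M ⊕ Fin m), ∀ v, τ.realize (Sum.elim id v) = t v
/-- formulas with parameters -/
def Dfn (P : (Fin m → M) → Prop) : Prop :=
  ∃ φ : LA.BoundedFormula M m, ∀ v, φ.Realize id v ↔ P v

variable {t u : (Fin m → M) → M} {P Q : (Fin m → M) → Prop}
theorem DF.var (i : Fin m) : DF (fun v : Fin m → M => v i) := ⟨.var (.inr i), fun _ => rfl⟩
theorem DF.const (c : M) : DF (fun v : Fin m → M => c) := ⟨.var (.inl c), fun _ => rfl⟩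
theorem DF.add (h1 : DF t) (h2 : DF u) : DF (fun v => t v + u v) := by
  obtain ⟨a, ha⟩ := h1; obtain ⟨b, hb⟩ := h2
  exact ⟨addT a b, fun v => by simp [ha, hb]⟩
theorem DF.mul (h1 : DF t) (h2 : DF u) : DF (fun v => t v * u v) := by
  obtain ⟨a, ha⟩ := h1; obtain ⟨b, hb⟩ := h2
  exact ⟨mulT a b, fun v => by simp [ha, hb]⟩
theorem DF.pr (h1 : DF t) (h2 : DF u) : DF (fun v => pr (t v) (u v)) :=
  .add (.mul (.add h1 h2) (.add h1 h2)) h1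
theorem Dfn.congr (h : Dfn P) (e : ∀ v, P v ↔ Q v) : Dfn Q :=
  let ⟨φ, h⟩ := h; ⟨φ, fun v => (h v).trans (e v)⟩
theorem Dfn.const (p : Prop) : Dfn (fun v : Fin m → M => p) := by
  by_cases h : p
  · exact ⟨⊤, fun v => by simp [h]⟩
  · exact ⟨⊥, fun v => by simp [h]⟩
theorem Dfn.eq (h1 : DF t) (h2 : DF u) : Dfn (fun v => t v = u v) := by
  obtain ⟨a, ha⟩ := h1; obtain ⟨b, hb⟩ := h2
  exact ⟨a =' b, fun v => by simp [ha, hb]⟩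
theorem Dfn.le (h1 : DF t) (h2 : DF u) : Dfn (fun v => t v ≤ u v) := by
  obtain ⟨a, ha⟩ := h1; obtain ⟨b, hb⟩ := h2
  exact ⟨leF a b, fun v => by simp [ha, hb]⟩
theorem Dfn.imp (h1 : Dfn P) (h2 : Dfn Q) : Dfn (fun v => P v → Q v) := by
  obtain ⟨a, ha⟩ := h1; obtain ⟨b, hb⟩ := h2
  exact ⟨a ⟹ b, fun v => by simp [ha, hb]⟩
theorem Dfn.not (h1 : Dfn P) : Dfn (fun v => ¬ P v) := h1.imp (.const False)
theorem Dfn.ne (h1 : DF t) (h2 : DF u) : Dfn (fun v => t v ≠ u v) := (Dfn.eq h1 h2).not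
theorem Dfn.lt (h1 : DF t) (h2 : DF u) : Dfn (fun v => t v < u v) :=
  (Dfn.le h2 h1).not.congr fun v => not_le
theorem Dfn.or (h1 : Dfn P) (h2 : Dfn Q) : Dfn (fun v => P v ∨ Q v) :=
  (h1.not.imp h2).congr fun v => by tauto
theorem Dfn.and (h1 : Dfn P) (h2 : Dfn Q) : Dfn (fun v => P v ∧ Q v) :=
  (h1.imp h2.not).not.congr fun v => by tauto
theorem Dfn.iff (h1 : Dfn P) (h2 : Dfn Q) : Dfn (fun v => P v ↔ Q v) :=
  ((h1.imp h2).and (h2.imp h1)).congr fun v => by tauto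
theorem Dfn.all {R : (Fin m → M) → M → Prop}
    (h : Dfn (fun w : Fin (m+1) → M => R (fun i => w i.castSucc) (w (Fin.last m)))) :
    Dfn (fun v => ∀ x, R v x) := by
  obtain ⟨b, hb⟩ := h
  refine ⟨∀' b, fun v => ?_⟩
  simp only [BoundedFormula.realize_all, hb, snoc_eta, Fin.snoc_last]
theorem Dfn.ex {R : (Fin m → M) → M → Prop}
    (h : Dfn (fun w : Fin (m+1) → M => R (fun i => w i.castSucc) (w (Fin.last m)))) :
    Dfn (fun v => ∃ x, R v x) := by
  obtain ⟨b, hb⟩ := h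
  refine ⟨∃' b, fun v => ?_⟩
  simp only [BoundedFormula.realize_ex, hb, snoc_eta, Fin.snoc_last]
theorem Dfn.subst {m' : ℕ} (h : Dfn P) {s : (Fin m' → M) → Fin m → M}
    (hs : ∀ j, DF (fun v => s v j)) : Dfn (fun v => P (s v)) := by
  obtain ⟨a, ha⟩ := h; choose b hb using hs
  exact ⟨gsub id a b, fun v => by
    rw [r_gsub]; simp only [hb, Function.comp_id]; exact ha _⟩
theorem Fm.dfn {R : ∀ (M : Type) [PAM M], (Fin m → M) → Prop} (h : Fm R) {m' : ℕ}
    {s : (Fin m' → M) → Fin m → M}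
    (hs : ∀ j, DF (fun v => s v j)) : Dfn (fun v => R M (s v)) := by
  obtain ⟨a, ha⟩ := h; choose b hb using hs
  exact ⟨sub a b, fun v => by
    rw [r_sub]; simp only [hb]; exact ha _ _⟩

theorem Dfn.comp1 {R : M → Prop} (h : Dfn (fun w : Fin 1 → M => R (w 0))) (ht : DF t) :
    Dfn (fun v => R (t v)) :=
  h.subst (s := fun v _ => t v) fun _ => ht
theorem Dfn.comp2 {R : M → M → Prop} (h : Dfn (fun w : Fin 2 → M => R (w 0) (w 1))) (ht : DF t)
    (hu : DF u) : Dfn (fun v => R (t v) (u v)) :=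
  h.subst (s := fun v => ![t v, u v]) fun j => by fin_cases j <;> assumption
theorem Fm.dfn1 {R : ∀ (M : Type) [PAM M], M → Prop} (h : Fm (fun M _ (w : Fin 1 → M) => R M (w 0)))
    (ht : DF t) : Dfn (fun v => R M (t v)) :=
  h.dfn (s := fun v _ => t v) fun _ => ht
theorem Fm.dfn2 {R : ∀ (M : Type) [PAM M], M → M → Prop}
    (h : Fm (fun M _ (w : Fin 2 → M) => R M (w 0) (w 1)))
    (ht : DF t) (hu : DF u) : Dfn (fun v => R M (t v) (u v)) :=
  h.dfn (s := fun v => ![t v, u v]) fun j => by fin_cases j <;> assumption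
theorem Fm.dfn3 {R : ∀ (M : Type) [PAM M], M → M → M → Prop}
    (h : Fm (fun M _ (w : Fin 3 → M) => R M (w 0) (w 1) (w 2))) {s : (Fin m → M) → M}
    (ht : DF t) (hu : DF u) (hs : DF s) : Dfn (fun v => R M (t v) (u v) (s v)) :=
  h.dfn (s := fun v => ![t v, u v, s v]) fun j => by fin_cases j <;> assumption

/-- induction for definable predicates -/
theorem Dfn.ind {R : M → Prop} (h : Dfn (fun w : Fin 1 → M => R (w 0)))
    (h0 : R 0) (hs : ∀ x, R x → R (x + 1)) (x : M) : R x := by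
  classical
  obtain ⟨φ, hφ⟩ := h
  let s := φ.freeVarFinset
  let φ' : LA.BoundedFormula s 1 := φ.restrictFreeVar id
  have h1 : ∀ v : Fin 1 → M, φ'.Realize (fun x : s => (x : M)) v ↔ φ.Realize id v := by
    intro v
    exact BoundedFormula.realize_restrictFreeVar id (fun a => rfl)
  let e := s.equivFin
  let φ2 : LA.BoundedFormula Empty (s.card + 1) := φ'.relabel (fun a => Sum.inr (e a))
  have h2 : ∀ y, φ2.Realize default (Fin.snoc (fun i => (e.symm i : M)) y) ↔ R y := by
    intro y
    have := BoundedFormula.realize_relabel (φ := φ') (g := fun a => (Sum.inr (e a) : Empty ⊕ _))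
      (v := (default : Empty → M)) (xs := Fin.snoc (fun i => (e.symm i : M)) y)
    refine this.trans ?_
    have e1 : (Sum.elim (default : Empty → M) ((Fin.snoc (fun i => (e.symm i : M)) y : Fin (s.card + 1) → M) ∘ Fin.castAdd 1) ∘
      fun a => Sum.inr (e a)) = fun x : s => (x : M) := by
      funext a
      change (Fin.snoc (fun i => (e.symm i : M)) y : Fin (s.card + 1) → M) (Fin.castSucc (e a)) = _
      rw [Fin.snoc_castSucc]; simp
    rw [e1, h1, hφ]
    change R ((Fin.snoc (fun i => (e.symm i : M)) y : Fin (s.card + 1) → M) (Fin.last _)) ↔ _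
    rw [Fin.snoc_last]
  exact (h2 x).1 (PAM.ind _ φ2 _ ((h2 0).2 h0) (fun a ha => (h2 _).2 (hs a ((h2 _).1 ha))) x)

theorem Dfn.sind {R : M → Prop} (h : Dfn (fun w : Fin 1 → M => R (w 0)))
    (hs : ∀ x, (∀ y, y < x → R y) → R x) (x : M) : R x := by
  have : ∀ y, y < x + 1 → R y := by
    refine Dfn.ind (R := fun x => ∀ y, y < x + 1 → R y) ?_ ?_ ?_ x
    · apply Dfn.all
      exact .imp (.lt (.var _) (.add (.var _) (.const _))) (h.comp1 (.var _))
    · intro y hy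
      rw [lt_succ_iff, nonpos_iff_eq_zero] at hy
      subst hy
      exact hs _ fun y hy => absurd hy not_lt_zero
    · intro x ih y hy
      rw [lt_succ_iff, le_iff_lt_or_eq] at hy
      rcases hy with hy | rfl
      · exact ih y hy
      · exact hs _ ih
  exact this x (lt_add_one x)

theorem Dfn.least {R : M → Prop} (h : Dfn (fun w : Fin 1 → M => R (w 0))) (x : M) (hx : R x) :
    ∃ y, R y ∧ ∀ z, z < y → ¬ R z := by
  by_contra hc
  push Not at hc
  refine Dfn.sind (R := fun x => ¬ R x) h.not ?_ x hx
  intro x ih hx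
  obtain ⟨z, h1, h2⟩ := hc x hx
  exact ih z h1 h2
end
end Guaspari

namespace Guaspari
set_option linter.unusedSimpArgs false
set_option linter.unusedVariables false

section
variable {M : Type} [PAM M]

theorem Dfn.dvd {m : ℕ} {t u : (Fin m → M) → M} (h1 : DF t) (h2 : DF u) :
    Dfn (fun v => t v ∣ u v) := by
  refine Dfn.congr (P := fun v => ∃ x, u v = t v * x) ?_ fun v => Iff.rfl
  apply Dfn.ex
  obtain ⟨a, ha⟩ := h1; obtain ⟨b, hb⟩ := h2
  refine Dfn.eq (t := fun w : Fin (m+1) → M => u fun i => w i.castSucc)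
    ⟨gtsub id b (fun i => .var (.inr i.castSucc)), fun v => ?_⟩ 
    (DF.mul (t := fun w : Fin (m+1) → M => t fun i => w i.castSucc)
    ⟨gtsub id a (fun i => .var (.inr i.castSucc)), fun v => ?_⟩ (.var _))
  · rw [r_gtsub]; exact hb _
  · rw [r_gtsub]; exact ha _

/-- coded membership -/
def mem (z S : M) : Prop :=
  ∃ c, c ≤ S ∧ ∃ m, m ≤ S ∧ ∃ b, b ≤ S ∧ (S = pr (pr c m) b ∧ (z ≤ b ∧
    ∃ k, k ≤ c ∧ c = (1 + (z + 1) * m) * k))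

theorem mem_code (z c m b : M) : mem z (pr (pr c m) b) ↔ z ≤ b ∧ (1 + (z + 1) * m) ∣ c := by
  constructor
  · rintro ⟨c', _, m', _, b', _, h, h1, k, _, h2⟩
    rw [pr_inj, pr_inj] at h
    obtain ⟨⟨rfl, rfl⟩, rfl⟩ := h
    exact ⟨h1, k, h2⟩
  · rintro ⟨h1, k, h2⟩
    refine ⟨c, (le_prl c m).trans (le_prl _ _), m, (le_prr c m).trans (le_prl _ _), b,
      le_prr _ _, rfl, h1, k, ?_, h2⟩
    rw [h2, add_mul, one_mul]
    exact le_self_add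

theorem mem_le {z S : M} (h : mem z S) : z ≤ S := by
  obtain ⟨c', _, m', _, b', h0, h, h1, _⟩ := h
  exact h1.trans h0

theorem common_mult (b : M) : ∃ m : M, m ≠ 0 ∧ ∀ k, k ≤ b → k + 1 ∣ m := by
  refine Dfn.ind (R := fun b => ∃ m : M, m ≠ 0 ∧ ∀ k, k ≤ b → k + 1 ∣ m) ?_ ?_ ?_ b
  · apply Dfn.ex
    refine .and (.ne (.var _) (.const 0)) ?_
    apply Dfn.all
    exact .imp (.le (.var _) (.var _)) (.dvd (.add (.var _) (.const 1)) (.var _))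
  · refine ⟨1, one_ne_zero, fun k hk => ?_⟩
    rw [nonpos_iff_eq_zero] at hk
    subst hk; simp
  · rintro x ⟨m, h0, h⟩
    refine ⟨m * (x + 1 + 1), mul_ne_zero h0 (by positivity), fun k hk => ?_⟩
    rw [le_succ_iff] at hk
    rcases hk with hk | rfl
    · exact (h k hk).mul_right _
    · exact Dvd.intro_left m rfl

theorem cop_aux {c k m z : M} (hk : k ∣ m) (h : 1 + (z + 1) * m ∣ c * k * m) :
    1 + (z + 1) * m ∣ c := by
  obtain ⟨m', hm⟩ := hk
  set d := 1 + (z + 1) * m with hd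
  set a := (z + 1) * m with ha
  have h1 : d ∣ c * a * a := by
    have : c * a * a = c * k * m * (m' * ((z+1)*(z+1))) := by
      calc c * a * a = c * m * m * ((z+1)*(z+1)) := by rw [ha]; ring
        _ = c * (k * m') * m * ((z+1)*(z+1)) := by rw [← hm]
        _ = _ := by ring
    rw [this]; exact h.mul_right _
  have h2 : d ∣ c * a := dvd_cancel h1 ⟨c * a, by rw [hd]; ring⟩
  exact dvd_cancel h2 ⟨c, by rw [hd]; ring⟩

theorem cop {c m z j b : M} (hm : ∀ k, k ≤ b → k + 1 ∣ m) (hz : z ≤ b) (hj : j ≤ b) (hne : z ≠ j)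
    (h : 1 + (z + 1) * m ∣ c * (1 + (j + 1) * m)) : 1 + (z + 1) * m ∣ c := by
  rcases lt_or_gt_of_ne hne with h1 | h1
  · rw [lt_iff_succ] at h1
    obtain ⟨k, rfl⟩ := (PAM.le_iff _ _).1 h1
    have hk : k + 1 ∣ m := hm k (le_trans le_add_self hj)
    refine cop_aux hk ?_
    refine dvd_cancel (a := c * (1 + (z + 1) * m)) (Dvd.intro_left c rfl) ?_
    convert h using 1; ring
  · rw [lt_iff_succ] at h1
    obtain ⟨k, rfl⟩ := (PAM.le_iff _ _).1 h1
    have hk : k + 1 ∣ m := hm k (le_trans le_add_self hz)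
    refine cop_aux hk ?_
    refine dvd_cancel h ?_
    exact ⟨c, by ring⟩

theorem coded {P : M → Prop} (hP : Dfn (fun w : Fin 1 → M => P (w 0))) (b : M) :
    ∃ S, ∀ z, mem z S ↔ z ≤ b ∧ P z := by
  obtain ⟨m, h0, hm⟩ := common_mult b
  have key : ∀ j, ∃ c, ∀ z, z ≤ b → (1 + (z + 1) * m ∣ c ↔ P z ∧ z < j) := by
    refine Dfn.ind ?_ ?_ ?_
    · apply Dfn.ex
      apply Dfn.all
      exact .imp (.le (.var _) (.const b)) (.iff (.dvd (.add (.const 1) (.mul (.add (.var _) (.const 1))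
        (.const m))) (.var _)) (.and (hP.comp1 (.var _)) (.lt (.var _) (.var _))))
    · refine ⟨1, fun z hz => ?_⟩
      simp only [not_lt_zero, and_false, iff_false]
      rintro ⟨k, hk⟩
      have hk0 : k ≠ 0 := by rintro rfl; simp at hk
      rcases zs k with rfl | ⟨k, rfl⟩
      · exact hk0 rfl
      have : (1 : M) + ((z + 1) * m + k + (z+1) * m * k) = 1 + 0 := by
        rw [add_zero]; refine Eq.trans ?_ hk.symm; ring
      have := add_left_cancel this
      rw [add_eq_zero, add_eq_zero, mul_eq_zero] at this
      rcases this.1.1 with h | h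
      · rw [add_eq_zero] at h; exact one_ne_zero h.2
      · exact h0 h
    · rintro j ⟨c, hc⟩
      by_cases hj : P j ∧ j ≤ b
      · refine ⟨c * (1 + (j + 1) * m), fun z hz => ?_⟩
        by_cases hzj : z = j
        · subst hzj
          simp [hj.1]
        · rw [lt_succ_iff, le_iff_lt_or_eq, or_iff_left hzj, ← hc z hz]
          exact ⟨cop hm hz hj.2 hzj, fun h => h.mul_right _⟩
      · refine ⟨c, fun z hz => ?_⟩
        rw [hc z hz, lt_succ_iff, le_iff_lt_or_eq]
        constructor
        · exact fun h => ⟨h.1, .inl h.2⟩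
        · rintro ⟨h1, h2 | rfl⟩
          · exact ⟨h1, h2⟩
          · exact absurd ⟨h1, hz⟩ hj
  obtain ⟨c, hc⟩ := key (b + 1)
  refine ⟨pr (pr c m) b, fun z => ?_⟩
  rw [mem_code]
  constructor
  · exact fun h => ⟨h.1, ((hc z h.1).1 h.2).1⟩
  · exact fun h => ⟨h.1, (hc z h.1).2 ⟨h.2, (lt_succ_iff _ _).2 h.1⟩⟩
end

theorem mem_D0 {m : ℕ} {z S : ∀ (M : Type) [PAM M], (Fin m → M) → M} (h1 : DT z) (h2 : DT S) :
    D0 (fun M _ v => mem (z M v) (S M v)) := by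
  unfold mem
  repeat first
    | exact DT.var _ | exact DT.one | exact DT.ren h1 _ | exact DT.ren h2 _ | assumption
    | apply D0.bex | apply D0.and | apply D0.eq | apply D0.le | apply DT.add | apply DT.mul | apply DT.pr

section
variable {M : Type} [PAM M]
theorem mem_dfn {m : ℕ} {z S : (Fin m → M) → M} (h1 : DF z) (h2 : DF S) :
    Dfn (fun v => mem (z v) (S v)) :=
  (mem_D0 (z := fun M _ (w : Fin 2 → M) => w 0) (S := fun M _ (w : Fin 2 → M) => w 1)
    (.var 0) (.var 1)).fm.dfn2 (R := fun M _ a b => mem a b) h1 h2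

theorem coded_insert (x S : M) : ∃ S', ∀ z, mem z S' ↔ z = x ∨ mem z S := by
  obtain ⟨S', h⟩ := coded (P := fun z => z = x ∨ mem z S)
    (.or (.eq (.var _) (.const x)) (mem_dfn (.var _) (.const S))) (x + S)
  refine ⟨S', fun z => (h z).trans ⟨fun h => h.2, fun h => ⟨?_, h⟩⟩⟩
  rcases h with rfl | h
  · exact le_self_add
  · exact (mem_le h).trans le_add_self
theorem coded_union (S T : M) : ∃ S', ∀ z, mem z S' ↔ mem z S ∨ mem z T := by
  obtain ⟨S', h⟩ := coded (P := fun z => mem z S ∨ mem z T)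
    (.or (mem_dfn (.var _) (.const S)) (mem_dfn (.var _) (.const T))) (S + T)
  refine ⟨S', fun z => (h z).trans ⟨fun h => h.2, fun h => ⟨?_, h⟩⟩⟩
  rcases h with h | h
  · exact (mem_le h).trans le_self_add
  · exact (mem_le h).trans le_add_self
theorem coded_empty : ∃ S : M, ∀ z, ¬ mem z S := by
  obtain ⟨S', h⟩ := coded (P := fun z : M => False) (.const _) 0
  exact ⟨S', fun z hz => ((h z).1 hz).2⟩
end
end Guaspari

namespace Guaspari
set_option linter.unusedSimpArgs false
set_option linter.unusedVariables false

/-! ### universal evaluator -/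
section
variable {M : Type} [PAM M]

/-- triples -/
def tri (i a v : M) : M := pr i (pr a v)
theorem tri_inj {i a v j b w : M} : tri i a v = tri j b w ↔ i = j ∧ a = b ∧ v = w := by
  unfold tri; rw [pr_inj, pr_inj]

/-- base clauses -/
def Bse (i a v : M) : Prop :=
  (i = pr (pr 0 0) 0 ∧ v = 0) ∨ (i = pr (pr 0 1) 0 ∧ v = a) ∨
  (i = pr (pr 0 2) 0 ∧ ((∃ y, y ≤ a ∧ a = pr v y) ∨
    (v = 0 ∧ ¬ ∃ x, x ≤ a ∧ ∃ y, y ≤ a ∧ a = pr x y))) ∨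
  (i = pr (pr 0 3) 0 ∧ ((∃ y, y ≤ a ∧ a = pr y v) ∨
    (v = 0 ∧ ¬ ∃ x, x ≤ a ∧ ∃ y, y ≤ a ∧ a = pr x y))) ∨
  (v = 1 ∧ ∃ f, f ≤ i ∧ ∃ e, e ≤ a ∧ (i = pr (pr 3 0) (pr f 0) ∧ a = pr 0 e))

/-- binary operations -/
def OP (o u w v : M) : Prop :=
  (o = 0 ∧ v = pr u w) ∨ (o = 1 ∧ v = u + w) ∨ (o = 2 ∧ v = u * w) ∨
  (o = 3 ∧ ((u ≤ w ∧ v = 1) ∨ (¬ u ≤ w ∧ v = 0))) ∨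
  (o = 4 ∧ ((u = w ∧ v = 1) ∨ (¬ u = w ∧ v = 0))) ∨
  (o = 5 ∧ (((u ≠ 0 → w ≠ 0) ∧ v = 1) ∨ (¬ (u ≠ 0 → w ≠ 0) ∧ v = 0))) ∨
  (o = 6 ∧ (((u ≠ 0 ∧ w ≠ 0) ∧ v = 1) ∨ (¬ (u ≠ 0 ∧ w ≠ 0) ∧ v = 0)))

/-- step clauses -/
def Stp (i a v j b u k c w : M) : Prop :=
  (∃ o, o ≤ i ∧ (i = pr (pr 1 o) (pr j k) ∧ b = a ∧ c = a ∧ OP o u w v)) ∨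
  (i = pr (pr 2 0) (pr j k) ∧ c = a ∧ b = w ∧ v = u) ∨
  (∃ e, e ≤ a ∧ ∃ b', b' ≤ a ∧ (a = pr (b' + 1) e ∧ j = i ∧ i = pr (pr 3 0) (pr k 0) ∧
    b = pr b' e ∧ c = pr b' e ∧ OP 6 u w v))

/-- tables -/
def just (S : M) : Prop :=
  ∀ i, i ≤ S → ∀ a, a ≤ S → ∀ v, v ≤ S → (mem (tri i a v) S → (Bse i a v ∨
    ∃ j, j ≤ S ∧ ∃ b, b ≤ S ∧ ∃ u, u ≤ S ∧ ∃ k, k ≤ S ∧ ∃ c, c ≤ S ∧ ∃ w, w ≤ S ∧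
      (mem (tri j b u) S ∧ mem (tri k c w) S ∧ Stp i a v j b u k c w)))

theorem tri_le {i a v S : M} (h : mem (tri i a v) S) : i ≤ S ∧ a ≤ S ∧ v ≤ S := by
  have := mem_le h
  exact ⟨(le_prl _ _).trans this, ((le_prl _ _).trans (le_prr _ _)).trans this,
    ((le_prr _ _).trans (le_prr _ _)).trans this⟩

theorem just_iff (S : M) : just S ↔ ∀ i a v, mem (tri i a v) S → (Bse i a v ∨
    ∃ j b u k c w, (mem (tri j b u) S ∧ mem (tri k c w) S ∧ Stp i a v j b u k c w)) := by
  constructor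
  · intro h i a v hm
    obtain ⟨h1, h2, h3⟩ := tri_le hm
    rcases h i h1 a h2 v h3 hm with h | ⟨j, _, b, _, u, _, k, _, c, _, w, _, h⟩
    · exact .inl h
    · exact .inr ⟨j, b, u, k, c, w, h⟩
  · intro h i _ a _ v _ hm
    rcases h i a v hm with h | ⟨j, b, u, k, c, w, h⟩
    · exact .inl h
    · obtain ⟨h1, h2, h3⟩ := tri_le h.1
      obtain ⟨g1, g2, g3⟩ := tri_le h.2.1
      exact .inr ⟨j, h1, b, h2, u, h3, k, g1, c, g2, w, g3, h⟩

/-- the evaluator -/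
def Ev (i a v : M) : Prop := ∃ S, just S ∧ mem (tri i a v) S

theorem ev_iff (i a v : M) : Ev i a v ↔ Bse i a v ∨
    ∃ j b u k c w, Ev j b u ∧ Ev k c w ∧ Stp i a v j b u k c w := by
  constructor
  · rintro ⟨S, hS, h⟩
    rcases (just_iff S).1 hS i a v h with h | ⟨j, b, u, k, c, w, h1, h2, h3⟩
    · exact .inl h
    · exact .inr ⟨j, b, u, k, c, w, ⟨S, hS, h1⟩, ⟨S, hS, h2⟩, h3⟩
  · rintro (h | ⟨j, b, u, k, c, w, ⟨S1, hS1, h1⟩, ⟨S2, hS2, h2⟩, h3⟩)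
    · obtain ⟨S0, h0⟩ := coded_empty (M := M)
      obtain ⟨S, hS⟩ := coded_insert (tri i a v) S0
      refine ⟨S, (just_iff S).2 ?_, (hS _).2 (.inl rfl)⟩
      intro i' a' v' hm
      rcases (hS _).1 hm with hm | hm
      · rw [tri_inj] at hm; obtain ⟨rfl, rfl, rfl⟩ := hm; exact .inl h
      · exact absurd hm (h0 _)
    · obtain ⟨S0, h0⟩ := coded_union S1 S2
      obtain ⟨S, hS⟩ := coded_insert (tri i a v) S0
      have hl : ∀ z, mem z S1 → mem z S := fun z hz => (hS z).2 (.inr ((h0 z).2 (.inl hz)))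
      have hr : ∀ z, mem z S2 → mem z S := fun z hz => (hS z).2 (.inr ((h0 z).2 (.inr hz)))
      refine ⟨S, (just_iff S).2 ?_, (hS _).2 (.inl rfl)⟩
      intro i' a' v' hm
      rcases (hS _).1 hm with hm | hm
      · rw [tri_inj] at hm; obtain ⟨rfl, rfl, rfl⟩ := hm
        exact .inr ⟨j, b, u, k, c, w, hl _ h1, hr _ h2, h3⟩
      · rcases (h0 _).1 hm with hm | hm
        · rcases (just_iff _).1 hS1 i' a' v' hm with h | ⟨j, b, u, k, c, w, h1, h2, h3⟩
          · exact .inl h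
          · exact .inr ⟨j, b, u, k, c, w, hl _ h1, hl _ h2, h3⟩
        · rcases (just_iff _).1 hS2 i' a' v' hm with h | ⟨j, b, u, k, c, w, h1, h2, h3⟩
          · exact .inl h
          · exact .inr ⟨j, b, u, k, c, w, hr _ h1, hr _ h2, h3⟩

open Classical in
/-- left projection -/
noncomputable def pL (a : M) : M := if h : ∃ x y, a = pr x y then h.choose else 0
open Classical in
/-- right projection -/
noncomputable def pR (a : M) : M := if h : ∃ x y, a = pr x y then h.choose_spec.choose else 0

theorem pLR {a x y : M} (h : a = pr x y) : pL a = x ∧ pR a = y := by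
  have h' : ∃ x y, a = pr x y := ⟨x, y, h⟩
  have := h'.choose_spec.choose_spec
  unfold pL pR
  rw [dif_pos h', dif_pos h']
  exact pr_inj.1 (this.symm.trans h)
@[simp] theorem pL_pr (x y : M) : pL (pr x y) = x := (pLR rfl).1
@[simp] theorem pR_pr (x y : M) : pR (pr x y) = y := (pLR rfl).2
theorem pLR0 {a : M} (h : ¬ ∃ x y, a = pr x y) : pL a = 0 ∧ pR a = 0 := by
  unfold pL pR
  rw [dif_neg h, dif_neg h]; exact ⟨rfl, rfl⟩

theorem bex_pr (a : M) : (∃ x, x ≤ a ∧ ∃ y, y ≤ a ∧ a = pr x y) ↔ ∃ x y, a = pr x y := by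
  constructor
  · rintro ⟨x, _, y, _, h⟩; exact ⟨x, y, h⟩
  · rintro ⟨x, y, h⟩
    exact ⟨x, h ▸ le_prl _ _, y, h ▸ le_prr _ _, h⟩

theorem ev_zero (a v : M) : Ev (pr (pr 0 0) 0) a v ↔ v = 0 := by
  rw [ev_iff]; simp [Bse, Stp, pr_inj]
theorem ev_id (a v : M) : Ev (pr (pr 0 1) 0) a v ↔ v = a := by
  rw [ev_iff]; simp [Bse, Stp, pr_inj]
theorem ev_L (a v : M) : Ev (pr (pr 0 2) 0) a v ↔ v = pL a := by
  rw [ev_iff]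
  simp only [Bse, Stp, bex_pr]
  simp only [pr_inj]
  have e : (∃ y, y ≤ a ∧ a = pr v y) ↔ ∃ y, a = pr v y :=
    ⟨fun ⟨y, _, h⟩ => ⟨y, h⟩, fun ⟨y, h⟩ => ⟨y, h ▸ le_prr _ _, h⟩⟩
  rw [e]
  simp
  by_cases h : ∃ x y, a = pr x y
  · obtain ⟨x, y, rfl⟩ := h
    simp [pr_inj]
    exact eq_comm
  · rw [(pLR0 h).1]
    push Not at h
    simp [h]
theorem ev_R (a v : M) : Ev (pr (pr 0 3) 0) a v ↔ v = pR a := by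
  rw [ev_iff]
  simp only [Bse, Stp, bex_pr]
  simp only [pr_inj]
  have e : (∃ y, y ≤ a ∧ a = pr y v) ↔ ∃ y, a = pr y v :=
    ⟨fun ⟨y, _, h⟩ => ⟨y, h⟩, fun ⟨y, h⟩ => ⟨y, h ▸ le_prl _ _, h⟩⟩
  rw [e]
  simp
  by_cases h : ∃ x y, a = pr x y
  · obtain ⟨x, y, rfl⟩ := h
    simp [pr_inj]
    exact eq_comm
  · rw [(pLR0 h).2]
    push Not at h
    simp [h]
theorem ev_op (o j k a v : M) : Ev (pr (pr 1 o) (pr j k)) a v ↔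
    ∃ u w, Ev j a u ∧ Ev k a w ∧ OP o u w v := by
  rw [ev_iff]
  constructor
  · rintro (h | ⟨j', b, u, k', c, w, h1, h2, h⟩)
    · simp [Bse, pr_inj] at h
    · simp [Stp, pr_inj] at h
      obtain ⟨_, ⟨rfl, rfl⟩, rfl, rfl, h⟩ := h
      exact ⟨u, w, h1, h2, h⟩
  · rintro ⟨u, w, h1, h2, h⟩
    exact .inr ⟨j, a, u, k, a, w, h1, h2,
      .inl ⟨o, (le_prr _ _).trans (le_prl _ _), rfl, rfl, rfl, h⟩⟩
theorem ev_cmp (j k a v : M) : Ev (pr (pr 2 0) (pr j k)) a v ↔ ∃ u, Ev k a u ∧ Ev j u v := by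
  rw [ev_iff]
  constructor
  · rintro (h | ⟨j', b, u, k', c, w, h1, h2, h⟩)
    · simp [Bse, pr_inj] at h
    · simp [Stp, pr_inj] at h
      obtain ⟨⟨rfl, rfl⟩, rfl, rfl, rfl⟩ := h
      exact ⟨b, h2, h1⟩
  · rintro ⟨u, h1, h2⟩
    exact .inr ⟨j, u, v, k, a, u, h2, h1, .inr (.inl ⟨rfl, rfl, rfl, rfl⟩)⟩
theorem ev_ball0 (f e v : M) : Ev (pr (pr 3 0) (pr f 0)) (pr 0 e) v ↔ v = 1 := by
  rw [ev_iff]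
  constructor
  · rintro (h | ⟨j', b, u, k', c, w, h1, h2, h⟩)
    · simp [Bse, pr_inj] at h
      exact h.1
    · simp [Stp, pr_inj] at h
      obtain ⟨_, x, _, h0, _⟩ := h
      exact absurd h0.symm (by positivity)
  · rintro rfl
    refine .inl (.inr (.inr (.inr (.inr ⟨rfl, f, ?_, e, ?_, rfl, rfl⟩))))
    · exact (le_prl _ _).trans (le_prr _ _)
    · exact le_prr _ _
theorem ev_ballS (f b e v : M) : Ev (pr (pr 3 0) (pr f 0)) (pr (b + 1) e) v ↔
    ∃ u w, Ev (pr (pr 3 0) (pr f 0)) (pr b e) u ∧ Ev f (pr b e) w ∧ OP 6 u w v := by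
  rw [ev_iff]
  constructor
  · rintro (h | ⟨j', b, u, k', c, w, h1, h2, h⟩)
    · simp [Bse, pr_inj] at h
    · simp [Stp, pr_inj] at h
      obtain ⟨_, _, rfl, rfl, rfl, rfl, h⟩ := h
      exact ⟨u, w, h1, h2, h⟩
  · rintro ⟨u, w, h1, h2, h⟩
    refine .inr ⟨_, _, u, _, _, w, h1, h2, .inr (.inr ⟨e, le_prr _ _, b, ?_, rfl, rfl, rfl, rfl, rfl, h⟩)⟩
    exact le_trans le_self_add (le_prl _ _)
end

section
variable {m : ℕ} {i a v o u w j b k c S : ∀ (M : Type) [PAM M], (Fin m → M) → M}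
theorem DT.two : DT (fun M _ (v : Fin m → M) => (2 : M)) := by simpa using DT.nat (m := m) 2
theorem DT.three : DT (fun M _ (v : Fin m → M) => (3 : M)) := by simpa using DT.nat (m := m) 3
theorem DT.four : DT (fun M _ (v : Fin m → M) => (4 : M)) := by simpa using DT.nat (m := m) 4
theorem DT.five : DT (fun M _ (v : Fin m → M) => (5 : M)) := by simpa using DT.nat (m := m) 5
theorem DT.six : DT (fun M _ (v : Fin m → M) => (6 : M)) := by simpa using DT.nat (m := m) 6
theorem DT.tri (h1 : DT i) (h2 : DT a) (h3 : DT v) :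
    DT (fun M _ w => tri (i M w) (a M w) (v M w)) := .pr h1 (.pr h2 h3)
theorem Bse_D0 (hi : DT i) (ha : DT a) (hv : DT v) :
    D0 (fun M _ w => Bse (i M w) (a M w) (v M w)) := by
  unfold Bse
  repeat first
    | exact DT.var _ | exact DT.zero | exact DT.one | exact DT.two | exact DT.three
    | exact hi.ren _ | exact ha.ren _ | exact hv.ren _ | assumption
    | apply D0.bex | apply D0.and | apply D0.or | apply D0.not | apply D0.eq | apply DT.pr
theorem OP_D0 (ho : DT o) (hu : DT u) (hw : DT w) (hv : DT v) :
    D0 (fun M _ x => OP (o M x) (u M x) (w M x) (v M x)) := by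
  unfold OP
  repeat first
    | exact DT.zero | exact DT.one | exact DT.two | exact DT.three
    | exact DT.four | exact DT.five | exact DT.six
    | assumption
    | apply D0.and | apply D0.or | apply D0.ne | apply D0.not | apply D0.eq | apply D0.le
    | apply D0.imp | apply DT.pr | apply DT.add | apply DT.mul
theorem Stp_D0 (hi : DT i) (ha : DT a) (hv : DT v) (hj : DT j) (hb : DT b) (hu : DT u) (hk : DT k)
    (hc : DT c) (hw : DT w) :
    D0 (fun M _ x => Stp (i M x) (a M x) (v M x) (j M x) (b M x) (u M x) (k M x) (c M x) (w M x)) := by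
  unfold Stp
  repeat first
    | exact DT.var _ | exact DT.zero | exact DT.one | exact DT.two | exact DT.three | exact DT.six
    | exact hi.ren _ | exact ha.ren _ | exact hv.ren _ | exact hj.ren _ | exact hb.ren _
    | exact hu.ren _ | exact hk.ren _ | exact hc.ren _ | exact hw.ren _
    | exact hi.ren _ |>.ren _ | exact (ha.ren _).ren _ | exact (hv.ren _).ren _
    | exact (hj.ren _).ren _ | exact (hb.ren _).ren _ | exact (hu.ren _).ren _
    | exact (hk.ren _).ren _ | exact (hc.ren _).ren _ | exact (hw.ren _).ren _
    | assumption
    | apply OP_D0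
    | apply D0.bex | apply D0.and | apply D0.or | apply D0.eq | apply DT.pr | apply DT.add
theorem just_D0 (hS : DT S) : D0 (fun M _ x => just (S M x)) := by
  have key : D0 (fun M _ (x : Fin 1 → M) => just (x 0)) := by
    unfold just
    repeat first
      | exact DT.var _
      | apply DT.tri | apply mem_D0 | apply Bse_D0 | apply Stp_D0
      | apply D0.bex | apply D0.ball | apply D0.and | apply D0.or | apply D0.imp
  exact key.subst (s := fun M _ x _ => S M x) fun _ => hS
theorem Ev_SigF (hi : DT i) (ha : DT a) (hv : DT v) :
    SigF 1 (fun M _ x => Ev (i M x) (a M x) (v M x)) := by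
  have key : SigF 1 (fun M _ (x : Fin 3 → M) => Ev (x 0) (x 1) (x 2)) := by
    unfold Ev
    apply SigF.ex
    apply PiF.up
    apply D0.pi
    exact .and (just_D0 (.var _)) (mem_D0 (.tri (.var _) (.var _) (.var _)) (.var _))
  exact key.subst (s := fun M _ x => ![i M x, a M x, v M x]) fun j => by
    fin_cases j <;> assumption
end
end Guaspari

namespace Guaspari
set_option linter.unusedSimpArgs false
set_option linter.unusedVariables false

/-- represented by the code `c` -/
def Rep (c : ℕ) (F : ∀ (M : Type) [PAM M], M → M) : Prop :=
  ∀ (M : Type) [PAM M] (a v : M), Ev (c : M) a v ↔ v = F M a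
/-- representable functions -/
def RF (F : ∀ (M : Type) [PAM M], M → M) : Prop := ∃ c, Rep c F
open Classical in
/-- representable predicates -/
def RP (P : ∀ (M : Type) [PAM M], M → Prop) : Prop :=
  RF (fun M _ a => if P M a then (1 : M) else 0)

theorem cast_pr {M : Type} [PAM M] (x y : ℕ) : ((pr x y : ℕ) : M) = pr (x : M) (y : M) := by
  change (((x + y) * (x + y) + x : ℕ) : M) = _
  unfold pr; push_cast; rfl

section
variable {F G : ∀ (M : Type) [PAM M], M → M} {P Q : ∀ (M : Type) [PAM M], M → Prop}
theorem RF.zero : RF (fun M _ a => (0 : M)) :=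
  ⟨pr (pr 0 0) 0, fun M _ a v => by simp only [cast_pr, Nat.cast_zero, Nat.cast_one]; exact ev_zero a v⟩
theorem RF.id : RF (fun M _ a => a) :=
  ⟨pr (pr 0 1) 0, fun M _ a v => by simp only [cast_pr, Nat.cast_zero, Nat.cast_one]; exact ev_id a v⟩
theorem RF.L : RF (fun M _ a => pL a) :=
  ⟨pr (pr 0 2) 0, fun M _ a v => by
    simp only [cast_pr, Nat.cast_zero, Nat.cast_one, Nat.cast_ofNat]; exact ev_L a v⟩
theorem RF.R : RF (fun M _ a => pR a) :=
  ⟨pr (pr 0 3) 0, fun M _ a v => by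
    simp only [cast_pr, Nat.cast_zero, Nat.cast_one, Nat.cast_ofNat]; exact ev_R a v⟩
theorem RF.op (o : ℕ) {H : ∀ (M : Type) [PAM M], M → M → M}
    (hH : ∀ (M : Type) [PAM M] (u w v : M), OP (o : M) u w v ↔ v = H M u w) (hF : RF F) (hG : RF G) :
    RF (fun M _ a => H M (F M a) (G M a)) := by
  obtain ⟨j, hj⟩ := hF
  obtain ⟨k, hk⟩ := hG
  refine ⟨pr (pr 1 o) (pr j k), fun M _ a v => ?_⟩
  simp only [cast_pr, Nat.cast_one, ev_op, hj M, hk M, hH]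
  constructor
  · rintro ⟨u, w, rfl, rfl, h⟩; exact h
  · exact fun h => ⟨_, _, rfl, rfl, h⟩
theorem RF.comp (hF : RF F) (hG : RF G) : RF (fun M _ a => F M (G M a)) := by
  obtain ⟨j, hj⟩ := hF
  obtain ⟨k, hk⟩ := hG
  refine ⟨pr (pr 2 0) (pr j k), fun M _ a v => ?_⟩
  simp only [cast_pr, Nat.cast_zero, Nat.cast_ofNat, ev_cmp, hj M, hk M, exists_eq_left]
theorem RF.pair (hF : RF F) (hG : RF G) : RF (fun M _ a => pr (F M a) (G M a)) :=
  RF.op 0 (H := fun M _ u w => pr u w) (fun M _ u w v => by simp [OP]) hF hG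
theorem RF.add (hF : RF F) (hG : RF G) : RF (fun M _ a => F M a + G M a) :=
  RF.op 1 (H := fun M _ u w => u + w) (fun M _ u w v => by simp [OP]) hF hG
theorem RF.mul (hF : RF F) (hG : RF G) : RF (fun M _ a => F M a * G M a) :=
  RF.op 2 (H := fun M _ u w => u * w) (fun M _ u w v => by simp [OP]) hF hG
theorem RP.le (hF : RF F) (hG : RF G) : RP (fun M _ a => F M a ≤ G M a) := by
  classical
  have := RF.op 3 (H := fun M _ u w => if u ≤ w then 1 else 0) (fun M _ u w v => by
    by_cases h : u ≤ w <;> simp [OP, h, not_lt.2, not_le.1]) hF hG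
  obtain ⟨c, hc⟩ := this
  refine ⟨c, fun M _ a v => (hc M a v).trans ?_⟩
  by_cases h1 : F M a ≤ G M a <;> simp only [h1, if_true, if_false]
theorem RP.eq (hF : RF F) (hG : RF G) : RP (fun M _ a => F M a = G M a) := by
  classical
  have := RF.op 4 (H := fun M _ u w => if u = w then 1 else 0) (fun M _ u w v => by
    by_cases h : u = w <;> simp [OP, h]) hF hG
  obtain ⟨c, hc⟩ := this
  refine ⟨c, fun M _ a v => (hc M a v).trans ?_⟩
  by_cases h1 : F M a = G M a <;> simp only [h1, if_true, if_false]
theorem RP.imp (hF : RP P) (hG : RP Q) : RP (fun M _ a => P M a → Q M a) := by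
  classical
  have := RF.op 5 (H := fun M _ u w => if (u ≠ 0 → w ≠ 0) then 1 else 0) (fun M _ u w v => by
    by_cases h : (u ≠ 0 → w ≠ 0)
    · rw [if_pos h]
      have h' : ¬ (u ≠ 0 ∧ w = 0) := fun ⟨a, b⟩ => h a b
      simp [OP, h']
      exact fun _ => h
    · rw [if_neg h]
      have h' : (u ≠ 0 ∧ w = 0) := by push Not at h; exact h
      simp [OP, h']) hF hG
  obtain ⟨c, hc⟩ := this
  refine ⟨c, fun M _ a v => (hc M a v).trans ?_⟩
  by_cases h1 : P M a <;> by_cases h2 : Q M a <;> simp [h1, h2]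
theorem RP.one : RF (fun M _ (a : M) => (1 : M)) := by
  obtain ⟨c, hc⟩ := RP.eq RF.zero RF.zero
  exact ⟨c, fun M _ a v => (hc M a v).trans (by simp)⟩
theorem RP.fls : RP (fun M _ (a : M) => False) := by
  obtain ⟨c, hc⟩ := RF.zero
  exact ⟨c, fun M _ a v => (hc M a v).trans (by simp)⟩
theorem RP.congr (h : RP P) (e : ∀ (M : Type) [PAM M] a, P M a ↔ Q M a) : RP Q := by
  obtain ⟨c, hc⟩ := h
  exact ⟨c, fun M _ a v => (hc M a v).trans (by
    beta_reduce
    by_cases h : P M a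
    · rw [if_pos h, if_pos ((e M a).1 h)]
    · rw [if_neg h, if_neg (fun h' => h ((e M a).2 h'))])⟩
theorem RP.comp (h : RP P) (hF : RF F) : RP (fun M _ a => P M (F M a)) := RF.comp h hF
theorem RP.not (h : RP P) : RP (fun M _ a => ¬ P M a) := h.imp RP.fls

theorem ball_aux {c : ℕ} {M : Type} [PAM M] {P : M → Prop} [DecidablePred P]
    (hc : ∀ a v : M, Ev (c : M) a v ↔ v = if P a then 1 else 0) (e b : M) [Decidable (∀ z, z < b → P (pr z e))] :
    ∀ v : M, Ev (pr (pr 3 0) (pr (c : M) 0)) (pr b e) v ↔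
      v = if (∀ z, z < b → P (pr z e)) then 1 else 0 := by
  classical
  have key : ∀ b v : M, Ev (pr (pr 3 0) (pr (c : M) 0)) (pr b e) v ↔
      (((∀ z, z < b → Ev (c : M) (pr z e) 1) ∧ v = 1) ∨ (¬ (∀ z, z < b → Ev (c : M) (pr z e) 1) ∧ v = 0)) := by
    intro b
    have hEv : ∀ {m : ℕ} {t u s : (Fin m → M) → M}, DF t → DF u → DF s → 
      Dfn (fun v => Ev (t v) (u v) (s v)) := fun h1 h2 h3 =>
        Fm.dfn3 (R := fun M _ a b c => Ev a b c) (Ev_SigF (.var _) (.var _) (.var _)).fm h1 h2 h3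
    refine Dfn.ind (R := fun b => ∀ v, Ev (pr (pr 3 0) (pr (c : M) 0)) (pr b e) v ↔
      (((∀ z, z < b → Ev (c : M) (pr z e) 1) ∧ v = 1) ∨ 
        (¬ (∀ z, z < b → Ev (c : M) (pr z e) 1) ∧ v = 0))) ?_ ?_ ?_ b
    · have h1 : Dfn (fun w : Fin 2 → M => ∀ z, z < w 0 → Ev (c : M) (pr z e) 1) := by
        apply Dfn.all
        exact .imp (.lt (.var _) (.var _)) (hEv (.const _) (.pr (.var _) (.const _)) (.const _))
      apply Dfn.all
      exact .iff (hEv (.const _) (.pr (.var _) (.const _)) (.var _))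
        (.or (.and h1 (.eq (.var _) (.const _))) (.and h1.not (.eq (.var _) (.const _))))
    · intro v; simp [ev_ball0]
    · intro b ih v
      rw [ev_ballS]
      have h2 : (∀ z, z < b + 1 → Ev (c : M) (pr z e) 1) ↔
        (∀ z, z < b → Ev (c : M) (pr z e) 1) ∧ Ev (c : M) (pr b e) 1 := by
        simp only [lt_succ_iff]
        exact ⟨fun h => ⟨fun z hz => h z hz.le, h b le_rfl⟩, fun h z hz =>
          (le_iff_lt_or_eq.1 hz).elim (h.1 z) (fun h' => h' ▸ h.2)⟩
      rw [h2]
      simp only [ih]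
      generalize (∀ z, z < b → Ev (c : M) (pr z e) 1) = A
      simp only [hc]
      by_cases h3 : A <;> by_cases h4 : P (pr b e) <;> simp [h3, h4, OP]
  intro v
  rw [key]
  have h5 : (∀ z, z < b → Ev (c : M) (pr z e) 1) ↔ ∀ z, z < b → P (pr z e) := by
    simp only [hc]
    refine forall₂_congr fun z hz => ?_
    by_cases h : P (pr z e) <;> simp [h]
  rw [h5]
  by_cases h6 : ∀ z, z < b → P (pr z e)
  · rw [if_pos h6]
    exact ⟨fun h => h.elim (fun h => h.2) (fun h => absurd h6 h.1), fun h => .inl ⟨h6, h⟩⟩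
  · rw [if_neg h6]; simp only [h6, not_false_iff, false_and, false_or, true_and]

theorem RP.ball (h : RP P) (hF : RF F) : RP (fun M _ a => ∀ z, z < F M a → P M (pr z a)) := by
  classical
  obtain ⟨c, hc⟩ := h
  have : RF (fun M _ a => pr (F M a) a) := hF.pair RF.id
  obtain ⟨d, hd⟩ := this
  refine ⟨pr (pr 2 0) (pr (pr (pr 3 0) (pr c 0)) d), fun M _ a v => ?_⟩
  simp only [cast_pr, Nat.cast_zero, Nat.cast_ofNat, ev_cmp, hd M, exists_eq_left]
  have := ball_aux (c := c) (P := P M) (fun a v => (hc M a v)) a (F M a) v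
  exact this
end

/-- stack of variables -/
def stack {M : Type} [PAM M] : {m : ℕ} → (Fin m → M) → M
  | 0, _ => 0
  | m + 1, v => pr (v (Fin.last m)) (stack (fun i => v i.castSucc))

theorem stack_snoc {M : Type} [PAM M] {m : ℕ} (v : Fin m → M) (x : M) :
    stack (Fin.snoc v x : Fin (m+1) → M) = pr x (stack v) := by
  simp only [stack, snoc_eta, Fin.snoc_last]

theorem var_RF : ∀ {m : ℕ} (i : Fin m), ∃ F : ∀ (M : Type) [PAM M], M → M, RF F ∧
    ∀ (M : Type) [PAM M] (v : Fin m → M), F M (stack v) = v i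
  | 0, i => i.elim0
  | m + 1, i => by
    refine Fin.lastCases ?_ (fun i => ?_) i
    · exact ⟨_, RF.L, fun M _ v => by simp [stack]⟩
    · obtain ⟨F, hF, h⟩ := var_RF i
      exact ⟨_, hF.comp RF.R, fun M _ v => by simp [stack, h]⟩

theorem term_RF {m : ℕ} (t : LA.Term (Empty ⊕ Fin m)) : ∃ F : ∀ (M : Type) [PAM M], M → M, RF F ∧
    ∀ (M : Type) [PAM M] (v : Fin m → M), F M (stack v) = t.realize (Sum.elim default v) := by
  induction t with
  | var x =>
    rcases x with x | i
    · exact x.elim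
    · exact var_RF i
  | func f ts ih =>
    rename_i l
    match l, f, ts, ih with
    | 0, f, ts, ih =>
      exact ⟨_, RF.zero, fun M _ v => (PAM.hz _).symm⟩
    | 1, f, ts, ih =>
      obtain ⟨F, hF, h⟩ := ih 0
      refine ⟨_, hF.add RP.one, fun M _ v => Eq.trans ?_ (PAM.hs _).symm⟩
      rw [h]
    | 2, false, ts, ih =>
      obtain ⟨F, hF, h⟩ := ih 0
      obtain ⟨G, hG, h'⟩ := ih 1
      refine ⟨_, hF.add hG, fun M _ v => Eq.trans ?_ (PAM.ha _).symm⟩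
      rw [h, h']
    | 2, true, ts, ih =>
      obtain ⟨F, hF, h⟩ := ih 0
      obtain ⟨G, hG, h'⟩ := ih 1
      refine ⟨_, hF.mul hG, fun M _ v => Eq.trans ?_ (PAM.hm _).symm⟩
      rw [h, h']
    | l + 3, f, ts, ih => exact Empty.elim f

theorem delta_RP {m : ℕ} {φ : LA.BoundedFormula Empty m} (h : IsDelta0 φ) :
    ∃ P : ∀ (M : Type) [PAM M], M → Prop, RP P ∧
    ∀ (M : Type) [PAM M] (v : Fin m → M), P M (stack v) ↔ φ.Realize default v := by
  induction h with
  | falsum => exact ⟨_, RP.fls, fun M _ v => Iff.rfl⟩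
  | equal t u =>
    obtain ⟨F, hF, h⟩ := term_RF t
    obtain ⟨G, hG, h'⟩ := term_RF u
    exact ⟨_, RP.eq hF hG, fun M _ v => by rw [h, h']; rfl⟩
  | le t u =>
    obtain ⟨F, hF, h⟩ := term_RF t
    obtain ⟨G, hG, h'⟩ := term_RF u
    exact ⟨_, RP.le hF hG, fun M _ v => by rw [h, h', r_le]⟩
  | imp _ _ h1 h2 =>
    obtain ⟨P, hP, h⟩ := h1
    obtain ⟨Q, hQ, h'⟩ := h2
    exact ⟨_, hP.imp hQ, fun M _ v => by rw [h, h']; rfl⟩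
  | ball t _ ih =>
    obtain ⟨P, hP, h⟩ := ih
    obtain ⟨F, hF, h'⟩ := term_RF t
    refine ⟨_, hP.ball (hF.add RP.one), fun M _ v => ?_⟩
    have := fun x => r_lft t default v x
    unfold lft at this
    simp only [lt_succ_iff, BoundedFormula.realize_all, BoundedFormula.realize_imp, r_le, r_v, h',
      ← stack_snoc, h, this, Fin.snoc_last]
  | bex t _ ih =>
    obtain ⟨P, hP, h⟩ := ih
    obtain ⟨F, hF, h'⟩ := term_RF t
    refine ⟨_, (hP.not.ball (hF.add RP.one)).not, fun M _ v => ?_⟩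
    have := fun x => r_lft t default v x
    unfold lft at this
    simp only [lt_succ_iff, BoundedFormula.realize_ex, BoundedFormula.realize_inf, r_le, r_v, h',
      ← stack_snoc, h, this, Fin.snoc_last]
    push Not; rfl

/-- universal predicates -/
def Tr {M : Type} [PAM M] : ℕ → M → M → Prop
  | 0, i, a => ¬ Ev i a 0
  | k + 1, i, a => ∃ y, ¬ Tr k i (pr y a)

theorem Tr_comp {F : ∀ (M : Type) [PAM M], M → M} (hF : RF F) (k c : ℕ) :
    ∃ c' : ℕ, ∀ (M : Type) [PAM M] (a : M), Tr k (c' : M) a ↔ Tr k (c : M) (F M a) := by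
  induction k generalizing F with
  | zero =>
    obtain ⟨j, hj⟩ := hF
    refine ⟨pr (pr 2 0) (pr c j), fun M _ a => ?_⟩
    simp only [Tr, cast_pr, Nat.cast_zero, Nat.cast_ofNat, ev_cmp, hj M, exists_eq_left]
  | succ k ih =>
    obtain ⟨c', h⟩ := ih (F := fun M _ z => pr (pL z) (F M (pR z))) (RF.L.pair (hF.comp RF.R))
    refine ⟨c', fun M _ a => ?_⟩
    simp only [Tr, h, pL_pr, pR_pr]

theorem Tr_code :
    (∀ {k m : ℕ} {φ : LA.BoundedFormula Empty m}, IsSigmaFml k φ → ∃ c : ℕ,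
      ∀ (M : Type) [PAM M] (v : Fin m → M), φ.Realize default v ↔ Tr k (c : M) (stack v)) ∧
    (∀ {k m : ℕ} {φ : LA.BoundedFormula Empty m}, IsPiFml k φ → ∃ c : ℕ,
      ∀ (M : Type) [PAM M] (v : Fin m → M), φ.Realize default v ↔ ¬ Tr k (c : M) (stack v)) := by
  refine sp_ind (S := fun k m φ => ∃ c : ℕ,
      ∀ (M : Type) [PAM M] (v : Fin m → M), φ.Realize default v ↔ Tr k (c : M) (stack v))
    (P := fun k m φ => ∃ c : ℕ,
      ∀ (M : Type) [PAM M] (v : Fin m → M), φ.Realize default v ↔ ¬ Tr k (c : M) (stack v)) ?_ ?_ ?_ ?_ ?_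
  · intro m φ h
    obtain ⟨P, hP, h'⟩ := delta_RP h
    obtain ⟨c, hc⟩ := hP
    obtain ⟨d, hd⟩ := RP.not ⟨c, hc⟩
    constructor
    · refine ⟨c, fun M _ v => ?_⟩
      simp only [Tr, hc M, ← h']
      by_cases h : P M (stack v) <;> simp [h]
    · refine ⟨d, fun M _ v => ?_⟩
      simp only [Tr, hd M, ← h']
      by_cases h : P M (stack v) <;> simp [h]
  · rintro k m φ ⟨c, hc⟩
    obtain ⟨c', h⟩ := Tr_comp RF.R k c
    refine ⟨c', fun M _ v => ?_⟩
    simp only [Tr, h, pR_pr, hc M, exists_const]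
  · rintro k m φ ⟨c, hc⟩
    obtain ⟨c', h⟩ := Tr_comp RF.R k c
    refine ⟨c', fun M _ v => ?_⟩
    simp only [Tr, h, pR_pr, hc M, exists_const, not_not]
  · rintro k m φ ⟨c, hc⟩
    obtain ⟨c', h⟩ := Tr_comp (F := fun M _ w => pr (pR (pL w)) (pr (pL (pL w)) (pR w)))
      ((RF.R.comp RF.L).pair ((RF.L.comp RF.L).pair RF.R)) k c
    refine ⟨c', fun M _ v => ?_⟩
    simp only [Tr, h, pR_pr, pL_pr, hc M, BoundedFormula.realize_ex, stack_snoc]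
    constructor
    · rintro ⟨x, y, h⟩; exact ⟨pr x y, by simpa using h⟩
    · rintro ⟨z, h⟩; exact ⟨_, _, h⟩
  · rintro k m φ ⟨c, hc⟩
    obtain ⟨c', h⟩ := Tr_comp (F := fun M _ w => pr (pR (pL w)) (pr (pL (pL w)) (pR w)))
      ((RF.R.comp RF.L).pair ((RF.L.comp RF.L).pair RF.R)) k c
    refine ⟨c', fun M _ v => ?_⟩
    simp only [Tr, h, pR_pr, pL_pr, hc M, BoundedFormula.realize_all, stack_snoc]
    push Not
    constructor
    · intro h z; exact h _ _
    · intro h x y; simpa using h (pr x y)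

theorem Tr_SigF (k : ℕ) {m : ℕ} {i a : ∀ (M : Type) [PAM M], (Fin m → M) → M} (hi : DT i)
    (ha : DT a) : SigF (k + 1) (fun M _ v => Tr (k + 1) (i M v) (a M v)) := by
  induction k generalizing m with
  | zero =>
    simp only [Tr, not_not]
    apply SigF.ex
    exact Ev_SigF (hi.ren _) (.pr (.var _) (ha.ren _)) .zero
  | succ k ih =>
    refine SigF.ex (R := fun M _ v y => ¬ Tr (k+1) (i M v) (pr y (a M v))) ?_
    exact (ih (hi.ren _) (.pr (.var _) (ha.ren _))).neg.up

/-- bounded kernel of the universal Sigma-1 predicate -/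
def E {M : Type} [PAM M] (i a N : M) : Prop :=
  ∃ y, y ≤ N ∧ ∃ S, S ≤ N ∧ (N = pr y S ∧ just S ∧ mem (tri i (pr y a) 0) S)
theorem Tr_one {M : Type} [PAM M] (i a : M) : Tr 1 i a ↔ ∃ N, E i a N := by
  simp only [Tr, not_not, Ev, E]
  constructor
  · rintro ⟨y, S, h⟩; exact ⟨pr y S, y, le_prl _ _, S, le_prr _ _, rfl, h⟩
  · rintro ⟨_, y, _, S, _, _, h⟩; exact ⟨y, S, h⟩
theorem E_D0 {m : ℕ} {i a N : ∀ (M : Type) [PAM M], (Fin m → M) → M} (hi : DT i)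
    (ha : DT a) (hN : DT N) : D0 (fun M _ v => E (i M v) (a M v) (N M v)) := by
  have key : D0 (fun M _ (v : Fin 3 → M) => E (v 0) (v 1) (v 2)) := by
    unfold E
    repeat first
      | exact DT.var _ | exact DT.zero
      | apply DT.tri | apply mem_D0 | apply just_D0
      | apply D0.bex | apply D0.and | apply D0.eq | apply DT.pr
  exact key.subst (s := fun M _ x => ![i M x, a M x, N M x]) fun j => by
    fin_cases j <;> assumption
end Guaspari

namespace Guaspari
set_option linter.unusedSimpArgs false
set_option linter.unusedVariables false

/-! ### absoluteness of bounded formulas -/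
theorem std_le {M : Type} [PAM M] (n : ℕ) (x : M) (h : x ≤ n) : ∃ k : ℕ, k ≤ n ∧ x = k := by
  induction n with
  | zero =>
    rw [Nat.cast_zero, nonpos_iff_eq_zero] at h
    exact ⟨0, le_rfl, by simpa using h⟩
  | succ n ih =>
    rw [Nat.cast_succ, le_succ_iff] at h
    rcases h with h | h
    · obtain ⟨k, h1, h2⟩ := ih h
      exact ⟨k, h1.trans n.le_succ, h2⟩
    · exact ⟨n + 1, le_rfl, by rw [h]; push_cast; rfl⟩

theorem term_abs {M : Type} [PAM M] {m : ℕ} (t : LA.Term (Empty ⊕ Fin m)) (v : Fin m → ℕ) :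
    t.realize (Sum.elim default (fun i => (v i : M))) = ((t.realize (Sum.elim default v) : ℕ) : M) := by
  induction t with
  | var x =>
    rcases x with x | i
    · exact x.elim
    · rfl
  | func f ts ih =>
    rename_i l
    match l, f, ts, ih with
    | 0, f, ts, ih =>
      refine (PAM.hz _).trans ?_
      have : Term.realize (Sum.elim default v) (Term.func f ts) = 0 := PAM.hz (M := ℕ) _
      rw [this]; exact Nat.cast_zero.symm
    | 1, f, ts, ih =>
      refine (PAM.hs _).trans ?_
      have : Term.realize (Sum.elim default v) (Term.func f ts) = 
        (ts 0).realize (Sum.elim default v) + 1 := PAM.hs (M := ℕ) _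
      rw [this, ih]; exact (Nat.cast_succ _).symm
    | 2, false, ts, ih =>
      refine (PAM.ha _).trans ?_
      have : Term.realize (Sum.elim default v) (Term.func (l := 2) false ts) = 
        (ts 0).realize (Sum.elim default v) + (ts 1).realize (Sum.elim default v) := PAM.ha (M := ℕ) _
      rw [this, ih, ih]; exact (Nat.cast_add _ _).symm
    | 2, true, ts, ih =>
      refine (PAM.hm _).trans ?_
      have : Term.realize (Sum.elim default v) (Term.func (l := 2) true ts) = 
        (ts 0).realize (Sum.elim default v) * (ts 1).realize (Sum.elim default v) := PAM.hm (M := ℕ) _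
      rw [this, ih, ih]; exact (Nat.cast_mul _ _).symm
    | l + 3, f, ts, ih => exact Empty.elim f

theorem snoc_cast {M : Type} [PAM M] {m : ℕ} (v : Fin m → ℕ) (x : ℕ) :
    (Fin.snoc (fun i => (v i : M)) (x : M) : Fin (m+1) → M) =
      fun i => (((Fin.snoc v x : Fin (m+1) → ℕ) i : ℕ) : M) := by
  funext i
  refine Fin.lastCases ?_ (fun i => ?_) i <;> simp

theorem delta_abs {M : Type} [PAM M] {m : ℕ} {φ : LA.BoundedFormula Empty m} (h : IsDelta0 φ)
    (v : Fin m → ℕ) : φ.Realize default (fun i => (v i : M)) ↔ φ.Realize default v := by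
  induction h with
  | falsum => exact Iff.rfl
  | equal t u =>
    change t.realize _ = u.realize _ ↔ t.realize _ = u.realize _
    rw [term_abs, term_abs, Nat.cast_inj]
  | le t u =>
    rw [r_le, r_le, term_abs, term_abs]; exact Nat.cast_le
  | imp _ _ h1 h2 =>
    rw [BoundedFormula.realize_imp, BoundedFormula.realize_imp, h1, h2]
  | ball t _ ih =>
    have h1 := fun x : M => r_lft t default (fun i => (v i : M)) x
    have h2 := fun x : ℕ => r_lft t default v x
    unfold lft at h1 h2
    simp only [BoundedFormula.realize_all, BoundedFormula.realize_imp, r_le, r_v, h1, h2,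
      Fin.snoc_last, term_abs]
    constructor
    · intro h x hx
      have := h (x : M) (Nat.cast_le.2 hx)
      rw [snoc_cast, ih] at this
      exact this
    · intro h x hx
      obtain ⟨k, hk, rfl⟩ := std_le _ x hx
      rw [snoc_cast, ih]
      exact h k hk
  | bex t _ ih =>
    have h1 := fun x : M => r_lft t default (fun i => (v i : M)) x
    have h2 := fun x : ℕ => r_lft t default v x
    unfold lft at h1 h2
    simp only [BoundedFormula.realize_ex, BoundedFormula.realize_inf, r_le, r_v, h1, h2,
      Fin.snoc_last, term_abs]
    constructor
    · rintro ⟨x, hx, h⟩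
      obtain ⟨k, hk, rfl⟩ := std_le _ x hx
      rw [snoc_cast, ih] at h
      exact ⟨k, hk, h⟩
    · rintro ⟨x, hx, h⟩
      refine ⟨x, Nat.cast_le.2 hx, ?_⟩
      rw [snoc_cast, ih]
      exact h

theorem D0.abs {m : ℕ} {P : ∀ (M : Type) [PAM M], (Fin m → M) → Prop} (h : D0 P)
    (M : Type) [PAM M] (v : Fin m → ℕ) : P M (fun i => (v i : M)) ↔ P ℕ v := by
  obtain ⟨φ, h1, h2⟩ := h
  exact (h2 M _).symm.trans ((delta_abs h1 v).trans (by convert h2 ℕ v))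

/-! ### Sigma-1 predicates over the naturals -/

/-- Sigma-1 predicates -/
def S1 {m : ℕ} (P : (Fin m → ℕ) → Prop) : Prop :=
  ∃ Q : ∀ (M : Type) [PAM M], (Fin (m + 1) → M) → Prop, D0 Q ∧
    ∀ v, P v ↔ ∃ N, Q ℕ (Fin.snoc v N)

section
variable {m : ℕ} {P P' : (Fin m → ℕ) → Prop}
theorem S1.congr (h : S1 P) (e : ∀ v, P v ↔ P' v) : S1 P' := by
  obtain ⟨Q, a, b⟩ := h
  exact ⟨Q, a, fun v => (e v).symm.trans (b v)⟩
theorem S1.ofD0 {R : ∀ (M : Type) [PAM M], (Fin m → M) → Prop} (h : D0 R) : S1 (R ℕ) := by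
  refine ⟨fun M _ w => R M (fun i => w i.castSucc), h.ren _, fun v => ?_⟩
  simp only [snoc_eta]
  simp
theorem D0_snoc {m' : ℕ} {Q : ∀ (M : Type) [PAM M], (Fin (m + 1) → M) → Prop} (h : D0 Q)
    {t : Fin m → Fin m'} {s : Fin m'} :
    D0 (fun M _ (w : Fin m' → M) => Q M (Fin.snoc (fun i => w (t i)) (w s))) := by
  refine h.subst (s := fun M _ w => Fin.snoc (fun i => w (t i)) (w s)) fun j => ?_
  refine Fin.lastCases ?_ (fun i => ?_) j
  · simp only [Fin.snoc_last]; exact .var _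
  · simp only [Fin.snoc_castSucc]; exact .var _
theorem S1.or (h1 : S1 P) (h2 : S1 P') : S1 (fun v => P v ∨ P' v) := by
  obtain ⟨Q, a, b⟩ := h1
  obtain ⟨Q', a', b'⟩ := h2
  refine ⟨_, a.or a', fun v => ?_⟩
  exact (or_congr (b v) (b' v)).trans exists_or.symm
theorem S1.and (h1 : S1 P) (h2 : S1 P') : S1 (fun v => P v ∧ P' v) := by
  obtain ⟨Q, a, b⟩ := h1
  obtain ⟨Q', a', b'⟩ := h2
  refine ⟨fun M _ w => (∃ x, x ≤ w (Fin.last m) ∧ Q M (Fin.snoc (fun i => w i.castSucc) x)) ∧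
    (∃ x, x ≤ w (Fin.last m) ∧ Q' M (Fin.snoc (fun i => w i.castSucc) x)),
    .and (.bex (.var _) (D0_snoc a)) (.bex (.var _) (D0_snoc a')), fun v => ?_⟩
  simp only [snoc_eta, Fin.snoc_last, b, b']
  constructor
  · rintro ⟨⟨x, hx⟩, y, hy⟩
    exact ⟨x + y, ⟨x, Nat.le_add_right _ _, hx⟩, y, Nat.le_add_left _ _, hy⟩
  · rintro ⟨N, ⟨x, _, hx⟩, y, _, hy⟩
    exact ⟨⟨x, hx⟩, y, hy⟩
theorem S1.ex {R : (Fin m → ℕ) → ℕ → Prop}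
    (h : S1 (fun w : Fin (m+1) → ℕ => R (fun i => w i.castSucc) (w (Fin.last m)))) :
    S1 (fun v => ∃ x, R v x) := by
  obtain ⟨Q, a, b⟩ := h
  refine ⟨fun M _ w => ∃ x, x ≤ w (Fin.last m) ∧ ∃ y, y ≤ w (Fin.last m) ∧
    Q M (Fin.snoc (Fin.snoc (fun i => w i.castSucc) x) y), ?_, fun v => ?_⟩
  · apply D0.bex (.var _)
    apply D0.bex (.var _)
    refine a.subst (s := fun M _ w => Fin.snoc (Fin.snoc (fun i => w i.castSucc.castSucc.castSucc)
      (w (Fin.last (m+1)).castSucc)) (w (Fin.last (m + 2)))) fun j => ?_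
    refine Fin.lastCases ?_ (fun i => ?_) j
    · simp only [Fin.snoc_last]; exact .var _
    · simp only [Fin.snoc_castSucc]
      refine Fin.lastCases ?_ (fun i => ?_) i
      · simp only [Fin.snoc_last]; exact .var _
      · simp only [Fin.snoc_castSucc]; exact .var _
  · simp only [snoc_eta, Fin.snoc_last]
    have : ∀ x, R v x ↔ ∃ N, Q ℕ (Fin.snoc (Fin.snoc v x) N) := fun x => by
      have := b (Fin.snoc v x)
      simpa only [snoc_eta, Fin.snoc_last] using this
    simp only [this]
    constructor
    · rintro ⟨x, y, h⟩
      exact ⟨x + y, x, Nat.le_add_right _ _, y, Nat.le_add_left _ _, h⟩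
    · rintro ⟨N, x, _, y, _, h⟩
      exact ⟨x, y, h⟩
theorem S1.ball {R : (Fin m → ℕ) → ℕ → Prop} (k : Fin m)
    (h : S1 (fun w : Fin (m+1) → ℕ => R (fun i => w i.castSucc) (w (Fin.last m)))) :
    S1 (fun v => ∀ x, x ≤ v k → R v x) := by
  obtain ⟨Q, a, b⟩ := h
  refine ⟨fun M _ w => ∀ x, x ≤ w k.castSucc → ∃ y, y ≤ w (Fin.last m) ∧
    Q M (Fin.snoc (Fin.snoc (fun i => w i.castSucc) x) y), ?_, fun v => ?_⟩
  · apply D0.ball (.var _)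
    apply D0.bex (.var _)
    refine a.subst (s := fun M _ w => Fin.snoc (Fin.snoc (fun i => w i.castSucc.castSucc.castSucc)
      (w (Fin.last (m+1)).castSucc)) (w (Fin.last (m + 2)))) fun j => ?_
    refine Fin.lastCases ?_ (fun i => ?_) j
    · simp only [Fin.snoc_last]; exact .var _
    · simp only [Fin.snoc_castSucc]
      refine Fin.lastCases ?_ (fun i => ?_) i
      · simp only [Fin.snoc_last]; exact .var _
      · simp only [Fin.snoc_castSucc]; exact .var _
  · simp only [snoc_eta, Fin.snoc_last, Fin.snoc_castSucc]
    have : ∀ x, R v x ↔ ∃ N, Q ℕ (Fin.snoc (Fin.snoc v x) N) := fun x => by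
      have := b (Fin.snoc v x)
      simpa only [snoc_eta, Fin.snoc_last] using this
    simp only [this]
    constructor
    · intro h
      choose! f hf using h
      refine ⟨(Finset.range (v k + 1)).sup f, fun x hx => ⟨f x, ?_, hf x hx⟩⟩
      exact Finset.le_sup (f := f) (Finset.mem_range.2 (Nat.lt_succ_of_le hx))
    · rintro ⟨N, h⟩ x hx
      obtain ⟨y, _, h⟩ := h x hx
      exact ⟨y, h⟩
theorem S1.ren {m' : ℕ} (h : S1 P) (f : Fin m → Fin m') : S1 (fun w : Fin m' → ℕ => P (fun i => w (f i))) := by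
  obtain ⟨Q, a, b⟩ := h
  refine ⟨fun M _ w => Q M (Fin.snoc (fun i => w (f i).castSucc) (w (Fin.last m'))), D0_snoc a, fun v => ?_⟩
  simp only [Fin.snoc_last, Fin.snoc_castSucc, b]
theorem S1.sig (h : S1 P) : ∃ c : ℕ, ∀ v : Fin m → ℕ, P v ↔ Tr 1 (c : ℕ) (stack v) := by
  obtain ⟨Q, a, b⟩ := h
  have : SigF 1 (fun M _ v => ∃ N, Q M (Fin.snoc v N)) := by
    apply SigF.ex
    exact (D0_snoc a).pi.up
  obtain ⟨φ, h1, h2⟩ := this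
  obtain ⟨c, hc⟩ := Tr_code.1 h1
  refine ⟨c, fun v => ?_⟩
  exact (b v).trans ((h2 ℕ v).symm.trans ((hc ℕ v).trans (by simp)))
end

/-- graph is Sigma-1 -/
def Gr (f : ℕ → ℕ) : Prop := S1 (fun v : Fin 2 → ℕ => v 1 = f (v 0))

theorem pair_S1 : S1 (fun v : Fin 3 → ℕ => v 2 = Nat.pair (v 0) (v 1)) := by
  refine S1.congr (S1.ofD0 (R := fun M _ v => (v 0 < v 1 ∧ v 2 = v 1 * v 1 + v 0) ∨
    (¬ v 0 < v 1 ∧ v 2 = v 0 * v 0 + v 0 + v 1)) ?_) ?_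
  · repeat first
      | exact DT.var _
      | apply D0.or
      | apply D0.and
      | apply D0.not
      | apply D0.lt
      | apply D0.eq
      | apply DT.add
      | apply DT.mul
  · intro v
    unfold Nat.pair
    by_cases h : v 0 < v 1
    · rw [if_pos h]
      exact ⟨fun h' => h'.elim (fun h => h.2) (fun h' => absurd h h'.1), fun h' => .inl ⟨h, h'⟩⟩
    · rw [if_neg h]
      exact ⟨fun h' => h'.elim (fun h' => absurd h'.1 h) (fun h' => h'.2), fun h' => .inr ⟨h, h'⟩⟩

theorem prec_S1 {f g : ℕ → ℕ} (hf : Gr f) (hg : Gr g) :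
    S1 (fun v : Fin 3 → ℕ => v 2 = Nat.rec (motive := fun _ => ℕ) (f (v 0)) 
      (fun y IH => g (Nat.pair (v 0) (Nat.pair y IH))) (v 1)) := by
  refine S1.congr (P := fun v => ∃ S, mem (pr (v 1) (v 2)) S ∧
    ∀ i, i ≤ S → ∀ y, y ≤ S → (¬ mem (pr i y) S ∨ ((i = 0 ∧ y = f (v 0)) ∨
      ∃ i' y', (i = i' + 1 ∧ mem (pr i' y') S) ∧ ∃ u, u = Nat.pair i' y' ∧ ∃ t, t = Nat.pair (v 0) u ∧
        y = g t))) ?_ ?_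
  · apply S1.ex
    apply S1.and
    · exact S1.ofD0 (R := fun M _ (v : Fin 4 → M) => mem (pr (v 1) (v 2)) (v 3))
        (mem_D0 (.pr (.var _) (.var _)) (.var _))
    apply S1.ball (3 : Fin 4)
    apply S1.ball (3 : Fin 5)
    apply S1.or
    · exact S1.ofD0 (R := fun M _ (v : Fin 6 → M) => ¬ mem (pr (v 4) (v 5)) (v 3))
        (mem_D0 (.pr (.var _) (.var _)) (.var _)).not
    apply S1.or
    · apply S1.and
      · exact S1.ofD0 (R := fun M _ (v : Fin 6 → M) => v 4 = 0) (.eq (.var _) .zero)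
      · exact hf.ren ![0, 5]
    apply S1.ex
    apply S1.ex
    apply S1.and
    · exact S1.ofD0 (R := fun M _ (v : Fin 8 → M) => v 4 = v 6 + 1 ∧ mem (pr (v 6) (v 7)) (v 3))
        (.and (.eq (.var _) (.add (.var _) .one)) (mem_D0 (.pr (.var _) (.var _)) (.var _)))
    apply S1.ex
    apply S1.and
    · exact pair_S1.ren ![6, 7, 8]
    apply S1.ex
    apply S1.and
    · exact pair_S1.ren ![0, 8, 9]
    · exact hg.ren ![9, 5]
  · intro v
    generalize v 0 = z
    generalize v 1 = k
    generalize v 2 = r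
    constructor
    · rintro ⟨S, h1, h2⟩
      have : ∀ k r, mem (pr k r) S → r = Nat.rec (motive := fun _ => ℕ) (f z) 
        (fun y IH => g (Nat.pair z (Nat.pair y IH))) k := by
        intro k
        induction k with
        | zero =>
          intro r hr
          rcases h2 0 (Nat.zero_le _) r ((le_prr _ _).trans (mem_le hr)) with h | h | ⟨i', y', h, _⟩
          · exact absurd hr h
          · exact h.2
          · exact absurd h.1.symm (Nat.succ_ne_zero i')
        | succ k ih =>
          intro r hr
          rcases h2 (k + 1) ((le_prl _ _).trans (mem_le hr)) r ((le_prr _ _).trans (mem_le hr))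
            with h | h | ⟨i', y', ⟨h, h'⟩, u, rfl, t, rfl, rfl⟩
          · exact absurd hr h
          · exact absurd h.1 (Nat.succ_ne_zero k)
          · obtain rfl : k = i' := Nat.succ_injective h
            rw [ih y' h']
      exact this k r h1
    · rintro rfl
      induction k with
      | zero =>
        obtain ⟨S0, h0⟩ := coded_empty (M := ℕ)
        obtain ⟨S, hS⟩ := coded_insert (pr 0 (f z)) S0
        refine ⟨S, (hS _).2 (.inl rfl), fun i _ y _ => ?_⟩
        by_cases hm : mem (pr i y) S
        · rcases (hS _).1 hm with h | h
          · rw [pr_inj] at h; exact .inr (.inl h)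
          · exact absurd h (h0 _)
        · exact .inl hm
      | succ k ih =>
        obtain ⟨S0, h1, h2⟩ := ih
        obtain ⟨S, hS⟩ := coded_insert (pr (k + 1) (Nat.rec (motive := fun _ => ℕ) (f z) 
          (fun y IH => g (Nat.pair z (Nat.pair y IH))) (k + 1))) S0
        refine ⟨S, (hS _).2 (.inl rfl), fun i _ y _ => ?_⟩
        by_cases hm : mem (pr i y) S
        · refine .inr ?_
          rcases (hS _).1 hm with h | h
          · rw [pr_inj] at h
            exact .inr ⟨k, _, ⟨h.1, (hS _).2 (.inr h1)⟩, _, rfl, _, rfl, h.2⟩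
          · rcases h2 i ((le_prl _ _).trans (mem_le h)) y ((le_prr _ _).trans (mem_le h)) with
              h' | h' | ⟨i', y', ⟨h', h3⟩, h4⟩
            · exact absurd h h'
            · exact .inl h'
            · exact .inr ⟨i', y', ⟨h', (hS _).2 (.inr h3)⟩, h4⟩
        · exact .inl hm

theorem primrec_Gr {f : ℕ → ℕ} (h : Nat.Primrec f) : Gr f := by
  induction h with
  | zero => exact S1.ofD0 (R := fun M _ (v : Fin 2 → M) => v 1 = 0) (.eq (.var _) .zero)
  | succ => exact S1.ofD0 (R := fun M _ (v : Fin 2 → M) => v 1 = v 0 + 1) (.eq (.var _) (.add (.var _) .one))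
  | left =>
    refine S1.congr (P := fun v : Fin 2 → ℕ => ∃ y, v 0 = Nat.pair (v 1) y) ?_ ?_
    · apply S1.ex; exact pair_S1.ren ![1, 2, 0]
    · intro v; constructor
      · rintro ⟨y, h⟩; rw [h]; simp
      · intro h; exact ⟨(Nat.unpair (v 0)).2, by rw [h]; simp⟩
  | right =>
    refine S1.congr (P := fun v : Fin 2 → ℕ => ∃ y, v 0 = Nat.pair y (v 1)) ?_ ?_
    · apply S1.ex; exact pair_S1.ren ![2, 1, 0]
    · intro v; constructor
      · rintro ⟨y, h⟩; rw [h]; simp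
      · intro h; exact ⟨(Nat.unpair (v 0)).1, by rw [h]; simp⟩
  | pair _ _ h1 h2 =>
    rename_i f g _ _
    refine S1.congr (P := fun v : Fin 2 → ℕ => ∃ x y, x = f (v 0) ∧ y = g (v 0) ∧ v 1 = Nat.pair x y) ?_ ?_
    · apply S1.ex; apply S1.ex; apply S1.and
      · exact h1.ren ![0, 2]
      apply S1.and
      · exact h2.ren ![0, 3]
      · exact pair_S1.ren ![2, 3, 1]
    · intro v; simp
  | comp _ _ h1 h2 =>
    rename_i f g _ _
    refine S1.congr (P := fun v : Fin 2 → ℕ => ∃ x, x = g (v 0) ∧ v 1 = f x) ?_ ?_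
    · apply S1.ex; apply S1.and
      · exact h2.ren ![0, 2]
      · exact h1.ren ![2, 1]
    · intro v; simp
  | prec _ _ h1 h2 =>
    rename_i f g _ _
    refine S1.congr (P := fun v : Fin 2 → ℕ => ∃ z k, v 0 = Nat.pair z k ∧ 
      v 1 = Nat.rec (motive := fun _ => ℕ) (f z) (fun y IH => g (Nat.pair z (Nat.pair y IH))) k) ?_ ?_
    · apply S1.ex; apply S1.ex; apply S1.and
      · exact pair_S1.ren ![2, 3, 0]
      · exact (prec_S1 h1 h2).ren ![2, 3, 1]
    · intro v
      constructor
      · rintro ⟨z, k, h, h'⟩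
        rw [h', h]; simp [Nat.unpaired]
      · intro h
        exact ⟨(Nat.unpair (v 0)).1, (Nat.unpair (v 0)).2, by simp, h⟩

/-- r.e. predicates with primitive recursive kernel are Sigma-1 -/
theorem S1.ofPrimrec {R : ℕ × ℕ × ℕ → Prop} [DecidablePred R] (h : PrimrecPred R) :
    S1 (fun v : Fin 2 → ℕ => ∃ N, R (v 0, v 1, N)) := by
  have h1 : Primrec (fun n : ℕ => if R (n.unpair.1, n.unpair.2.unpair.1, n.unpair.2.unpair.2) then 1 else 0) := by
    have hp : Primrec (fun n : ℕ => (n.unpair.1, n.unpair.2.unpair.1, n.unpair.2.unpair.2)) :=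
      (Primrec.fst.comp Primrec.unpair).pair
        ((Primrec.fst.comp (Primrec.unpair.comp (Primrec.snd.comp Primrec.unpair))).pair
        (Primrec.snd.comp (Primrec.unpair.comp (Primrec.snd.comp Primrec.unpair))))
    exact Primrec.ite (h.comp hp) (Primrec.const 1) (Primrec.const 0)
  have h2 := primrec_Gr (Primrec.nat_iff.1 h1)
  refine S1.congr (P := fun v : Fin 2 → ℕ => ∃ N u t s, u = Nat.pair (v 1) N ∧ t = Nat.pair (v 0) u ∧
    s = 1 ∧ s = if R (t.unpair.1, t.unpair.2.unpair.1, t.unpair.2.unpair.2) then 1 else 0) ?_ ?_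
  · apply S1.ex; apply S1.ex; apply S1.ex; apply S1.ex; apply S1.and
    · exact pair_S1.ren ![1, 2, 3]
    apply S1.and
    · exact pair_S1.ren ![0, 3, 4]
    apply S1.and
    · exact S1.ofD0 (R := fun M _ (v : Fin 6 → M) => v 5 = 1) (.eq (.var _) .one)
    · exact h2.ren ![4, 5]
  · intro v; simp
end Guaspari

namespace Guaspari
set_option linter.unusedSimpArgs false
set_option linter.unusedVariables false

/-! ### composed forms of closure properties of primitive recursive functions -/
section
variable {α β γ δ : Type} [Primcodable α] [Primcodable β] [Primcodable γ] [Primcodable δ]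
theorem qfst {f : α → β × γ} (h : Primrec f) : Primrec (fun a => (f a).1) := Primrec.fst.comp h
theorem qsnd {f : α → β × γ} (h : Primrec f) : Primrec (fun a => (f a).2) := Primrec.snd.comp h
theorem qid : Primrec (fun a : α => a) := Primrec.id
theorem qpair {f : α → β} {g : α → γ} (h : Primrec f) (h' : Primrec g) :
    Primrec (fun a => (f a, g a)) := h.pair h'
theorem qadd {f g : α → ℕ} (h : Primrec f) (h' : Primrec g) :
    Primrec (fun a => f a + g a) := Primrec.nat_add.comp h h'
theorem qsub {f g : α → ℕ} (h : Primrec f) (h' : Primrec g) :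
    Primrec (fun a => f a - g a) := Primrec.nat_sub.comp h h'
theorem qmul {f g : α → ℕ} (h : Primrec f) (h' : Primrec g) :
    Primrec (fun a => f a * g a) := Primrec.nat_mul.comp h h'
theorem qdiv {f g : α → ℕ} (h : Primrec f) (h' : Primrec g) :
    Primrec (fun a => f a / g a) := Primrec.nat_div.comp h h'
theorem qmod {f g : α → ℕ} (h : Primrec f) (h' : Primrec g) :
    Primrec (fun a => f a % g a) := Primrec.nat_mod.comp h h'
theorem qmax {f g : α → ℕ} (h : Primrec f) (h' : Primrec g) :
    Primrec (fun a => max (f a) (g a)) := Primrec.nat_max.comp h h'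
theorem qnp {f g : α → ℕ} (h : Primrec f) (h' : Primrec g) :
    Primrec (fun a => Nat.pair (f a) (g a)) := Primrec₂.natPair.comp h h'
theorem qunp {f : α → ℕ} (h : Primrec f) : Primrec (fun a => Nat.unpair (f a)) :=
  Primrec.unpair.comp h
theorem qenc {f : α → β} (h : Primrec f) : Primrec (fun a => Encodable.encode (f a)) :=
  Primrec.encode.comp h
theorem qcons {f : α → β} {g : α → List β} (h : Primrec f) (h' : Primrec g) :
    Primrec (fun a => f a :: g a) := Primrec.list_cons.comp h h'
theorem qapp {f g : α → List β} (h : Primrec f) (h' : Primrec g) :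
    Primrec (fun a => f a ++ g a) := Primrec.list_append.comp h h'
theorem qgetD {f : α → List β} {g : α → ℕ} {d : β} (h : Primrec f) (h' : Primrec g) :
    Primrec (fun a => (f a).getD (g a) d) := (Primrec.list_getD d).comp h h'
theorem qeq {f g : α → β} (h : Primrec f) (h' : Primrec g) :
    PrimrecPred (fun a => f a = g a) := Primrec.eq.comp h h'
theorem qle {f g : α → ℕ} (h : Primrec f) (h' : Primrec g) :
    PrimrecPred (fun a => f a ≤ g a) := Primrec.nat_le.comp h h'
end

/-- code trees, used as raw formulas and terms -/
abbrev Cd := Nat.Partrec.Code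
/-- the number stored at a node -/
def ix (a b : Cd) : ℕ := Nat.pair (Encodable.encode a) (Encodable.encode b)
/-- read a code tree from a number -/
def cd (n : ℕ) : Cd := Denumerable.ofNat Cd n
theorem qix {α : Type} [Primcodable α] {f g : α → Cd} (h : Primrec f) (h' : Primrec g) :
    Primrec (fun a => ix (f a) (g a)) := qnp (qenc h) (qenc h')
theorem qcd {α : Type} [Primcodable α] {f : α → ℕ} (h : Primrec f) :
    Primrec (fun a => cd (f a)) := (Primrec.ofNat Cd).comp h
theorem ix_cd (x : ℕ) : ix (cd x.unpair.1) (cd x.unpair.2) = x := by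
  simp [ix, cd]
theorem cd_enc (c : Cd) : cd (Encodable.encode c) = c := by simp [cd]

/-- number of variables used by a raw term, plus one; zero if ill formed -/
noncomputable def bT (c : Cd) : ℕ :=
  Nat.Partrec.Code.recOn (motive := fun _ => ℕ) c 1 0 0 0
    (fun _ _ x y => if x = 0 ∨ y = 0 then 0 else max x y)
    (fun _ _ x y => if x = 0 ∨ y = 0 then 0 else max x y)
    (fun a b _ _ => ix a b + 2) (fun _ x => x)
/-- token codes of a raw term -/
noncomputable def LT (c : Cd) : List ℕ :=
  Nat.Partrec.Code.recOn (motive := fun _ => List ℕ) c [2 * Nat.pair 0 0 + 1] [] [] []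
    (fun _ _ x y => (2 * Nat.pair 2 0 + 1) :: (x ++ y))
    (fun _ _ x y => (2 * Nat.pair 2 1 + 1) :: (x ++ y))
    (fun a b _ _ => [2 * (2 * ix a b + 1)]) (fun _ x => (2 * Nat.pair 1 0 + 1) :: x)
/-- name of the value of a raw term -/
noncomputable def tv (c : Cd) (r : List ℕ) : ℕ :=
  Nat.Partrec.Code.recOn (motive := fun _ => ℕ) c (Nat.pair 0 0) 0 0 0
    (fun _ _ x y => Nat.pair 2 (Nat.pair x y))
    (fun _ _ x y => Nat.pair 3 (Nat.pair x y))
    (fun a b _ _ => r.getD (ix a b) 0) (fun _ x => Nat.pair 1 x)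
/-- kind of an atom -/
def kd (a : Cd) : ℕ := Encodable.encode a % 2
/-- level of an atom -/
def ln (a : Cd) : ℕ := Encodable.encode a / 2
/-- left term of an atom -/
def tl (b : Cd) : Cd := cd (Encodable.encode b).unpair.1
/-- right term of an atom -/
def tr (b : Cd) : Cd := cd (Encodable.encode b).unpair.2
/-- level of a raw formula plus one; zero if ill formed -/
noncomputable def lv (c : Cd) : ℕ :=
  Nat.Partrec.Code.recOn (motive := fun _ => ℕ) c 0 0 0 0
    (fun _ _ x y => if x = y then x else 0)
    (fun a b _ _ => if (bT (tl b) = 0 ∨ bT (tr b) = 0) ∨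
      ¬ (bT (tl b) ≤ ln a + 1) ∨ ¬ (bT (tr b) ≤ ln a + 1) then 0 else ln a + 1)
    (fun a b _ _ => ix a b + 1) (fun _ x => x - 1)
/-- token codes of a raw formula -/
noncomputable def LF (c : Cd) : List ℕ :=
  Nat.Partrec.Code.recOn (motive := fun _ => List ℕ) c [] [] [] []
    (fun _ _ x y => 3 :: (x ++ y))
    (fun a b _ _ => (if kd a = 0 then [] else [2 * (2 * Nat.pair 2 0) + 1, 2 * (2 * ln a + 1) + 1]) ++
      [2 * Nat.pair (ln a) (Encodable.encode (LT (tl b))),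
       2 * Nat.pair (ln a) (Encodable.encode (LT (tr b)))])
    (fun a b _ _ => [2 * (2 * (ix a b + 2) + 1) + 1]) (fun _ x => 7 :: x)
/-- generic item -/
def gi (c : Cd) (r : List ℕ) : ℕ := Nat.pair 2 (Encodable.encode (c, r))
/-- propositional variable of a raw formula with an environment -/
noncomputable def it (c : Cd) (r : List ℕ) : ℕ :=
  Nat.Partrec.Code.recOn (motive := fun _ => ℕ) c (gi c r) (gi c r) (gi c r) (gi c r)
    (fun _ _ _ _ => gi c r)
    (fun a b _ _ => Nat.pair (kd a) (Nat.pair (tv (tl b) r) (tv (tr b) r)))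
    (fun _ _ _ _ => gi c r) (fun _ _ => gi c r)
/-- Henkin witness -/
def wt (c : Cd) (r : List ℕ) : ℕ := Nat.pair 4 (Encodable.encode (c, r))
/-- clauses (forbidden conjunctions) of a raw formula with an environment -/
noncomputable def cf (c : Cd) (r : List ℕ) (k : ℕ) : List (List (ℕ × Bool)) :=
  Nat.Partrec.Code.recOn (motive := fun _ => List (List (ℕ × Bool))) c [ [(it c r, true)] ] [ [(it c r, true)] ]
    [ [(it c r, true)] ] [ [(it c r, true)] ]
    (fun a b _ _ => [ [(it c r, true), (it a r, true), (it b r, false)],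
      [(it c r, false), (it a r, false)], [(it c r, false), (it b r, true)] ])
    (fun _ _ _ _ => []) (fun _ _ _ _ => [ [(it c r, true)] ])
    (fun a _ => [ [(it c r, true), (it a (r ++ [k]), false)],
      [(it c r, false), (it a (r ++ [wt a r]), true)] ])

section
variable {α : Type} [Primcodable α]
theorem qbT {f : α → Cd} (h : Primrec f) : Primrec (fun a => bT (f a)) := by
  refine Primrec.comp (f := bT) ?_ h
  refine Nat.Partrec.Code.primrec_recOn Primrec.id ?_ ?_ ?_ ?_ ?_ ?_ ?_ ?_
  all_goals with_reducible repeat first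
    | exact Primrec.const _
    | exact qid
    | apply Primrec.ite
    | apply PrimrecPred.or
    | apply qeq
    | apply qmax
    | apply qix
    | apply qadd
    | apply qfst
    | apply qsnd
theorem qLT {f : α → Cd} (h : Primrec f) : Primrec (fun a => LT (f a)) := by
  refine Primrec.comp (f := LT) ?_ h
  refine Nat.Partrec.Code.primrec_recOn Primrec.id ?_ ?_ ?_ ?_ ?_ ?_ ?_ ?_
  all_goals with_reducible repeat first
    | exact Primrec.const _
    | exact qid
    | apply qcons
    | apply qapp
    | apply qix
    | apply qadd
    | apply qmul
    | apply qfst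
    | apply qsnd
theorem qtv {f : α → Cd} {g : α → List ℕ} (h : Primrec f) (h' : Primrec g) :
    Primrec (fun a => tv (f a) (g a)) := by
  refine Nat.Partrec.Code.primrec_recOn h ?_ ?_ ?_ ?_ ?_ ?_ ?_ ?_
  all_goals with_reducible repeat first
    | exact Primrec.const _
    | exact qid
    | apply qnp
    | apply qgetD
    | refine h'.comp ?_
    | apply qix
    | apply qfst
    | apply qsnd
theorem qkd {f : α → Cd} (h : Primrec f) : Primrec (fun a => kd (f a)) := qmod (qenc h) (.const 2)
theorem qln {f : α → Cd} (h : Primrec f) : Primrec (fun a => ln (f a)) := qdiv (qenc h) (.const 2)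
theorem qtl {f : α → Cd} (h : Primrec f) : Primrec (fun a => tl (f a)) := qcd (qfst (qunp (qenc h)))
theorem qtr {f : α → Cd} (h : Primrec f) : Primrec (fun a => tr (f a)) := qcd (qsnd (qunp (qenc h)))
theorem qgi {f : α → Cd} {g : α → List ℕ} (h : Primrec f) (h' : Primrec g) :
    Primrec (fun a => gi (f a) (g a)) := qnp (.const 2) (qenc (qpair h h'))
theorem qwt {f : α → Cd} {g : α → List ℕ} (h : Primrec f) (h' : Primrec g) :
    Primrec (fun a => wt (f a) (g a)) := qnp (.const 4) (qenc (qpair h h'))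
theorem qlv {f : α → Cd} (h : Primrec f) : Primrec (fun a => lv (f a)) := by
  refine Primrec.comp (f := lv) ?_ h
  refine Nat.Partrec.Code.primrec_recOn Primrec.id ?_ ?_ ?_ ?_ ?_ ?_ ?_ ?_
  all_goals with_reducible repeat first
    | exact Primrec.const _
    | exact qid
    | apply Primrec.ite
    | apply PrimrecPred.or
    | apply PrimrecPred.not
    | apply qeq
    | apply qle
    | apply qbT
    | apply qln
    | apply qtl
    | apply qtr
    | apply qix
    | apply qadd
    | apply qsub
    | apply qfst
    | apply qsnd
theorem qLF {f : α → Cd} (h : Primrec f) : Primrec (fun a => LF (f a)) := by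
  refine Primrec.comp (f := LF) ?_ h
  refine Nat.Partrec.Code.primrec_recOn Primrec.id ?_ ?_ ?_ ?_ ?_ ?_ ?_ ?_
  all_goals with_reducible repeat first
    | exact Primrec.const _
    | exact qid
    | apply Primrec.ite
    | apply qcons
    | apply qapp
    | apply qeq
    | apply qkd
    | apply qln
    | apply qtl
    | apply qtr
    | apply qLT
    | apply qenc
    | apply qnp
    | apply qix
    | apply qadd
    | apply qmul
    | apply qfst
    | apply qsnd
theorem qit {f : α → Cd} {g : α → List ℕ} (h : Primrec f) (h' : Primrec g) :
    Primrec (fun a => it (f a) (g a)) := by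
  refine Nat.Partrec.Code.primrec_recOn h ?_ ?_ ?_ ?_ ?_ ?_ ?_ ?_
  all_goals with_reducible repeat first
    | exact Primrec.const _
    | exact qid
    | apply qgi
    | apply qnp
    | apply qtv
    | apply qkd
    | apply qtl
    | apply qtr
    | exact h'
    | exact h
    | refine h'.comp ?_
    | refine h.comp ?_
    | apply qfst
    | apply qsnd
theorem qc0 : Primrec (fun _ : α => ([] : List (ℕ × Bool))) := Primrec.const _
theorem qd0 : Primrec (fun _ : α => ([] : List (List (ℕ × Bool)))) := Primrec.const _
theorem qcl {f : α → ℕ} {b : Bool} {g : α → List (ℕ × Bool)} (h : Primrec f) (h' : Primrec g) :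
    Primrec (fun a => (f a, b) :: g a) := qcons (qpair h (Primrec.const b)) h'
theorem qcf {f : α → Cd} {g : α → List ℕ} {k : α → ℕ} (h : Primrec f) (h' : Primrec g)
    (h3 : Primrec k) : Primrec (fun a => cf (f a) (g a) (k a)) := by
  have hj := qcons (qcl (b := true) (qit h h') qc0) qd0
  refine Nat.Partrec.Code.primrec_recOn h hj hj hj hj ?_ qd0 ?_ ?_
  · have hc := h.comp (Primrec.fst (α := α) (β := Cd × Cd × List (List (ℕ × Bool)) × List (List (ℕ × Bool))))
    have hr := h'.comp (Primrec.fst (α := α) (β := Cd × Cd × List (List (ℕ × Bool)) × List (List (ℕ × Bool))))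
    have ha := Primrec.fst.comp (Primrec.snd (α := α) (β := Cd × Cd × List (List (ℕ × Bool)) × List (List (ℕ × Bool))))
    have hb := Primrec.fst.comp (Primrec.snd.comp (Primrec.snd (α := α) (β := Cd × Cd × List (List (ℕ × Bool)) × List (List (ℕ × Bool)))))
    exact qcons (qcl (qit hc hr) (qcl (qit ha hr) (qcl (qit hb hr) qc0)))
      (qcons (qcl (qit hc hr) (qcl (qit ha hr) qc0)) (qcons (qcl (qit hc hr) (qcl (qit hb hr) qc0)) qd0))
  · have hc := h.comp (Primrec.fst (α := α) (β := Cd × Cd × List (List (ℕ × Bool)) × List (List (ℕ × Bool))))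
    have hr := h'.comp (Primrec.fst (α := α) (β := Cd × Cd × List (List (ℕ × Bool)) × List (List (ℕ × Bool))))
    exact qcons (qcl (qit hc hr) qc0) qd0
  · have hc := h.comp (Primrec.fst (α := α) (β := Cd × List (List (ℕ × Bool))))
    have hr := h'.comp (Primrec.fst (α := α) (β := Cd × List (List (ℕ × Bool))))
    have hk := h3.comp (Primrec.fst (α := α) (β := Cd × List (List (ℕ × Bool))))
    have ha := Primrec.fst.comp (Primrec.snd (α := α) (β := Cd × List (List (ℕ × Bool))))
    exact qcons (qcl (qit hc hr) (qcl (qit ha (qapp hr (qcons hk (Primrec.const [])))) qc0))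
      (qcons (qcl (qit hc hr) (qcl (qit ha (qapp hr (qcons (qwt ha hr) (Primrec.const [])))) qc0)) qd0)
end
end Guaspari

namespace Guaspari
set_option linter.unusedSimpArgs false
set_option linter.unusedVariables false

/-! ### raw codes of terms and formulas -/
/-- a raw code of a term -/
inductive CorrT {n : ℕ} : LA.Term (Empty ⊕ Fin n) → Cd → Prop
  | var (i : Fin n) : CorrT (Term.var (Sum.inr i))
      (.prec (cd (Nat.unpair (i : ℕ)).1) (cd (Nat.unpair (i : ℕ)).2))
  | zero (f : LA.Functions 0) (ts : Fin 0 → _) : CorrT (Term.func f ts) .zero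
  | succ (f : LA.Functions 1) (ts : Fin 1 → _) {a : Cd} : CorrT (ts 0) a →
      CorrT (Term.func f ts) (.rfind' a)
  | add (ts : Fin 2 → _) {a b : Cd} : CorrT (ts 0) a → CorrT (ts 1) b →
      CorrT (Term.func (show LA.Functions 2 from false) ts) (.pair a b)
  | mul (ts : Fin 2 → _) {a b : Cd} : CorrT (ts 0) a → CorrT (ts 1) b →
      CorrT (Term.func (show LA.Functions 2 from true) ts) (.comp a b)

/-- raw atom -/
def atm (k n : ℕ) (a b : Cd) : Cd :=
  .comp (cd (2 * n + k)) (cd (Nat.pair (Encodable.encode a) (Encodable.encode b)))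

/-- a raw code of a formula -/
inductive Corr : ∀ {n : ℕ}, LA.BoundedFormula Empty n → Cd → Prop
  | falsum {n : ℕ} : Corr (BoundedFormula.falsum : LA.BoundedFormula Empty n)
      (.prec (cd n.unpair.1) (cd n.unpair.2))
  | eq {n : ℕ} {t u : LA.Term (Empty ⊕ Fin n)} {a b : Cd} : CorrT t a → CorrT u b →
      Corr (.equal t u) (atm 0 n a b)
  | le {n : ℕ} (R : LA.Relations 2) (ts : Fin 2 → LA.Term (Empty ⊕ Fin n)) {a b : Cd} :
      CorrT (ts 0) a → CorrT (ts 1) b → Corr (.rel R ts) (atm 1 n a b)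
  | imp {n : ℕ} {φ ψ : LA.BoundedFormula Empty n} {a b : Cd} : Corr φ a → Corr ψ b →
      Corr (φ.imp ψ) (.pair a b)
  | all {n : ℕ} {φ : LA.BoundedFormula Empty (n + 1)} {a : Cd} : Corr φ a →
      Corr φ.all (.rfind' a)

theorem corrT_ex {n : ℕ} (t : LA.Term (Empty ⊕ Fin n)) : ∃ c, CorrT t c := by
  induction t with
  | var x =>
    rcases x with x | i
    · exact x.elim
    · exact ⟨_, .var i⟩
  | func f ts ih =>
    rename_i l
    match l, f, ts, ih with
    | 0, f, ts, ih => exact ⟨_, .zero f ts⟩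
    | 1, f, ts, ih => exact ⟨_, .succ f ts (ih 0).choose_spec⟩
    | 2, false, ts, ih => exact ⟨_, .add ts (ih 0).choose_spec (ih 1).choose_spec⟩
    | 2, true, ts, ih => exact ⟨_, .mul ts (ih 0).choose_spec (ih 1).choose_spec⟩
    | l + 3, f, ts, ih => exact Empty.elim f

theorem corr_ex {n : ℕ} (φ : LA.BoundedFormula Empty n) : ∃ c, Corr φ c := by
  induction φ with
  | falsum => exact ⟨_, .falsum⟩
  | equal t u => exact ⟨_, .eq (corrT_ex t).choose_spec (corrT_ex u).choose_spec⟩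
  | rel R ts =>
    rename_i l
    match l, R, ts with
    | 0, R, ts => exact Empty.elim R
    | 1, R, ts => exact Empty.elim R
    | 2, R, ts => exact ⟨_, .le R ts (corrT_ex _).choose_spec (corrT_ex _).choose_spec⟩
    | l + 3, R, ts => exact Empty.elim R
  | imp φ ψ h1 h2 => exact ⟨_, .imp h1.choose_spec h2.choose_spec⟩
  | all φ h => exact ⟨_, .all h.choose_spec⟩

theorem kd_cd {k n : ℕ} (h : k < 2) : kd (cd (2 * n + k)) = k := by simp [kd, cd]; omega
theorem ln_cd {k n : ℕ} (h : k < 2) : ln (cd (2 * n + k)) = n := by simp [ln, cd]; omega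
theorem tl_cd {a b : Cd} : tl (cd (Nat.pair (Encodable.encode a) (Encodable.encode b))) = a := by
  simp [tl, cd]
theorem tr_cd {a b : Cd} : tr (cd (Nat.pair (Encodable.encode a) (Encodable.encode b))) = b := by
  simp [tr, cd]
theorem atm_eta (a b : Cd) : Nat.Partrec.Code.comp a b = atm (kd a) (ln a) (tl b) (tr b) := by
  unfold atm kd ln tl tr
  have : 2 * (Encodable.encode a / 2) + Encodable.encode a % 2 = Encodable.encode a := by omega
  rw [this, cd_enc]
  congr 1
  simp [cd]

theorem corrT_bT {n : ℕ} {t : LA.Term (Empty ⊕ Fin n)} {c : Cd} (h : CorrT t c) :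
    bT c ≠ 0 ∧ bT c ≤ n + 1 := by
  induction h with
  | var i =>
    change ix _ _ + 2 ≠ 0 ∧ ix _ _ + 2 ≤ n + 1
    rw [ix_cd]; have := i.2; omega
  | zero f ts => change 1 ≠ 0 ∧ 1 ≤ n + 1; omega
  | succ f ts _ ih => exact ih
  | add ts _ _ h1 h2 =>
    rename_i a b _ _
    change (if bT a = 0 ∨ bT b = 0 then 0 else max (bT a) (bT b)) ≠ 0 ∧
      (if bT a = 0 ∨ bT b = 0 then 0 else max (bT a) (bT b)) ≤ n + 1
    rw [if_neg (by omega)]; omega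
  | mul ts _ _ h1 h2 =>
    rename_i a b _ _
    change (if bT a = 0 ∨ bT b = 0 then 0 else max (bT a) (bT b)) ≠ 0 ∧
      (if bT a = 0 ∨ bT b = 0 then 0 else max (bT a) (bT b)) ≤ n + 1
    rw [if_neg (by omega)]; omega

theorem bT_corr {n : ℕ} (c : Cd) (h0 : bT c ≠ 0) (h1 : bT c ≤ n + 1) :
    ∃ t : LA.Term (Empty ⊕ Fin n), CorrT t c := by
  induction c with
  | zero => exact ⟨_, .zero () (fun i => i.elim0)⟩
  | succ => exact absurd rfl h0
  | left => exact absurd rfl h0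
  | right => exact absurd rfl h0
  | pair a b iha ihb =>
    change (if bT a = 0 ∨ bT b = 0 then 0 else max (bT a) (bT b)) ≠ 0 at h0
    change (if bT a = 0 ∨ bT b = 0 then 0 else max (bT a) (bT b)) ≤ n + 1 at h1
    split_ifs at h0 h1 with h
    · exact absurd rfl h0
    · obtain ⟨t, ht⟩ := iha (by omega) (by omega)
      obtain ⟨u, hu⟩ := ihb (by omega) (by omega)
      exact ⟨_, .add ![t, u] ht hu⟩
  | comp a b iha ihb =>
    change (if bT a = 0 ∨ bT b = 0 then 0 else max (bT a) (bT b)) ≠ 0 at h0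
    change (if bT a = 0 ∨ bT b = 0 then 0 else max (bT a) (bT b)) ≤ n + 1 at h1
    split_ifs at h0 h1 with h
    · exact absurd rfl h0
    · obtain ⟨t, ht⟩ := iha (by omega) (by omega)
      obtain ⟨u, hu⟩ := ihb (by omega) (by omega)
      exact ⟨_, .mul ![t, u] ht hu⟩
  | prec a b _ _ =>
    change ix a b + 2 ≤ n + 1 at h1
    have := CorrT.var (n := n) ⟨ix a b, by omega⟩
    simp only [ix, Nat.unpair_pair, cd_enc] at this
    exact ⟨_, this⟩
  | rfind' a ih =>
    obtain ⟨t, ht⟩ := ih h0 h1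
    exact ⟨_, .succ (show LA.Functions 1 from ()) ![t] ht⟩

theorem corr_lv {n : ℕ} {φ : LA.BoundedFormula Empty n} {c : Cd} (h : Corr φ c) : lv c = n + 1 := by
  induction h with
  | falsum => change ix _ _ + 1 = _; rw [ix_cd]
  | eq h1 h2 =>
    have h1 := corrT_bT h1
    have h2 := corrT_bT h2
    change (if _ then _ else _) = _
    rw [tl_cd, tr_cd, ln_cd (by omega), if_neg (by omega)]
  | le R ts h1 h2 =>
    have h1 := corrT_bT h1
    have h2 := corrT_bT h2
    change (if _ then _ else _) = _
    rw [tl_cd, tr_cd, ln_cd (by omega), if_neg (by omega)]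
  | imp _ _ h1 h2 =>
    rename_i a b _ _
    change (if lv a = lv b then lv a else 0) = _
    rw [h1, h2, if_pos rfl]
  | all _ h =>
    rename_i a _
    change lv a - 1 = _
    rw [h]; rfl

theorem lv_corr (c : Cd) : ∀ {n : ℕ}, lv c = n + 1 → ∃ φ : LA.BoundedFormula Empty n, Corr φ c := by
  induction c with
  | zero => intro n h; exact absurd h.symm (Nat.succ_ne_zero n)
  | succ => intro n h; exact absurd h.symm (Nat.succ_ne_zero n)
  | left => intro n h; exact absurd h.symm (Nat.succ_ne_zero n)
  | right => intro n h; exact absurd h.symm (Nat.succ_ne_zero n)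
  | pair a b iha ihb =>
    intro n h
    change (if lv a = lv b then lv a else 0) = _ at h
    split_ifs at h with h'
    · obtain ⟨φ, h1⟩ := iha h
      obtain ⟨ψ, h2⟩ := ihb (h' ▸ h)
      exact ⟨_, h1.imp h2⟩
  | comp a b _ _ =>
    intro n h
    change (if (bT (tl b) = 0 ∨ bT (tr b) = 0) ∨
      ¬ (bT (tl b) ≤ ln a + 1) ∨ ¬ (bT (tr b) ≤ ln a + 1) then 0 else ln a + 1) = _ at h
    split_ifs at h with h'
    have hn : ln a = n := by omega
    obtain ⟨t, ht⟩ := bT_corr (n := n) (tl b) (by omega) (by omega)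
    obtain ⟨u, hu⟩ := bT_corr (n := n) (tr b) (by omega) (by omega)
    rw [atm_eta, hn]
    have hk : kd a = 0 ∨ kd a = 1 := by unfold kd; omega
    rcases hk with hk | hk <;> rw [hk]
    · exact ⟨_, .eq ht hu⟩
    · exact ⟨_, .le (show LA.Relations 2 from ()) ![t, u] ht hu⟩
  | prec a b _ _ =>
    intro n h
    change ix a b + 1 = _ at h
    have := Corr.falsum (n := n)
    obtain rfl : ix a b = n := by omega
    simp only [ix, Nat.unpair_pair, cd_enc] at this
    exact ⟨_, this⟩
  | rfind' a ih =>
    intro n h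
    change lv a - 1 = _ at h
    obtain ⟨φ, h1⟩ := ih (n := n + 1) (by omega)
    exact ⟨_, h1.all⟩

theorem enc_map {α : Type} [Encodable α] (l : List α) :
    Encodable.encode l = Encodable.encode (l.map Encodable.encode) := by
  induction l with
  | nil => rfl
  | cons a l ih => rw [List.map_cons, Encodable.encode_list_cons, Encodable.encode_list_cons, ih]; rfl

theorem LT_corr' {n : ℕ} {t : LA.Term (Empty ⊕ Fin n)} {c : Cd} (h : CorrT t c) :
    t.listEncode.map Encodable.encode = LT c := by
  induction h with
  | var i =>
    change _ = [2 * (2 * ix _ _ + 1)]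
    rw [ix_cd]; rfl
  | zero f ts => rfl
  | succ f ts _ ih =>
    rename_i a _
    change _ = (2 * Nat.pair 1 0 + 1) :: LT a
    simp only [Term.listEncode, List.map_cons, ← ih]
    congr 1
    simp [List.finRange_succ]
  | add ts _ _ h1 h2 =>
    rename_i a b _ _
    change _ = (2 * Nat.pair 2 0 + 1) :: (LT a ++ LT b)
    simp only [Term.listEncode, List.map_cons, ← h1, ← h2]
    congr 1
    simp [List.finRange_succ]
  | mul ts _ _ h1 h2 =>
    rename_i a b _ _
    change _ = (2 * Nat.pair 2 1 + 1) :: (LT a ++ LT b)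
    simp only [Term.listEncode, List.map_cons, ← h1, ← h2]
    congr 1
    simp [List.finRange_succ]

theorem LT_corr {n : ℕ} {t : LA.Term (Empty ⊕ Fin n)} {c : Cd} (h : CorrT t c) :
    Encodable.encode t = Encodable.encode (LT c) := by
  rw [← LT_corr' h, ← enc_map]; rfl

theorem LF_corr {n : ℕ} {φ : LA.BoundedFormula Empty n} {c : Cd} (h : Corr φ c) :
    φ.listEncode.map Encodable.encode = LF c := by
  induction h with
  | falsum =>
    change _ = [2 * (2 * (ix _ _ + 2) + 1) + 1]
    rw [ix_cd]; rfl
  | eq h1 h2 =>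
    change _ = (if kd _ = 0 then _ else _) ++ _
    rw [tl_cd, tr_cd, ln_cd (by omega), kd_cd (by omega), if_pos rfl, ← LT_corr h1, ← LT_corr h2]
    rfl
  | le R ts h1 h2 =>
    change _ = (if kd _ = 0 then _ else _) ++ _
    rw [tl_cd, tr_cd, ln_cd (by omega), kd_cd (by omega), if_neg (by omega), ← LT_corr h1, ← LT_corr h2]
    simp only [BoundedFormula.listEncode, List.finRange_succ, List.map_append, List.map_cons]
    rfl
  | imp _ _ h1 h2 =>
    rename_i a b _ _
    change _ = 3 :: (LF a ++ LF b)
    rw [← h1, ← h2]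
    simp only [BoundedFormula.listEncode, List.map_append, List.map_cons, List.cons_append]
    rfl
  | all _ h =>
    rename_i a _
    change _ = 7 :: LF a
    rw [← h]; rfl

theorem gnum_corr {φ : Snt} {c : Cd} (h : Corr φ c) : gnum φ = Encodable.encode (LF c) := by
  rw [← LF_corr h, ← enc_map]; rfl

theorem gnum_inj {φ ψ : Snt} (h : gnum φ = gnum ψ) : φ = ψ := by
  have := Encodable.encode_injective h
  have := BoundedFormula.encoding.encode_injective this
  simpa using this

end Guaspari

namespace Guaspari
set_option linter.unusedSimpArgs false
set_option linter.unusedVariables false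

/-! ### propositional compactness -/
theorem prop_compact (C : ℕ → List (List (ℕ × Bool))) :
    (∃ N, ∀ V : List Bool, V.length = N → ∃ j < N, ∃ K ∈ C j, ∀ l ∈ K, V[l.1]? = some l.2) ↔
      ¬ ∃ f : ℕ → Bool, ∀ j, ∀ K ∈ C j, ∃ l ∈ K, f l.1 ≠ l.2 := by
  constructor
  · rintro ⟨N, h⟩ ⟨f, hf⟩
    obtain ⟨j, _, K, hK, h2⟩ := h ((List.range N).map f) (by simp)
    obtain ⟨l, hl, h3⟩ := hf j K hK
    have := h2 l hl
    rw [List.getElem?_map, Option.map_eq_some_iff] at this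
    obtain ⟨a, ha, hb⟩ := this
    obtain ⟨h4, h5⟩ := List.getElem?_eq_some_iff.1 ha
    rw [List.getElem_range] at h5
    exact h3 (h5 ▸ hb)
  · intro h
    by_contra hN
    push Not at hN
    choose V hV hV2 using hN
    apply h
    classical
    let U : Ultrafilter ℕ := Filter.hyperfilter ℕ
    have hbig : ∀ j : ℕ, ∀ᶠ N in (U : Filter ℕ), j < N := fun j => by
      have : (U : Filter ℕ) ≤ Filter.atTop := by
        rw [← Nat.cofinite_eq_atTop]; exact Filter.hyperfilter_le_cofinite
      exact this (Filter.eventually_gt_atTop j)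
    refine ⟨fun i => decide (∀ᶠ N in (U : Filter ℕ), (V N)[i]? = some true), fun j K hK => ?_⟩
    by_contra hc
    push Not at hc
    have key : ∀ K' : List (ℕ × Bool), (∀ l ∈ K', decide (∀ᶠ N in (U : Filter ℕ), (V N)[l.1]? = some true) = l.2) →
        ∀ᶠ N in (U : Filter ℕ), ∀ l ∈ K', (V N)[l.1]? = some l.2 := by
      intro K'
      induction K' with
      | nil => intro _; simp
      | cons l K' ih =>
        intro hl
        have h1 := ih fun l' hl' => hl l' (List.mem_cons_of_mem _ hl')
        have h2 := hl l List.mem_cons_self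
        have h3 : ∀ᶠ N in (U : Filter ℕ), (V N)[l.1]? = some l.2 := by
          rcases l with ⟨i, b⟩
          cases b
          · have h2 := of_decide_eq_false h2
            have h2 := Ultrafilter.eventually_not.2 h2
            filter_upwards [h2, hbig i] with N h4 h5
            have h6 : i < (V N).length := by rw [hV]; exact h5
            rw [List.getElem?_eq_getElem h6] at h4 ⊢
            simpa using h4
          · exact of_decide_eq_true h2
        filter_upwards [h1, h3] with N h4 h5 l' hl'
        rcases List.mem_cons.1 hl' with rfl | h
        · exact h5
        · exact h4 l' h
    obtain ⟨N, h1, h2⟩ := ((key K hc).and (hbig j)).exists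
    obtain ⟨l, hl, h3⟩ := hV2 N j h2 K hK
    exact h3 (h1 l hl)

/-! ### semantics of raw codes -/
section
variable {M : Type} [LA.Structure M]
/-- zero -/
def sz : M := Structure.funMap (L := LA) (show LA.Functions 0 from ()) ![]
/-- successor -/
def ss (x : M) : M := Structure.funMap (L := LA) (show LA.Functions 1 from ()) ![x]
/-- addition -/
def sa (x y : M) : M := Structure.funMap (L := LA) (show LA.Functions 2 from false) ![x, y]
/-- multiplication -/
def sm (x y : M) : M := Structure.funMap (L := LA) (show LA.Functions 2 from true) ![x, y]
/-- order -/
def sl (x y : M) : Prop := Structure.RelMap (L := LA) (show LA.Relations 2 from ()) ![x, y]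
/-- value of a raw term -/
noncomputable def tM (c : Cd) (r : List M) : M :=
  Nat.Partrec.Code.recOn (motive := fun _ => M) c sz sz sz sz (fun _ _ x y => sa x y)
    (fun _ _ x y => sm x y) (fun a b _ _ => r.getD (ix a b) sz) (fun _ x => ss x)
/-- satisfaction of a raw formula -/
def Sat (c : Cd) : List M → Prop :=
  Nat.Partrec.Code.recOn (motive := fun _ => List M → Prop) c (fun _ => False) (fun _ => False)
    (fun _ => False) (fun _ => False) (fun _ _ x y r => x r → y r)
    (fun a b _ _ r => if kd a = 0 then tM (tl b) r = tM (tr b) r else sl (tM (tl b) r) (tM (tr b) r))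
    (fun _ _ _ _ _ => False) (fun _ x r => ∀ m, x (r ++ [m]))

theorem tM_corr {n : ℕ} {t : LA.Term (Empty ⊕ Fin n)} {c : Cd} (h : CorrT t c) (v : Fin n → M) :
    t.realize (Sum.elim default v) = tM c (List.ofFn v) := by
  induction h with
  | var i =>
    change v i = (List.ofFn v).getD (ix _ _) sz
    rw [ix_cd]; simp
  | zero f ts =>
    change Structure.funMap _ _ = sz
    unfold sz; congr 1; exact Subsingleton.elim _ _
  | succ f ts _ ih =>
    change Structure.funMap _ _ = ss (tM _ _)
    unfold ss; rw [← ih]; congr 1; funext i; fin_cases i; rfl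
  | add ts _ _ h1 h2 =>
    change Structure.funMap _ _ = sa (tM _ _) (tM _ _)
    unfold sa; rw [← h1, ← h2]; congr 1; funext i; fin_cases i <;> rfl
  | mul ts _ _ h1 h2 =>
    change Structure.funMap _ _ = sm (tM _ _) (tM _ _)
    unfold sm; rw [← h1, ← h2]; congr 1; funext i; fin_cases i <;> rfl

theorem ofFn_snoc' {α : Type} {n : ℕ} (v : Fin n → α) (x : α) :
    List.ofFn (Fin.snoc v x : Fin (n + 1) → α) = List.ofFn v ++ [x] := by
  rw [List.ofFn_succ']
  simp

theorem Sat_corr {n : ℕ} {φ : LA.BoundedFormula Empty n} {c : Cd} (h : Corr φ c) (v : Fin n → M) :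
    φ.Realize default v ↔ Sat c (List.ofFn v) := by
  induction h with
  | falsum => exact Iff.rfl
  | eq h1 h2 =>
    change _ = _ ↔ (if kd _ = 0 then _ else _)
    rw [tl_cd, tr_cd, kd_cd (by omega), if_pos rfl, tM_corr h1, tM_corr h2]
  | le R ts h1 h2 =>
    change Structure.RelMap _ _ ↔ (if kd _ = 0 then _ else _)
    rw [tl_cd, tr_cd, kd_cd (by omega), if_neg (by omega), ← tM_corr h1, ← tM_corr h2]
    unfold sl
    apply iff_of_eq; congr 1; funext i; fin_cases i <;> rfl
  | imp _ _ h1 h2 => exact imp_congr (h1 v) (h2 v)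
  | all _ h =>
    change (∀ m, _) ↔ ∀ m, _
    refine forall_congr' fun m => ?_
    rw [← ofFn_snoc']
    exact h _

theorem tM_hom {h : ℕ → M} (h0 : h 0 = sz) (h1 : ∀ x, h (Nat.pair 1 x) = ss (h x))
    (h2 : ∀ x y, h (Nat.pair 2 (Nat.pair x y)) = sa (h x) (h y))
    (h3 : ∀ x y, h (Nat.pair 3 (Nat.pair x y)) = sm (h x) (h y)) (c : Cd) (r : List ℕ) :
    h (tv c r) = tM c (r.map h) := by
  induction c with
  | zero => exact h0
  | succ => exact h0
  | left => exact h0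
  | right => exact h0
  | pair a b iha ihb =>
    change h (Nat.pair 2 (Nat.pair (tv a r) (tv b r))) = sa (tM a _) (tM b _)
    rw [h2, iha, ihb]
  | comp a b iha ihb =>
    change h (Nat.pair 3 (Nat.pair (tv a r) (tv b r))) = sm (tM a _) (tM b _)
    rw [h3, iha, ihb]
  | prec a b _ _ =>
    change h (r.getD _ 0) = (r.map h).getD _ sz
    rw [← h0, List.getD_map]
  | rfind' a ih =>
    change h (Nat.pair 1 (tv a r)) = ss (tM a _)
    rw [h1, ih]

/-! ### interpretation of names in a model -/
open Classical in
/-- witness -/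
noncomputable def wit (c : Cd) (r : List M) : M :=
  if h : ∃ m, ¬ Sat c (r ++ [m]) then h.choose else sz
/-- one step of the interpretation -/
noncomputable def istep (n : ℕ) (g : ℕ → M) : M :=
  if n.unpair.1 = 0 then sz else
  if n.unpair.1 = 1 then ss (g n.unpair.2) else
  if n.unpair.1 = 2 then sa (g n.unpair.2.unpair.1) (g n.unpair.2.unpair.2) else
  if n.unpair.1 = 3 then sm (g n.unpair.2.unpair.1) (g n.unpair.2.unpair.2) else
  wit (Denumerable.ofNat (Cd × List ℕ) n.unpair.2).1
    ((Denumerable.ofNat (Cd × List ℕ) n.unpair.2).2.map g)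
variable (M) in
/-- interpretation of names -/
noncomputable def nI (n : ℕ) : M :=
  istep n (fun m => if h : m < n then nI m else sz)
termination_by n

theorem pair_gt {a b : ℕ} (h : 1 ≤ a) : b < Nat.pair a b := by
  have := Nat.add_le_pair a b; omega
theorem nI_zero : nI M 0 = sz := by
  rw [nI]; unfold istep; rw [if_pos (by simp)]
theorem nI_succ (x : ℕ) : nI M (Nat.pair 1 x) = ss (nI M x) := by
  rw [nI]; unfold istep; simp only [Nat.unpair_pair]
  simp [pair_gt (b := x) (le_refl 1)]
theorem nI_add (x y : ℕ) : nI M (Nat.pair 2 (Nat.pair x y)) = sa (nI M x) (nI M y) := by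
  rw [nI]; unfold istep; simp only [Nat.unpair_pair]
  have h := pair_gt (a := 2) (b := Nat.pair x y) (by omega)
  have h1 := (Nat.left_le_pair x y).trans_lt h
  have h2 := (Nat.right_le_pair x y).trans_lt h
  simp [h1, h2]
theorem nI_mul (x y : ℕ) : nI M (Nat.pair 3 (Nat.pair x y)) = sm (nI M x) (nI M y) := by
  rw [nI]; unfold istep; simp only [Nat.unpair_pair]
  have h := pair_gt (a := 3) (b := Nat.pair x y) (by omega)
  have h1 := (Nat.left_le_pair x y).trans_lt h
  have h2 := (Nat.right_le_pair x y).trans_lt h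
  simp [h1, h2]
theorem mem_lt_enc {x : ℕ} {r : List ℕ} (h : x ∈ r) : x < Encodable.encode r := by
  induction r with
  | nil => simp at h
  | cons a l ih =>
    rw [Encodable.encode_list_cons]
    rcases List.mem_cons.1 h with rfl | h
    · exact Nat.lt_succ_of_le (Nat.left_le_pair _ _)
    · exact Nat.lt_succ_of_le ((ih h).le.trans (Nat.right_le_pair _ _))
theorem nI_wt (c : Cd) (r : List ℕ) : nI M (wt c r) = wit c (r.map (nI M)) := by
  unfold wt
  rw [nI]; unfold istep; simp only [Nat.unpair_pair, Denumerable.ofNat_encode]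
  simp only [show (4 : ℕ) ≠ 0 from by omega, show (4 : ℕ) ≠ 1 from by omega,
    show (4 : ℕ) ≠ 2 from by omega, show (4 : ℕ) ≠ 3 from by omega, if_false]
  congr 1
  refine List.map_congr_left fun x hx => ?_
  rw [dif_pos]
  refine (mem_lt_enc hx).trans_le ?_
  refine le_trans ?_ (pair_gt (by omega)).le
  exact Nat.right_le_pair _ _

/-- truth of items -/
def fI (M : Type) [LA.Structure M] (i : ℕ) : Prop :=
  if i.unpair.1 = 0 then nI M i.unpair.2.unpair.1 = nI M i.unpair.2.unpair.2 else
  if i.unpair.1 = 1 then sl (nI M i.unpair.2.unpair.1) (nI M i.unpair.2.unpair.2) else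
  Sat (Denumerable.ofNat (Cd × List ℕ) i.unpair.2).1
    ((Denumerable.ofNat (Cd × List ℕ) i.unpair.2).2.map (nI M))

theorem fI_gi (c : Cd) (r : List ℕ) : fI M (gi c r) ↔ Sat c (r.map (nI M)) := by
  unfold fI gi
  simp only [Nat.unpair_pair, Denumerable.ofNat_encode]
  simp

theorem fI_it (c : Cd) (r : List ℕ) : fI M (it c r) ↔ Sat c (r.map (nI M)) := by
  cases c with
  | comp a b =>
    change fI M (Nat.pair (kd a) (Nat.pair (tv (tl b) r) (tv (tr b) r))) ↔ 
      if kd a = 0 then tM (tl b) _ = tM (tr b) _ else sl (tM (tl b) _) (tM (tr b) _)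
    rw [← tM_hom nI_zero nI_succ nI_add nI_mul, ← tM_hom nI_zero nI_succ nI_add nI_mul]
    unfold fI
    simp only [Nat.unpair_pair]
    by_cases h : kd a = 0
    · rw [if_pos h, if_pos h]
    · have : kd a = 1 := by unfold kd at h ⊢; omega
      rw [if_neg h, if_neg h, if_pos this]
  | _ => exact fI_gi _ _

theorem fI_cf (c : Cd) (r : List ℕ) (k : ℕ) {K : List (ℕ × Bool)} (hK : K ∈ cf c r k) :
    ∃ l ∈ K, ¬ (fI M l.1 ↔ l.2 = true) := by
  cases c with
  | pair a b =>
    rw [show cf (.pair a b) r k = [ [(it (.pair a b) r, true), (it a r, true), (it b r, false)],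
      [(it (.pair a b) r, false), (it a r, false)], [(it (.pair a b) r, false), (it b r, true)] ] from rfl] at hK
    have := fI_it (M := M) (.pair a b) r
    rw [show Sat (.pair a b) (r.map (nI M)) = (Sat a (r.map (nI M)) → Sat b (r.map (nI M))) from rfl,
      ← fI_it, ← fI_it] at this
    simp only [List.mem_cons, List.not_mem_nil, or_false] at hK
    rcases hK with rfl | rfl | rfl <;>
      simp only [List.mem_cons, List.not_mem_nil, or_false, exists_eq_or_imp, exists_eq_left, this] <;>
      by_cases h1 : fI M (it a r) <;> by_cases h2 : fI M (it b r) <;> simp [h1, h2]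
  | comp a b => simp [cf] at hK
  | rfind' a =>
    rw [show cf (.rfind' a) r k = [ [(it (.rfind' a) r, true), (it a (r ++ [k]), false)],
      [(it (.rfind' a) r, false), (it a (r ++ [wt a r]), true)] ] from rfl] at hK
    have h1 := fI_it (M := M) (.rfind' a) r
    rw [show Sat (.rfind' a) (r.map (nI M)) = ∀ m, (Sat a (r.map (nI M) ++ [m])) from rfl] at h1
    have h2 := fI_it (M := M) a (r ++ [k])
    have h3 := fI_it (M := M) a (r ++ [wt a r])
    simp only [List.map_append, List.map_cons, List.map_nil, nI_wt] at h2 h3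
    have h4 : (∀ m, Sat a (r.map (nI M) ++ [m])) ∨ ¬ Sat a (r.map (nI M) ++ [wit a (r.map (nI M))]) := by
      by_cases h : ∃ m, ¬ Sat a (r.map (nI M) ++ [m])
      · right; unfold wit; rw [dif_pos h]; exact h.choose_spec
      · left; push Not at h; exact h
    have h5 : (∀ m, Sat a (r.map (nI M) ++ [m])) → Sat a (r.map (nI M) ++ [nI M k]) := fun h => h _
    simp only [List.mem_cons, List.not_mem_nil, or_false] at hK
    rcases hK with rfl | rfl <;>
      simp only [List.mem_cons, List.not_mem_nil, or_false, exists_eq_or_imp, exists_eq_left, h1, h2, h3]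
    · by_cases h : ∀ m, Sat a (r.map (nI M) ++ [m])
      · right; simp [h5 h]
      · left; simp [h]
    · rcases h4 with h4 | h4
      · left; simp [h4]
      · right; simp [h4]
  | _ =>
    simp only [cf, List.mem_cons, List.not_mem_nil, or_false] at hK
    subst hK
    refine ⟨_, List.mem_cons_self, ?_⟩
    rw [fI_it]
    simp [Sat]
end
end Guaspari

namespace Guaspari
set_option linter.unusedSimpArgs false
set_option linter.unusedVariables false

/-- equality item -/
def eE (x y : ℕ) : ℕ := Nat.pair 0 (Nat.pair x y)
/-- order item -/
def eL (x y : ℕ) : ℕ := Nat.pair 1 (Nat.pair x y)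
/-- successor name -/
def fS (x : ℕ) : ℕ := Nat.pair 1 x
/-- sum name -/
def fA (x y : ℕ) : ℕ := Nat.pair 2 (Nat.pair x y)
/-- product name -/
def fP (x y : ℕ) : ℕ := Nat.pair 3 (Nat.pair x y)
/-- name of a numeral -/
def nm (k : ℕ) : ℕ := Nat.rec 0 (fun _ x => fS x) k
/-- equality clauses for four names -/
def eqs (x y z u : ℕ) : List (List (ℕ × Bool)) :=
  [ [(eE x x, false)], [(eE x y, true), (eE x z, true), (eE y z, false)],
    [(eE x y, true), (eE (fS x) (fS y), false)],
    [(eE x y, true), (eE z u, true), (eE (fA x z) (fA y u), false)],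
    [(eE x y, true), (eE z u, true), (eE (fP x z) (fP y u), false)],
    [(eE x y, true), (eE z u, true), (eL x z, true), (eL y u, false)] ]
/-- all clauses with index `j` -/
noncomputable def Cl (RB : ℕ × ℕ → Bool) (cF : Cd) (a b : ℕ) (c : Cd) (r : List ℕ) (k : ℕ) :
    List (List (ℕ × Bool)) :=
  cf c r k ++ (eqs k.unpair.1 k.unpair.2.unpair.1 k.unpair.2.unpair.2.unpair.1
    k.unpair.2.unpair.2.unpair.2 ++
    ((if RB (k, Encodable.encode (LF c)) = true ∧ lv c = 1 then [ [(it c [], false)] ] else []) ++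
      [ [(it cF [nm a, nm b], true)] ]))
/-- numerals in a structure -/
def nmM {M : Type} [LA.Structure M] (k : ℕ) : M := Nat.rec sz (fun _ x => ss x) k

theorem nI_nm {M : Type} [LA.Structure M] (k : ℕ) : nI M (nm k) = nmM k := by
  induction k with
  | zero => exact nI_zero
  | succ k ih =>
    change nI M (Nat.pair 1 (nm k)) = ss (nmM k)
    rw [nI_succ, ih]

theorem fI_eE {M : Type} [LA.Structure M] (x y : ℕ) : fI M (eE x y) ↔ nI M x = nI M y := by
  unfold fI eE; simp only [Nat.unpair_pair]; simp
theorem fI_eL {M : Type} [LA.Structure M] (x y : ℕ) : fI M (eL x y) ↔ sl (nI M x) (nI M y) := by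
  unfold fI eL; simp only [Nat.unpair_pair]; simp

theorem fI_eqs {M : Type} [LA.Structure M] (x y z u : ℕ) {K : List (ℕ × Bool)} (hK : K ∈ eqs x y z u) :
    ∃ l ∈ K, ¬ (fI M l.1 ↔ l.2 = true) := by
  have h1 : nI M (fS x) = ss (nI M x) := nI_succ _
  have h2 : nI M (fS y) = ss (nI M y) := nI_succ _
  have h3 : nI M (fA x z) = sa (nI M x) (nI M z) := nI_add _ _
  have h4 : nI M (fA y u) = sa (nI M y) (nI M u) := nI_add _ _
  have h5 : nI M (fP x z) = sm (nI M x) (nI M z) := nI_mul _ _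
  have h6 : nI M (fP y u) = sm (nI M y) (nI M u) := nI_mul _ _
  by_cases e1 : nI M x = nI M y <;> by_cases e2 : nI M z = nI M u <;>
    by_cases e3 : nI M x = nI M z <;> by_cases e4 : sl (nI M x) (nI M z) <;>
  · simp only [eqs, List.mem_cons, List.not_mem_nil, or_false] at hK
    rcases hK with rfl | rfl | rfl | rfl | rfl | rfl <;>
    simp only [List.mem_cons, List.not_mem_nil, or_false, exists_eq_or_imp, exists_eq_left, fI_eE, fI_eL,
      h1, h2, h3, h4, h5, h6] <;> simp_all

theorem cl_sound {M : Type} [LA.Structure M] {T : Thy} [hM : T.Model M] {RB : ℕ × ℕ → Bool}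
    (h : ∀ m, (∃ k, RB (k, m) = true) ↔ ∃ φ ∈ T, gnum φ = m)
    {F : LA.BoundedFormula Empty 2} {cF : Cd} (hF : Corr F cF) {a b : ℕ}
    (hn : ¬ F.Realize (M := M) default ![nmM a, nmM b]) (c : Cd) (r : List ℕ) (k : ℕ) {K : List (ℕ × Bool)}
    (hK : K ∈ Cl RB cF a b c r k) : ∃ l ∈ K, ¬ (fI M l.1 ↔ l.2 = true) := by
  unfold Cl at hK
  simp only [List.mem_append] at hK
  rcases hK with hK | hK | hK | hK
  · exact fI_cf _ _ _ hK
  · exact fI_eqs _ _ _ _ hK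
  · split_ifs at hK with h1
    · simp only [List.mem_cons, List.not_mem_nil, or_false] at hK
      subst hK
      refine ⟨_, List.mem_cons_self, ?_⟩
      rw [fI_it]
      obtain ⟨φ, hφ⟩ := lv_corr c (n := 0) h1.2
      obtain ⟨ψ, hψ, he⟩ := (h _).1 ⟨k, h1.1⟩
      rw [← gnum_corr hφ] at he
      have := gnum_inj he
      subst this
      have h2 : M ⊨ ψ := hM.realize_of_mem ψ hψ
      have h3 := (Sat_corr hφ (M := M) default).1 h2
      have h4 : Sat c ([].map (nI M)) := by simpa using h3
      exact fun h5 => by simpa using h5.1 h4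
    · simp at hK
  · simp only [List.mem_cons, List.not_mem_nil, or_false] at hK
    subst hK
    refine ⟨_, List.mem_cons_self, ?_⟩
    rw [fI_it]
    rw [Sat_corr hF] at hn
    simp only [List.map_cons, List.map_nil, nI_nm]
    simpa using hn

/-- `f` respects equality clauses -/
def OkE (f : ℕ → Bool) : Prop := ∀ x y z u, ∀ K ∈ eqs x y z u, ∃ l ∈ K, f l.1 ≠ l.2

theorem ok_all {f : ℕ → Bool} (hf : OkE f) (x y z u : ℕ) : f (eE x x) = true ∧
    (f (eE x y) = true → f (eE x z) = true → f (eE y z) = true) ∧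
    (f (eE x y) = true → f (eE (fS x) (fS y)) = true) ∧
    (f (eE x y) = true → f (eE z u) = true → f (eE (fA x z) (fA y u)) = true) ∧
    (f (eE x y) = true → f (eE z u) = true → f (eE (fP x z) (fP y u)) = true) ∧
    (f (eE x y) = true → f (eE z u) = true → f (eL x z) = true → f (eL y u) = true) := by
  have h := hf x y z u
  simp only [eqs, List.mem_cons, List.not_mem_nil, or_false, forall_eq_or_imp, forall_eq,
    exists_eq_or_imp, exists_eq_left] at h
  obtain ⟨h1, h2, h3, h4, h5, h6⟩ := h
  refine ⟨?_, ?_, ?_, ?_, ?_, ?_⟩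
  · simpa using h1
  · intro a b; simpa [a, b] using h2
  · intro a; simpa [a] using h3
  · intro a b; simpa [a, b] using h4
  · intro a b; simpa [a, b] using h5
  · intro a b c; simpa [a, b, c] using h6

/-- setoid of provably equal names -/
def std {f : ℕ → Bool} (hf : OkE f) : Setoid ℕ where
  r x y := f (eE x y) = true
  iseqv := ⟨fun x => (ok_all hf x x x x).1,
    fun {x y} h => (ok_all hf x y x x).2.1 h (ok_all hf x x x x).1,
    fun {x y z} h h' => (ok_all hf y x z x).2.1 ((ok_all hf x y x x).2.1 h (ok_all hf x x x x).1) h'⟩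

/-- term model -/
def TM {f : ℕ → Bool} (hf : OkE f) : Type := Quotient (std hf)
/-- class of a name -/
def mk {f : ℕ → Bool} (hf : OkE f) (x : ℕ) : TM hf := Quotient.mk (std hf) x
theorem mk_eq {f : ℕ → Bool} (hf : OkE f) {x y : ℕ} : mk hf x = mk hf y ↔ f (eE x y) = true :=
  Quotient.eq (r := std hf)
theorem mk_surj {f : ℕ → Bool} (hf : OkE f) (m : TM hf) : ∃ x, mk hf x = m :=
  Quotient.exists_rep m

instance instTM {f : ℕ → Bool} (hf : OkE f) : LA.Structure (TM hf) where
  funMap {n} g v := match n, g, v with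
    | 0, _, _ => mk hf 0
    | 1, _, v => Quotient.lift (s := std hf) (fun x => mk hf (fS x))
        (fun x y h => (mk_eq hf).2 ((ok_all hf x y x x).2.2.1 h)) (v 0)
    | 2, false, v => Quotient.lift₂ (s₁ := std hf) (s₂ := std hf) (fun x y => mk hf (fA x y))
        (fun x y z u h h' => (mk_eq hf).2 ((ok_all hf x z y u).2.2.2.1 h h')) (v 0) (v 1)
    | 2, true, v => Quotient.lift₂ (s₁ := std hf) (s₂ := std hf) (fun x y => mk hf (fP x y))
        (fun x y z u h h' => (mk_eq hf).2 ((ok_all hf x z y u).2.2.2.2.1 h h')) (v 0) (v 1)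
  RelMap {n} g v := match n, g, v with
    | 2, _, v => Quotient.lift₂ (s₁ := std hf) (s₂ := std hf) (fun x y => f (eL x y) = true)
        (fun x y z u h h' => propext ⟨(ok_all hf x z y u).2.2.2.2.2 h h',
          (ok_all hf z x u y).2.2.2.2.2 ((std hf).symm h) ((std hf).symm h')⟩) (v 0) (v 1)

theorem mk_zero {f : ℕ → Bool} (hf : OkE f) : mk hf 0 = sz := rfl
theorem mk_succ {f : ℕ → Bool} (hf : OkE f) (x : ℕ) : mk hf (Nat.pair 1 x) = ss (mk hf x) := rfl
theorem mk_add {f : ℕ → Bool} (hf : OkE f) (x y : ℕ) :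
    mk hf (Nat.pair 2 (Nat.pair x y)) = sa (mk hf x) (mk hf y) := rfl
theorem mk_mul {f : ℕ → Bool} (hf : OkE f) (x y : ℕ) :
    mk hf (Nat.pair 3 (Nat.pair x y)) = sm (mk hf x) (mk hf y) := rfl
theorem mk_le {f : ℕ → Bool} (hf : OkE f) (x y : ℕ) :
    sl (mk hf x) (mk hf y) ↔ f (eL x y) = true := Iff.rfl
theorem mk_nm {f : ℕ → Bool} (hf : OkE f) (k : ℕ) : mk hf (nm k) = nmM k := by
  induction k with
  | zero => rfl
  | succ k ih =>
    change ss (mk hf (nm k)) = ss (nmM k)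
    rw [ih]

theorem tm_junk {f : ℕ → Bool} (hf : OkE f)
    (hc : ∀ c r k, ∀ K ∈ cf c r k, ∃ l ∈ K, f l.1 ≠ l.2) (c : Cd) (r : List ℕ)
    (h1 : cf c r 0 = [ [(it c r, true)] ]) (h2 : ¬ Sat c (r.map (mk hf))) :
    Sat c (r.map (mk hf)) ↔ f (it c r) = true := by
  have h := hc c r 0 [(it c r, true)] (by rw [h1]; exact List.mem_cons_self)
  simp only [List.mem_cons, List.not_mem_nil, or_false, exists_eq_left] at h
  exact iff_of_false h2 h

theorem tm_truth {f : ℕ → Bool} (hf : OkE f)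
    (hc : ∀ c r k, ∀ K ∈ cf c r k, ∃ l ∈ K, f l.1 ≠ l.2) (c : Cd) :
    ∀ r : List ℕ, Sat c (r.map (mk hf)) ↔ f (it c r) = true := by
  induction c with
  | pair a b iha ihb =>
    intro r
    change (Sat a _ → Sat b _) ↔ _
    rw [iha, ihb]
    have h := hc (.pair a b) r 0
    rw [show cf (.pair a b) r 0 = [ [(it (.pair a b) r, true), (it a r, true), (it b r, false)],
      [(it (.pair a b) r, false), (it a r, false)], [(it (.pair a b) r, false), (it b r, true)] ] from rfl] at h
    simp only [List.mem_cons, List.not_mem_nil, or_false, forall_eq_or_imp, forall_eq,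
      exists_eq_or_imp, exists_eq_left] at h
    generalize f (it (.pair a b) r) = x at *
    generalize f (it a r) = y at *
    generalize f (it b r) = z at *
    revert h; clear * -; revert x y z; decide
  | comp a b _ _ =>
    intro r
    change (if kd a = 0 then tM (tl b) _ = tM (tr b) _ else sl (tM (tl b) _) (tM (tr b) _)) ↔
      f (Nat.pair (kd a) (Nat.pair (tv (tl b) r) (tv (tr b) r))) = true
    rw [← tM_hom (mk_zero hf) (mk_succ hf) (mk_add hf) (mk_mul hf),
      ← tM_hom (mk_zero hf) (mk_succ hf) (mk_add hf) (mk_mul hf), mk_eq, mk_le]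
    by_cases h : kd a = 0
    · rw [if_pos h, h]; rfl
    · have : kd a = 1 := by unfold kd at h ⊢; omega
      rw [if_neg h, this]; rfl
  | rfind' a ih =>
    intro r
    change (∀ m, Sat a (_ ++ [m])) ↔ _
    have h (k : ℕ) := hc (.rfind' a) r k
    have e (k : ℕ) : cf (.rfind' a) r k = [ [(it (.rfind' a) r, true), (it a (r ++ [k]), false)],
      [(it (.rfind' a) r, false), (it a (r ++ [wt a r]), true)] ] := rfl
    simp only [e, List.mem_cons, List.not_mem_nil, or_false, forall_eq_or_imp, forall_eq,
      exists_eq_or_imp, exists_eq_left] at h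
    have h2 (k : ℕ) : Sat a (r.map (mk hf) ++ [mk hf k]) ↔ f (it a (r ++ [k])) = true := by
      rw [← ih]; simp
    constructor
    · intro h1
      have h3 := (h 0).2
      rw [(h2 _).1 (h1 _)] at h3
      simpa using h3
    · intro h1 m
      obtain ⟨k, rfl⟩ := mk_surj hf m
      rw [h2]
      have h3 := (h k).1
      rw [h1] at h3
      simpa using h3
  | _ =>
    intro r
    exact tm_junk hf hc _ r rfl id

theorem cl_sem {T : Thy} {RB : ℕ × ℕ → Bool}
    (h : ∀ m, (∃ k, RB (k, m) = true) ↔ ∃ φ ∈ T, gnum φ = m)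
    {F : LA.BoundedFormula Empty 2} {cF : Cd} (hF : Corr F cF) (a b : ℕ) :
    (∃ f : ℕ → Bool, ∀ c r k, ∀ K ∈ Cl RB cF a b c r k, ∃ l ∈ K, f l.1 ≠ l.2) ↔
      ∃ (M : Type) (_ : LA.Structure M), T.Model M ∧ ¬ F.Realize (M := M) default ![nmM a, nmM b] := by
  classical
  constructor
  · rintro ⟨f, H⟩
    have hf : OkE f := by
      intro x y z u K hK
      refine H .zero [] (Nat.pair x (Nat.pair y (Nat.pair z u))) K ?_
      unfold Cl
      simp only [Nat.unpair_pair]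
      exact List.mem_append_right _ (List.mem_append_left _ hK)
    have ht := tm_truth hf fun c r k K hK => H c r k K (List.mem_append_left _ hK)
    refine ⟨TM hf, inferInstance, ⟨fun φ hφ => ?_⟩, ?_⟩
    · obtain ⟨c, hc⟩ := corr_ex φ
      obtain ⟨k, hk⟩ := (h (gnum φ)).2 ⟨φ, hφ, rfl⟩
      rw [gnum_corr hc] at hk
      refine (Sat_corr hc (M := TM hf) default).2 ?_
      have h1 := (ht c []).2 ?_
      · simpa using h1
      · obtain ⟨l, hl, h2⟩ := H c [] k [(it c [], false)] (by
          unfold Cl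
          rw [if_pos ⟨hk, corr_lv hc⟩]
          simp)
        simp only [List.mem_cons, List.not_mem_nil, or_false] at hl
        subst hl
        simpa using h2
    · rw [Sat_corr hF]
      obtain ⟨l, hl, h2⟩ := H .zero [] 0 [(it cF [nm a, nm b], true)] (by
          unfold Cl
          simp)
      simp only [List.mem_cons, List.not_mem_nil, or_false] at hl
      subst hl
      have h3 := ht cF [nm a, nm b]
      simp only [List.map_cons, List.map_nil, mk_nm] at h3
      intro h4
      exact h2 (h3.1 (by simpa using h4))
  · rintro ⟨M, _, hM, hn⟩
    refine ⟨fun i => decide (fI M i), fun c r k K hK => ?_⟩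
    obtain ⟨l, hl, h1⟩ := cl_sound (hM := hM) h hF hn c r k hK
    refine ⟨l, hl, fun h2 => h1 ?_⟩
    rw [← h2]; simp
end Guaspari

namespace Guaspari
set_option linter.unusedSimpArgs false
set_option linter.unusedVariables false

theorem comp_RB {T : Thy} (h : CompThy T) : ∃ RB : ℕ × ℕ → Bool, Primrec RB ∧
    ∀ m, (∃ k, RB (k, m) = true) ↔ ∃ φ ∈ T, gnum φ = m := by
  obtain ⟨f, hf, he⟩ := ComputablePred.computable_iff.1 h
  obtain ⟨c, hc⟩ := Nat.Partrec.Code.exists_code.1 hf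
  refine ⟨fun p => decide (Nat.Partrec.Code.evaln p.1 c p.2 = some 1), ?_, fun m => ?_⟩
  · have h1 : PrimrecPred (fun p : ℕ × ℕ => Nat.Partrec.Code.evaln p.1 c p.2 = some 1) :=
      qeq (Nat.Partrec.Code.primrec_evaln.comp (qpair (qpair (qfst qid) (.const c)) (qsnd qid))) (.const (some 1))
    exact h1.decide
  · have h2 : (∃ φ ∈ T, gnum φ = m) ↔ f m = true := iff_of_eq (congrFun he m)
    rw [h2]
    have h3 : (∃ k, Nat.Partrec.Code.evaln k c m = some 1) ↔ 1 ∈ Nat.Partrec.Code.eval c m :=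
      (Nat.Partrec.Code.evaln_complete (x := 1)).symm
    simp only [decide_eq_true_eq]
    rw [h3, hc]
    cases hfm : f m <;> simp [hfm]

section
variable {α β : Type} [Primcodable α] [Primcodable β]
theorem qall {f : α → List β} {P : β → α → Prop} (hf : Primrec f) (h : PrimrecRel P) :
    PrimrecPred fun a => ∀ x ∈ f a, P x a := h.forall_mem_list.comp hf Primrec.id
theorem qex {f : α → List β} {P : β → α → Prop} (hf : Primrec f) (h : PrimrecRel P) :
    PrimrecPred fun a => ∃ x ∈ f a, P x a := h.exists_mem_list.comp hf Primrec.id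
theorem qeE {f g : α → ℕ} (h : Primrec f) (h' : Primrec g) : Primrec (fun a => eE (f a) (g a)) :=
  qnp (.const 0) (qnp h h')
theorem qeL {f g : α → ℕ} (h : Primrec f) (h' : Primrec g) : Primrec (fun a => eL (f a) (g a)) :=
  qnp (.const 1) (qnp h h')
theorem qfS {f : α → ℕ} (h : Primrec f) : Primrec (fun a => fS (f a)) := qnp (.const 1) h
theorem qfA {f g : α → ℕ} (h : Primrec f) (h' : Primrec g) : Primrec (fun a => fA (f a) (g a)) :=
  qnp (.const 2) (qnp h h')
theorem qfP {f g : α → ℕ} (h : Primrec f) (h' : Primrec g) : Primrec (fun a => fP (f a) (g a)) :=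
  qnp (.const 3) (qnp h h')
theorem qnm {f : α → ℕ} (h : Primrec f) : Primrec (fun a => nm (f a)) :=
  Primrec.nat_rec' (g := fun _ => 0) (h := fun _ p => fS p.2) h (.const 0) (qfS (qsnd (qsnd qid)))
theorem qeqs {x y z u : α → ℕ} (hx : Primrec x) (hy : Primrec y) (hz : Primrec z) (hu : Primrec u) :
    Primrec (fun a => eqs (x a) (y a) (z a) (u a)) :=
  qcons (qcl (qeE hx hx) qc0) <|
  qcons (qcl (qeE hx hy) <| qcl (qeE hx hz) <| qcl (qeE hy hz) qc0) <|
  qcons (qcl (qeE hx hy) <| qcl (qeE (qfS hx) (qfS hy)) qc0) <|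
  qcons (qcl (qeE hx hy) <| qcl (qeE hz hu) <| qcl (qeE (qfA hx hz) (qfA hy hu)) qc0) <|
  qcons (qcl (qeE hx hy) <| qcl (qeE hz hu) <| qcl (qeE (qfP hx hz) (qfP hy hu)) qc0) <|
  qcons (qcl (qeE hx hy) <| qcl (qeE hz hu) <| qcl (qeL hx hz) <| qcl (qeL hy hu) qc0) qd0
theorem qCl {RB : ℕ × ℕ → Bool} (hR : Primrec RB) {cF : Cd} {x y k : α → ℕ} {c : α → Cd} {r : α → List ℕ}
    (hx : Primrec x) (hy : Primrec y) (hc : Primrec c) (hr : Primrec r) (hk : Primrec k) :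
    Primrec (fun a => Cl RB cF (x a) (y a) (c a) (r a) (k a)) := by
  refine qapp (qcf hc hr hk) (qapp (qeqs (qfst (qunp hk)) (qfst (qunp (qsnd (qunp hk))))
    (qfst (qunp (qsnd (qunp (qsnd (qunp hk)))))) (qsnd (qunp (qsnd (qunp (qsnd (qunp hk))))))) (qapp ?_ ?_))
  · refine Primrec.ite ?_ (qcons (qcl (qit hc (.const [])) qc0) qd0) qd0
    exact (qeq (hR.comp (qpair hk (qenc (qLF hc)))) (.const true)).and (qeq (qlv hc) (.const 1))
  · exact qcons (qcl (qit (.const cF) (qcons (qnm hx) (qcons (qnm hy) (.const [])))) qc0) qd0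
end

/-- all Boolean lists of a given length -/
def allB (N : ℕ) : List (List Bool) :=
  Nat.rec [ [] ] (fun _ L => L.map (fun x => true :: x) ++ L.map (fun x => false :: x)) N
theorem mem_allB (N : ℕ) (V : List Bool) : V ∈ allB N ↔ V.length = N := by
  induction N generalizing V with
  | zero => simp [allB]
  | succ N ih =>
    change V ∈ (allB N).map _ ++ (allB N).map _ ↔ _
    simp only [List.mem_append, List.mem_map, ih]
    cases V with
    | nil => simp
    | cons b V => cases b <;> simp
theorem qallB {α : Type} [Primcodable α] {f : α → ℕ} (h : Primrec f) : Primrec (fun a => allB (f a)) := by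
  refine Primrec.nat_rec' (g := fun _ => [ [] ])
    (h := fun _ p => p.2.map (fun x => true :: x) ++ p.2.map (fun x => false :: x)) h (.const _) ?_
  refine qapp ?_ ?_
  · exact Primrec.list_map (qsnd (qsnd qid)) (qcons (.const true) (qsnd qid))
  · exact Primrec.list_map (qsnd (qsnd qid)) (qcons (.const false) (qsnd qid))

/-- clauses by number -/
noncomputable def ClN (RB : ℕ × ℕ → Bool) (cF : Cd) (a b : ℕ) (j : ℕ) : List (List (ℕ × Bool)) :=
  Cl RB cF a b (Denumerable.ofNat (Cd × List ℕ × ℕ) j).1 (Denumerable.ofNat (Cd × List ℕ × ℕ) j).2.1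
    (Denumerable.ofNat (Cd × List ℕ × ℕ) j).2.2

theorem cl_R {RB : ℕ × ℕ → Bool} (hR : Primrec RB) {cF : Cd} :
    PrimrecPred (fun w : ℕ × ℕ × ℕ => ∀ V ∈ allB w.2.2, ∃ j ∈ List.range w.2.2, ∃ K ∈ ClN RB cF w.1 w.2.1 j,
      ∀ l ∈ K, V[l.1]? = some l.2) := by
  refine qall (P := fun V w => ∃ j ∈ List.range w.2.2, ∃ K ∈ ClN RB cF w.1 w.2.1 j,
      ∀ l ∈ K, V[l.1]? = some l.2) (qallB (qsnd (qsnd qid))) ?_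
  refine qex (α := List Bool × (ℕ × ℕ × ℕ)) (P := fun j p => ∃ K ∈ ClN RB cF p.2.1 p.2.2.1 j,
      ∀ l ∈ K, p.1[l.1]? = some l.2) (Primrec.list_range.comp (qsnd (qsnd (qsnd qid)))) ?_
  refine qex (α := ℕ × List Bool × (ℕ × ℕ × ℕ)) (P := fun (K : List (ℕ × Bool)) p => ∀ l ∈ K, p.2.1[l.1]? = some l.2) ?_ ?_
  · have hj : Primrec (fun p : ℕ × List Bool × (ℕ × ℕ × ℕ) => Denumerable.ofNat (Cd × List ℕ × ℕ) p.1) :=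
      (Primrec.ofNat _).comp (qfst qid)
    exact qCl hR (qfst (qsnd (qsnd qid))) (qfst (qsnd (qsnd (qsnd qid)))) (qfst hj) (qfst (qsnd hj)) (qsnd (qsnd hj))
  · refine qall (α := List (ℕ × Bool) × ℕ × List Bool × (ℕ × ℕ × ℕ)) (P := fun l p => p.2.2.1[l.1]? = some l.2)
      (qfst qid) ?_
    exact qeq (Primrec.list_getElem?.comp (qfst (qsnd (qsnd (qsnd qid)))) (qfst (qfst qid)))
      (Primrec.option_some.comp (qsnd (qfst qid)))

theorem ent_S1 {T : Thy} (hT : CompThy T) (F : LA.BoundedFormula Empty 2) :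
    S1 (fun v : Fin 2 → ℕ => ∀ (M : Type) (_ : LA.Structure M), T.Model M →
      F.Realize (M := M) default ![nmM (v 0), nmM (v 1)]) := by
  classical
  obtain ⟨RB, hR, h⟩ := comp_RB hT
  obtain ⟨cF, hF⟩ := corr_ex F
  refine (S1.ofPrimrec (cl_R (cF := cF) hR)).congr fun v => ?_
  have h1 := prop_compact (ClN RB cF (v 0) (v 1))
  simp only [mem_allB, List.mem_range]
  rw [h1]
  have h2 := cl_sem h hF (v 0) (v 1)
  have h3 : (∃ f : ℕ → Bool, ∀ j, ∀ K ∈ ClN RB cF (v 0) (v 1) j, ∃ l ∈ K, f l.1 ≠ l.2) ↔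
      (∃ f : ℕ → Bool, ∀ c r k, ∀ K ∈ Cl RB cF (v 0) (v 1) c r k, ∃ l ∈ K, f l.1 ≠ l.2) := by
    refine exists_congr fun f => ⟨fun H c r k => ?_, fun H j => H _ _ _⟩
    have := H (Encodable.encode (c, r, k))
    unfold ClN at this
    rw [Denumerable.ofNat_encode] at this
    exact this
  rw [h3, h2]
  push Not
  rfl
end Guaspari

namespace Guaspari
set_option linter.unusedSimpArgs false
set_option linter.unusedVariables false

section
variable {M : Type} [PAM M]
/-- matrix of the truth predicate at level `k + 1` -/
def Bn : ℕ → M → M → Prop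
  | 0, p, y => E p 0 y
  | k + 1, p, y => ¬ Tr (k + 1) p (pr y 0)
theorem Tr_Bn (k : ℕ) (p : M) : Tr (k + 1) p 0 ↔ ∃ y, Bn k p y := by
  cases k with
  | zero => exact Tr_one p 0
  | succ k => rfl
/-- witnessing relation with tag and argument -/
def Wt (t : M) (q p N : M) : Prop := E q (pr (pr t p) (pr q 0)) N
/-- least witness -/
def Lst (q s : M) : Prop := Wt 0 q 0 s ∧ ∀ s', s' ≤ s → (s' < s → ¬ Wt 0 q 0 s')
/-- Sigma part -/
def chS (k : ℕ) (q : M) : Prop :=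
  ∃ s, ∃ w, (Lst q s ∧ ∀ p, p ≤ s → ∀ N, N ≤ s → Wt 1 q p N → ∃ y, y ≤ w ∧ mem (pr p y) w) ∧
    ∀ p, p ≤ w → ∀ y, y ≤ w → mem (pr p y) w → Bn k p y
/-- Pi part -/
def chP (k : ℕ) (q : M) : Prop :=
  ∀ s, ∀ p, p ≤ s → ∀ N, N ≤ s → (Lst q s ∧ Wt 2 q p N) → ¬ Tr (k + 1) p 0
/-- the predicate whose negation is the desired sentence -/
def chi (k : ℕ) (q : M) : Prop := chS k q ∧ chP k q
end

section
variable {m : ℕ} {t q p N : ∀ (M : Type) [PAM M], (Fin m → M) → M}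
theorem Bn_PiF (k : ℕ) (hp : DT p) (hN : DT N) : PiF k (fun M _ v => Bn k (p M v) (N M v)) := by
  cases k with
  | zero => exact (E_D0 hp .zero hN).pi
  | succ k => exact (Tr_SigF k hp (.pr hN .zero)).neg
theorem Wt_D0 (ht : DT t) (hq : DT q) (hp : DT p) (hN : DT N) :
    D0 (fun M _ v => Wt (t M v) (q M v) (p M v) (N M v)) :=
  E_D0 hq (.pr (.pr ht hp) (.pr hq .zero)) hN
theorem Lst_D0 (hq : DT q) (hp : DT p) : D0 (fun M _ v => Lst (q M v) (p M v)) := by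
  refine (Wt_D0 .zero hq .zero hp).and ?_
  refine D0.ball hp ?_
  exact (D0.lt (.var _) (hp.ren _)).imp (Wt_D0 .zero (hq.ren _) .zero (.var _)).not
end

theorem chS_SigF (k : ℕ) {m : ℕ} {q : ∀ (M : Type) [PAM M], (Fin m → M) → M} (hq : DT q) :
    SigF (k + 1) (fun M _ v => chS k (q M v)) := by
  unfold chS
  apply SigF.ex
  apply SigF.ex
  apply SigF.gand
  · refine (Lst_D0 ((hq.ren _).ren _) (.var _)).and ?_
    apply D0.ball (.var _)
    apply D0.ball (.var _)
    apply D0.imp (Wt_D0 .one ((((hq.ren _).ren _).ren _).ren _) (.var _) (.var _))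
    apply D0.bex (.var _)
    exact mem_D0 (.pr (.var _) (.var _)) (.var _)
  · apply PiF.up
    apply PiF.ball (.var _)
    apply PiF.ball (.var _)
    apply PiF.gimp
    · exact mem_D0 (.pr (.var _) (.var _)) (.var _)
    · exact Bn_PiF k (.var _) (.var _)

theorem chP_PiF (k : ℕ) {m : ℕ} {q : ∀ (M : Type) [PAM M], (Fin m → M) → M} (hq : DT q) :
    PiF (k + 1) (fun M _ v => chP k (q M v)) := by
  unfold chP
  apply PiF.all
  apply PiF.ball (.var _)
  apply PiF.ball (.var _)
  apply PiF.gimp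
  · exact (Lst_D0 (((hq.ren _).ren _).ren _) (.var _)).and
      (Wt_D0 .two (((hq.ren _).ren _).ren _) (.var _) (.var _))
  · exact (Tr_SigF k (.var _) .zero).neg

theorem coll {M : Type} [PAM M] {G : M → Prop} {B : M → M → Prop} (hG : Dfn (fun w : Fin 1 → M => G (w 0)))
    (hB : Dfn (fun w : Fin 2 → M => B (w 0) (w 1))) (H : ∀ p, G p → ∃ y, B p y) (t : M) :
    ∃ w : M, (∀ p, p ≤ t → G p → ∃ y, mem (pr p y) w) ∧ ∀ p y, mem (pr p y) w → B p y := by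
  refine Dfn.ind (R := fun t : M => ∃ w : M, (∀ p, p ≤ t → G p → ∃ y, mem (pr p y) w) ∧
    ∀ p y, mem (pr p y) w → B p y) ?_ ?_ ?_ t
  · apply Dfn.ex
    refine Dfn.and ?_ ?_
    · apply Dfn.all
      refine Dfn.imp (.le (.var _) (.var _)) (Dfn.imp (hG.comp1 (.var _)) ?_)
      apply Dfn.ex
      exact mem_dfn (.pr (.var _) (.var _)) (.var _)
    · apply Dfn.all
      apply Dfn.all
      exact Dfn.imp (mem_dfn (.pr (.var _) (.var _)) (.var _)) (hB.comp2 (.var _) (.var _))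
  · obtain ⟨S, hS⟩ := coded_empty (M := M)
    by_cases h : G 0
    · obtain ⟨y, hy⟩ := H 0 h
      obtain ⟨S', hS'⟩ := coded_insert (pr 0 y) S
      refine ⟨S', fun p hp _ => ⟨y, ?_⟩, fun p y' h' => ?_⟩
      · rw [hS']; left; rw [le_antisymm hp (zero_le)]
      · rcases (hS' _).1 h' with h1 | h1
        · obtain ⟨rfl, rfl⟩ := pr_inj.1 h1; exact hy
        · exact (hS _ h1).elim
    · refine ⟨S, fun p hp hG => ?_, fun p y h' => (hS _ h').elim⟩
      rw [le_antisymm hp (zero_le)] at hG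
      exact (h hG).elim
  · rintro x ⟨S, h1, h2⟩
    by_cases h : G (x + 1)
    · obtain ⟨y, hy⟩ := H _ h
      obtain ⟨S', hS'⟩ := coded_insert (pr (x + 1) y) S
      refine ⟨S', fun p hp hg => ?_, fun p y' h' => ?_⟩
      · rcases (le_succ_iff _ _).1 hp with h3 | rfl
        · obtain ⟨y', h4⟩ := h1 p h3 hg
          exact ⟨y', (hS' _).2 (Or.inr h4)⟩
        · exact ⟨y, (hS' _).2 (Or.inl rfl)⟩
      · rcases (hS' _).1 h' with h3 | h3
        · obtain ⟨rfl, rfl⟩ := pr_inj.1 h3; exact hy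
        · exact h2 _ _ h3
    · refine ⟨S, fun p hp hg => ?_, h2⟩
      rcases (le_succ_iff _ _).1 hp with h3 | rfl
      · exact h1 p h3 hg
      · exact (h hg).elim

theorem chS_iff {M : Type} [PAM M] (k : ℕ) (q : M) :
    chS k q ↔ ∃ s, Lst q s ∧ ∀ p, p ≤ s → ∀ N, N ≤ s → Wt 1 q p N → Tr (k + 1) p 0 := by
  constructor
  · rintro ⟨s, w, ⟨h1, h2⟩, h3⟩
    refine ⟨s, h1, fun p hp N hN hW => ?_⟩
    obtain ⟨y, hy, h4⟩ := h2 p hp N hN hW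
    exact (Tr_Bn k p).2 ⟨y, h3 p ((le_prl _ _).trans (mem_le h4)) y hy h4⟩
  · rintro ⟨s, h1, h2⟩
    have hG : Dfn (fun w : Fin 1 → M => w 0 ≤ s ∧ ∃ N, N ≤ s ∧ Wt 1 q (w 0) N) := by
      refine Dfn.and (.le (.var _) (.const s)) ?_
      apply Dfn.ex
      refine Dfn.and (.le (.var _) (.const s)) ?_
      exact (Wt_D0 (t := fun M _ (w : Fin 3 → M) => 1) (q := fun M _ (w : Fin 3 → M) => w 0)
        (p := fun M _ (w : Fin 3 → M) => w 1) (N := fun M _ (w : Fin 3 → M) => w 2)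
        .one (.var _) (.var _) (.var _)).fm.dfn3 (R := fun M _ x y z => Wt 1 x y z) (.const q) (.var _) (.var _)
    have hB : Dfn (fun w : Fin 2 → M => Bn k (w 0) (w 1)) :=
      (Bn_PiF k (p := fun M _ (w : Fin 2 → M) => w 0) (N := fun M _ (w : Fin 2 → M) => w 1)
        (.var _) (.var _)).fm.dfn2 (R := fun M _ x y => Bn k x y) (.var _) (.var _)
    obtain ⟨w, h3, h4⟩ := coll (M := M) (G := fun p => p ≤ s ∧ ∃ N, N ≤ s ∧ Wt 1 q p N) (B := Bn k) hG hB
      (fun p ⟨hp, N, hN, hW⟩ => (Tr_Bn k p).1 (h2 p hp N hN hW)) s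
    refine ⟨s, w, ⟨h1, fun p hp N hN hW => ?_⟩, fun p _ y _ h => h4 p y h⟩
    obtain ⟨y, hy⟩ := h3 p hp ⟨hp, N, hN, hW⟩
    exact ⟨y, (le_prr _ _).trans (mem_le hy), hy⟩

theorem Lst_unique {M : Type} [PAM M] {q s s' : M} (h : Lst q s) (h' : Lst q s') : s = s' := by
  rcases lt_trichotomy s s' with h1 | h1 | h1
  · exact (h'.2 s h1.le h1 h.1).elim
  · exact h1
  · exact (h.2 s' h1.le h1 h'.1).elim

theorem Wt_abs (M : Type) [PAM M] (t q p N : ℕ) : Wt (t : M) (q : M) (p : M) (N : M) ↔ Wt t q p N :=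
  D0.abs (P := fun M _ (v : Fin 4 → M) => Wt (v 0) (v 1) (v 2) (v 3))
    (Wt_D0 (.var _) (.var _) (.var _) (.var _)) M ![t, q, p, N]
theorem Lst_abs (M : Type) [PAM M] (q s : ℕ) : Lst (q : M) (s : M) ↔ Lst q s :=
  D0.abs (P := fun M _ (v : Fin 2 → M) => Lst (v 0) (v 1)) (Lst_D0 (.var _) (.var _)) M ![q, s]
end Guaspari

namespace Guaspari
set_option linter.unusedSimpArgs false
set_option linter.unusedVariables false

theorem prv_iff {T : Thy} {φ : Snt} :
    Prv T φ ↔ ∀ (M : Type) (_ : LA.Structure M), T.Model M → M ⊨ φ := by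
  unfold Prv
  rw [Theory.models_sentence_iff]
  constructor
  · intro h M i hM
    haveI : Nonempty M := ⟨sz⟩
    exact h (Theory.ModelType.of T M)
  · intro h M
    exact h M _ M.is_model

theorem pa_model {T : Thy} (hT : ExtPA T) {M : Type} [LA.Structure M] (hM : T.Model M) : M ⊨ PAAx :=
  ⟨fun φ hφ => prv_iff.1 (hT φ hφ) M _ hM⟩

/-- truth in all models with the algebraic structure -/
def Ent (T : Thy) (P : ∀ (M : Type) [PAM M], Prop) : Prop := ∀ (M : Type) [PAM M], T.Model M → P M

theorem prv_pam {T : Thy} (hT : ExtPA T) {φ : Snt} :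
    Prv T φ ↔ Ent T (fun M _ => M ⊨ φ) := by
  rw [prv_iff]
  constructor
  · intro h M i hM
    exact h M _ hM
  · intro h M i hM
    exact @h M (PAM.ofModel (pa_model hT hM)) hM

theorem snt_iff {M : Type} [PAM M] (φ : Snt) : M ⊨ φ ↔ BoundedFormula.Realize (M := M) φ default ![] := by
  unfold Sentence.Realize Formula.Realize
  rw [Subsingleton.elim (default : Fin 0 → M) ![] ]

theorem nmM_eq {M : Type} [PAM M] (k : ℕ) : (nmM k : M) = k := by
  induction k with
  | zero => rw [Nat.cast_zero]; exact PAM.hz _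
  | succ k ih =>
    rw [Nat.cast_succ, ← ih]
    exact PAM.hs _

theorem ent_iff {T : Thy} (hT : ExtPA T) (F : LA.BoundedFormula Empty 2) (a b : ℕ) :
    (∀ (M : Type) (_ : LA.Structure M), T.Model M → F.Realize (M := M) default ![nmM a, nmM b]) ↔
    Ent T (fun M _ => F.Realize (M := M) default ![(a : M), (b : M)]) := by
  constructor
  · intro h M i hM
    have := h M _ hM
    rwa [nmM_eq, nmM_eq] at this
  · intro h M i hM
    have := @h M (PAM.ofModel (pa_model hT hM)) hM
    simp only [← nmM_eq] at this
    exact this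

theorem ent_fm {T : Thy} (hT : GoodThy T) {P : ∀ (M : Type) [PAM M], M → M → Prop}
    (h : Fm (fun M _ (v : Fin 2 → M) => P M (v 0) (v 1))) :
    S1 (fun v : Fin 2 → ℕ => Ent T (fun M _ => P M (v 0 : M) (v 1 : M))) := by
  obtain ⟨F, hF⟩ := h
  refine (ent_S1 hT.1 F).congr fun v => ?_
  rw [ent_iff hT.2.2]
  unfold Ent
  refine forall_congr' fun M => forall_congr' fun i => imp_congr Iff.rfl ?_
  exact hF M _

theorem Fm.imp {m : ℕ} {P Q : ∀ (M : Type) [PAM M], (Fin m → M) → Prop} (h : Fm P) (h' : Fm Q) :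
    Fm (fun M _ v => P M v → Q M v) := by
  obtain ⟨φ, h⟩ := h
  obtain ⟨ψ, h'⟩ := h'
  exact ⟨φ ⟹ ψ, fun M _ v => by rw [BoundedFormula.realize_imp, h, h']⟩
theorem Fm.not {m : ℕ} {P : ∀ (M : Type) [PAM M], (Fin m → M) → Prop} (h : Fm P) :
    Fm (fun M _ v => ¬ P M v) := by
  obtain ⟨φ, h⟩ := h
  exact ⟨∼φ, fun M _ v => by rw [BoundedFormula.realize_not, h]⟩
theorem Fm.and {m : ℕ} {P Q : ∀ (M : Type) [PAM M], (Fin m → M) → Prop} (h : Fm P) (h' : Fm Q) :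
    Fm (fun M _ v => P M v ∧ Q M v) := by
  obtain ⟨φ, h⟩ := h
  obtain ⟨ψ, h'⟩ := h'
  exact ⟨φ ⊓ ψ, fun M _ v => by rw [BoundedFormula.realize_inf, h, h']⟩

/-- the tagged matrices -/
def Fk (k : ℕ) : ℕ → ∀ (M : Type) [PAM M], M → M → Prop
  | 0, M, _, q, p => ¬ chi k q
  | 1, M, _, q, p => ¬ chi k q → Tr (k + 1) p 0
  | _, M, _, q, p => ¬ chi k q → ¬ Tr (k + 1) p 0

theorem Fk_fm (k t : ℕ) : Fm (fun M _ (v : Fin 2 → M) => Fk k t M (v 0) (v 1)) := by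
  have h0 : Fm (fun M _ (v : Fin 2 → M) => ¬ chi k (v 0)) :=
    ((chS_SigF k (.var _)).fm.and (chP_PiF k (.var _)).fm).not
  have h1 : Fm (fun M _ (v : Fin 2 → M) => Tr (k + 1) (v 1) 0) := (Tr_SigF k (.var _) .zero).fm
  match t with
  | 0 => exact h0
  | 1 => exact h0.imp h1
  | _ + 2 => exact h0.imp h1.not

theorem exists_code {T U : Thy} (hT : GoodThy T) (hU : GoodThy U) (k : ℕ) :
    ∃ c : ℕ, ∀ t < 3, ∀ p : ℕ, (∃ N : ℕ, Wt t c p N) ↔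
      (Ent T (fun M _ => Fk k t M (c : M) (p : M)) ∨ Ent U (fun M _ => Fk k t M (c : M) (p : M))) := by
  have hA : ∀ t : ℕ, S1 (fun v : Fin 3 → ℕ => v 1 = pr t (v 2) ∧
      (Ent T (fun M _ => Fk k t M (v 0 : M) (v 2 : M)) ∨ Ent U (fun M _ => Fk k t M (v 0 : M) (v 2 : M)))) := by
    intro t
    refine S1.and ?_ ?_
    · exact (S1.ofD0 (R := fun M _ v => v 1 = pr (t : M) (v 2)) (.eq (.var _) (.pr (.nat t) (.var _))))
    · exact ((ent_fm hT (Fk_fm k t)).or (ent_fm hU (Fk_fm k t))).ren ![0, 2]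
  have hQ : S1 (fun v : Fin 2 → ℕ => ∃ p, (v 1 = pr 0 p ∧
      (Ent T (fun M _ => Fk k 0 M (v 0 : M) (p : M)) ∨ Ent U (fun M _ => Fk k 0 M (v 0 : M) (p : M)))) ∨
      (v 1 = pr 1 p ∧
      (Ent T (fun M _ => Fk k 1 M (v 0 : M) (p : M)) ∨ Ent U (fun M _ => Fk k 1 M (v 0 : M) (p : M)))) ∨
      (v 1 = pr 2 p ∧
      (Ent T (fun M _ => Fk k 2 M (v 0 : M) (p : M)) ∨ Ent U (fun M _ => Fk k 2 M (v 0 : M) (p : M))))) := by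
    apply S1.ex
    exact (hA 0).or ((hA 1).or (hA 2))
  obtain ⟨c, hc⟩ := hQ.sig
  refine ⟨c, fun t ht p => ?_⟩
  have h1 := hc ![c, pr t p]
  have e : stack ![c, pr t p] = pr (pr t p) (pr c 0) := rfl
  rw [e, Tr_one] at h1
  refine Iff.trans ?_ (h1.symm.trans ?_)
  · rfl
  · simp only [Matrix.cons_val_zero, Matrix.cons_val_one, pr_inj]
    interval_cases t
    · simp
    · simp
    · simp
end Guaspari

namespace Guaspari
set_option linter.unusedSimpArgs false
set_option linter.unusedVariables false

theorem d0_sp {m : ℕ} {φ : LA.BoundedFormula Empty m} (h : IsDelta0 φ) (k : ℕ) :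
    IsSigmaFml k φ ∧ IsPiFml k φ := by
  induction k with
  | zero => exact ⟨.ofDelta0 h, .ofDelta0 h⟩
  | succ k ih => exact ⟨.ofPi ih.2, .ofSigma ih.1⟩

theorem con_model {T S : Thy} (hT : ExtPA T) (h : Con (T ∪ S)) :
    ∃ (M : Type) (_ : PAM M), T.Model M ∧ ∀ φ ∈ S, M ⊨ φ := by
  unfold Con at h
  rw [prv_iff] at h
  push Not at h
  obtain ⟨M, i, hM, -⟩ := h
  have h1 : T.Model M := ⟨fun φ hφ => hM.realize_of_mem φ (Or.inl hφ)⟩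
  exact ⟨M, PAM.ofModel (pa_model hT h1), h1, fun φ hφ => hM.realize_of_mem φ (Or.inr hφ)⟩

/-- the fixed point property -/
def Codes (T U : Thy) (k c : ℕ) : Prop := ∀ t < 3, ∀ p : ℕ, (∃ N : ℕ, Wt t c p N) ↔
      (Ent T (fun M _ => Fk k t M (c : M) (p : M)) ∨ Ent U (fun M _ => Fk k t M (c : M) (p : M)))

theorem Codes.symm {T U : Thy} {k c : ℕ} (h : Codes T U k c) : Codes U T k c :=
  fun t ht p => (h t ht p).trans or_comm

theorem tr_true {T U : Thy} (hU : ExtPA U) {k p : ℕ} {M : Type} [PAM M]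
    (hM : ∀ φ ∈ ThIn (SigAndPiS (k + 1)) U, M ⊨ φ) (h : Ent U (fun K _ => Tr (k + 1) (p : K) 0)) :
    Tr (k + 1) (p : M) 0 := by
  obtain ⟨σ, h1, h2⟩ := Tr_SigF (m := 0) k (.nat p) .zero
  have h3 : M ⊨ (σ ⊓ (⊥ ⟹ ⊥) : Snt) := by
    refine hM _ ⟨⟨σ, h1, _, (d0_sp (.imp .falsum .falsum) (k + 1)).2, rfl⟩, (prv_pam hU).2 ?_⟩
    intro K _ hK
    refine (snt_iff _).2 (BoundedFormula.realize_inf.2 ⟨(h2 K _).2 (h K hK), ?_⟩)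
    exact fun h => h
  exact (h2 M _).1 (BoundedFormula.realize_inf.1 ((snt_iff _).1 h3)).1

theorem tr_false {T U : Thy} (hU : ExtPA U) {k p : ℕ} {M : Type} [PAM M]
    (hM : ∀ φ ∈ ThIn (SigAndPiS (k + 1)) U, M ⊨ φ) (h : Ent U (fun K _ => ¬ Tr (k + 1) (p : K) 0)) :
    ¬ Tr (k + 1) (p : M) 0 := by
  obtain ⟨σ, h1, h2⟩ := (Tr_SigF (m := 0) k (.nat p) .zero).neg
  have h3 : M ⊨ ((⊥ ⟹ ⊥) ⊓ σ : Snt) := by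
    refine hM _ ⟨⟨_, (d0_sp (.imp .falsum .falsum) (k + 1)).1, σ, h1, rfl⟩, (prv_pam hU).2 ?_⟩
    intro K _ hK
    refine (snt_iff _).2 (BoundedFormula.realize_inf.2 ⟨?_, (h2 K _).2 (h K hK)⟩)
    exact fun h => h
  exact (h2 M _).1 (BoundedFormula.realize_inf.1 ((snt_iff _).1 h3)).2

theorem no_prove {T U : Thy} (hT : GoodThy T) (hU : GoodThy U) {k c : ℕ} (hc : Codes T U k c)
    (hC : Con (T ∪ ThIn (SigAndPiS (k + 1)) U)) : ¬ Ent T (fun M _ => ¬ chi k (c : M)) := by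
  classical
  intro hE
  have h0 : ∃ N : ℕ, Wt 0 c 0 N := (hc 0 (by norm_num) 0).2 (Or.inl hE)
  obtain ⟨s, hs⟩ : ∃ s : ℕ, Lst c s :=
    ⟨Nat.find h0, Nat.find_spec h0, fun s' _ h => Nat.find_min h0 h⟩
  obtain ⟨M, _, hM, hS⟩ := con_model hT.2.2 hC
  refine hE M hM ⟨(chS_iff k _).2 ⟨s, (Lst_abs M c s).2 hs, fun p hp N hN hW => ?_⟩, ?_⟩
  · obtain ⟨p, hp', rfl⟩ := std_le _ _ hp
    obtain ⟨N, hN', rfl⟩ := std_le _ _ hN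
    have hW' : Wt 1 c p N := by
      have := Wt_abs M 1 c p N
      rw [Nat.cast_one] at this
      exact this.1 hW
    rcases (hc 1 (by norm_num) p).1 ⟨N, hW'⟩ with h | h
    · exact h M hM (hE M hM)
    · refine tr_true (T := T) hU.2.2 hS fun K _ hK => ?_
      by_cases hx : chi k (c : K)
      · obtain ⟨s1, h1, h2⟩ := (chS_iff k _).1 hx.1
        obtain rfl := Lst_unique ((Lst_abs K c s).2 hs) h1
        refine h2 p (Nat.cast_le.2 hp') N (Nat.cast_le.2 hN') ?_
        have := Wt_abs K 1 c p N
        rw [Nat.cast_one] at this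
        exact this.2 hW'
      · exact h K hK hx
  · rintro s1 p hp N hN ⟨h1, hW⟩
    obtain rfl := Lst_unique ((Lst_abs M c s).2 hs) h1
    obtain ⟨p, hp', rfl⟩ := std_le _ _ hp
    obtain ⟨N, hN', rfl⟩ := std_le _ _ hN
    have hW' : Wt 2 c p N := by
      have := Wt_abs M 2 c p N
      rw [Nat.cast_ofNat] at this
      exact this.1 hW
    rcases (hc 2 (by norm_num) p).1 ⟨N, hW'⟩ with h | h
    · exact h M hM (hE M hM)
    · refine tr_false (T := T) hU.2.2 hS fun K _ hK => ?_
      by_cases hx : chi k (c : K)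
      · refine hx.2 s p (Nat.cast_le.2 hp') N (Nat.cast_le.2 hN') ⟨(Lst_abs K c s).2 hs, ?_⟩
        have := Wt_abs K 2 c p N
        rw [Nat.cast_ofNat] at this
        exact this.2 hW'
      · exact h K hK hx

theorem hcons {T U : Thy} (hT : GoodThy T) {k c : ℕ} (hc : Codes T U k c)
    (hnT : ¬ Ent T (fun M _ => ¬ chi k (c : M))) (hnU : ¬ Ent U (fun M _ => ¬ chi k (c : M)))
    {φ : Snt} (hφ : ∀ (M : Type) [PAM M], M ⊨ φ ↔ ¬ chi k (c : M)) :
    HConsIn (SigAndPiS (k + 1)) T φ := by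
  rintro V ⟨hV, hVT⟩ γ ⟨σ, hσ, π, hπ, rfl⟩ h
  have h1 : Ent V (fun M _ => ¬ chi k (c : M) → M ⊨ (σ ⊓ π : Snt)) := by
    intro M _ hM hx
    refine prv_iff.1 h M _ ⟨fun ψ hψ => ?_⟩
    rcases hψ with rfl | hψ
    · exact (hφ M).2 hx
    · exact hM.realize_of_mem ψ hψ
  have h1T : Ent T (fun M _ => ¬ chi k (c : M) → M ⊨ (σ ⊓ π : Snt)) := by
    have : Prv V (φ ⟹ (σ ⊓ π)) := by
      refine (prv_pam hV).2 fun M _ hM => ?_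
      intro hf
      exact h1 M hM ((hφ M).1 hf)
    have := (prv_pam hT.2.2).1 (hVT _ this)
    intro M _ hM hx
    exact this M hM ((hφ M).2 hx)
  obtain ⟨a, ha⟩ := Tr_code.1 hσ
  obtain ⟨b, hb⟩ := Tr_code.2 hπ
  have ha1 : Ent T (fun M _ => Fk k 1 M (c : M) (a : M)) := by
    intro M _ hM hx
    exact (ha M ![]).1 (BoundedFormula.realize_inf.1 ((snt_iff _).1 (h1T M hM hx))).1
  have hb1 : Ent T (fun M _ => Fk k 2 M (c : M) (b : M)) := by
    intro M _ hM hx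
    exact (hb M ![]).1 (BoundedFormula.realize_inf.1 ((snt_iff _).1 (h1T M hM hx))).2
  obtain ⟨N1, hN1⟩ := (hc 1 (by norm_num) a).2 (Or.inl ha1)
  obtain ⟨N2, hN2⟩ := (hc 2 (by norm_num) b).2 (Or.inl hb1)
  have h0 : ¬ ∃ N : ℕ, Wt 0 c 0 N := fun h => ((hc 0 (by norm_num) 0).1 h).elim hnT hnU
  refine (prv_pam hV).2 fun M _ hM => ?_
  by_cases hx : chi k (c : M)
  · obtain ⟨s, hs, h2⟩ := (chS_iff k _).1 hx.1
    have hst : ∀ n : ℕ, (n : M) ≤ s := by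
      intro n
      by_contra hlt
      obtain ⟨j, _, rfl⟩ := std_le n s (le_of_not_ge hlt)
      exact h0 ⟨j, ((Lst_abs M c j).1 hs).1⟩
    refine (snt_iff _).2 (BoundedFormula.realize_inf.2 ⟨(ha M ![]).2 ?_, (hb M ![]).2 ?_⟩)
    · refine h2 a (hst _) N1 (hst _) ?_
      have := Wt_abs M 1 c a N1
      rw [Nat.cast_one] at this
      exact this.2 hN1
    · refine hx.2 s b (hst _) N2 (hst _) ⟨hs, ?_⟩
      have := Wt_abs M 2 c b N2
      rw [Nat.cast_ofNat] at this
      exact this.2 hN2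
  · exact h1 M hM hx

theorem one_two {T U : Thy} (hT : GoodThy T) (hU : GoodThy U) (k : ℕ) (h : Capair (k + 1) T U) :
    ∃ φ ∈ BSigmaS (k + 1), HConsIn (SigAndPiS (k + 1)) T φ ∧ HConsIn (SigAndPiS (k + 1)) U φ ∧
         φ ∉ Th T ∪ Th U := by
  obtain ⟨c, hc⟩ := exists_code hT hU k
  have hc : Codes T U k c := hc
  have hnT := no_prove hT hU hc h.1
  have hnU := no_prove hU hT hc.symm h.2
  obtain ⟨θ, h1, h2⟩ := chS_SigF (m := 0) k (.nat c)
  obtain ⟨η, h3, h4⟩ := (chP_PiF (m := 0) k (.nat c)).neg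
  have hφ : ∀ (M : Type) [PAM M], M ⊨ (∼(θ ⊓ ∼η) : Snt) ↔ ¬ chi k (c : M) := by
    intro M _
    rw [snt_iff, BoundedFormula.realize_not, BoundedFormula.realize_inf, BoundedFormula.realize_not, h2, h4]
    unfold chi
    tauto
  refine ⟨∼(θ ⊓ ∼η), .not (.inf (.base h1) (.not (.base h3))), hcons hT hc hnT hnU hφ,
    hcons hU hc.symm hnU hnT hφ, ?_⟩
  rintro (h | h)
  · exact hnT fun M _ hM => (hφ M).1 ((prv_pam hT.2.2).1 h M hM)
  · exact hnU fun M _ hM => (hφ M).1 ((prv_pam hU.2.2).1 h M hM)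

theorem four_half {T U : Thy} (hT : GoodThy T) (hU : GoodThy U) {n : ℕ} {φ : Snt}
    (h : HConsIn (SigAndPiS n) U φ) (hn : ¬ Prv T φ) : Con (T ∪ ThIn (SigAndPiS n) U) := by
  intro hC
  apply hn
  refine (prv_pam hT.2.2).2 fun M _ hM => ?_
  by_contra hx
  refine (prv_iff.1 hC M _ ⟨fun θ hθ => ?_⟩ : M ⊨ (⊥ : Snt))
  rcases hθ with hθ | ⟨hθ, hUθ⟩
  · exact hM.realize_of_mem θ hθ
  · have hE : ExtPA (PAAx ∪ {φ ⟹ θ}) := fun ψ hψ =>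
      prv_iff.2 fun K _ hK => hK.realize_of_mem ψ (Or.inl hψ)
    have hs : SubThy (PAAx ∪ {φ ⟹ θ}) U := by
      refine ⟨hE, fun ψ hψ => prv_iff.2 fun K _ hK => prv_iff.1 hψ K _ ⟨fun ρ hρ => ?_⟩⟩
      rcases hρ with hρ | rfl
      · exact (pa_model hU.2.2 hK).realize_of_mem ρ hρ
      · exact fun _ => prv_iff.1 hUθ K _ hK
    have h1 : Prv (PAAx ∪ {φ ⟹ θ}) θ := by
      refine h _ hs θ hθ (prv_iff.2 fun K _ hK => ?_)
      exact (hK.realize_of_mem (φ ⟹ θ) (Or.inr (Or.inr rfl)) : K ⊨ (φ ⟹ θ)) (hK.realize_of_mem φ (Or.inl rfl))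
    refine prv_iff.1 h1 M _ ⟨fun ρ hρ => ?_⟩
    rcases hρ with hρ | rfl
    · exact (pa_model hT.2.2 hM).realize_of_mem ρ hρ
    · exact fun hf => (hx hf).elim
end Guaspari

namespace Guaspari

/-- Theorem 8.2. -/
theorem stmt_18 (T U : Thy) (hT : GoodThy T) (hU : GoodThy U) (n : ℕ) (hn : 1 ≤ n) :
    List.TFAE
      [Capair n T U,
       ∃ φ ∈ BSigmaS n, HConsIn (SigAndPiS n) T φ ∧ HConsIn (SigAndPiS n) U φ ∧
         φ ∉ Th T ∪ Th U,
       ∃ φ : Snt, HConsIn (SigAndPiS n) T φ ∧ HConsIn (SigAndPiS n) U φ ∧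
         ∃ ψ ∈ BSigmaS n, Prv (add PAAx φ) ψ ∧ ¬ Prv T ψ ∧ ¬ Prv U ψ,
       ∃ φ : Snt, HConsIn (SigAndPiS n) T φ ∧ HConsIn (SigAndPiS n) U φ ∧
         φ ∉ Th T ∪ Th U] := by
  obtain ⟨k, rfl⟩ : ∃ k, n = k + 1 := ⟨n - 1, by omega⟩
  tfae_have 1 → 2 := one_two hT hU k
  tfae_have 2 → 3 := by
    rintro ⟨φ, hB, h1, h2, h3⟩
    refine ⟨φ, h1, h2, φ, hB, prv_iff.2 fun M _ hM => hM.realize_of_mem φ (Or.inl rfl), ?_, ?_⟩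
    · exact fun h => h3 (Or.inl h)
    · exact fun h => h3 (Or.inr h)
  tfae_have 3 → 4 := by
    rintro ⟨φ, h1, h2, ψ, hB, h3, h4, h5⟩
    have key : ∀ {S : Thy}, ExtPA S → Prv S φ → Prv S ψ := by
      intro S hS h
      refine prv_iff.2 fun M _ hM => prv_iff.1 h3 M _ ⟨fun ρ hρ => ?_⟩
      rcases hρ with rfl | hρ
      · exact prv_iff.1 h M _ hM
      · exact (pa_model hS hM).realize_of_mem ρ hρ
    refine ⟨φ, h1, h2, ?_⟩
    rintro (h | h)
    · exact h4 (key hT.2.2 h)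
    · exact h5 (key hU.2.2 h)
  tfae_have 4 → 1 := by
    rintro ⟨φ, h1, h2, h3⟩
    exact ⟨four_half hT hU h2 fun h => h3 (Or.inl h), four_half hU hT h1 fun h => h3 (Or.inr h)⟩
  tfae_finish

end Guaspari
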